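/- Every subgroup Γ of the Lorentzian isometry group E(m+1,1) = ℝ^{m+2} ⋊ O(m+1,1) that acts freely, properly discontinuously and cocompactly on ℝ^{m+2} is virtually solvable (the Auslander–Milnor conjecture holds for compact complete Lorentzian flat manifolds). -/

import Mathlib

noncomputable section

/-- `Vec n` is the euclidean space `ℝ^n`. -/
abbrev Vec (n : ℕ) : Type := Fin n → ℝ

/-- The group of invertible affine transformations of `ℝ^n`. -/
abbrev AffGroup (n : ℕ) := Vec n ≃ᵃ[ℝ] Vec n

/-- The standard Lorentz quadratic form `Q(x) = x₁² + ⋯ + x_{m+1}² − x_{m+2}²` on `ℝ^{m+2}`. -/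
def lorentzQ (m : ℕ) (x : Vec (m + 2)) : ℝ :=
  (∑ i : Fin (m + 1), x i.castSucc ^ 2) - x (Fin.last (m + 1)) ^ 2

/-- Membership in the Lorentzian similarity group
`Sim_L(ℝ^{m+2}) = ℝ^{m+2} ⋊ (O(m+1,1) × ℝ^+)`: the linear part is `λ • A` with `λ > 0`
and `A` a linear map preserving the Lorentz form. -/
def InSimL (m : ℕ) (g : AffGroup (m + 2)) : Prop :=
  ∃ (lam : ℝ) (A : Vec (m + 2) →ₗ[ℝ] Vec (m + 2)), 0 < lam ∧
    (∀ v, lorentzQ m (A v) = lorentzQ m v) ∧ ∀ v, g.linear v = lam • A v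

/-- Properly discontinuous action on `ℝ^n`. -/
def ProperlyDisc {n : ℕ} (Γ : Subgroup (AffGroup n)) : Prop :=
  ∀ K : Set (Vec n), IsCompact K →
    {γ : AffGroup n | γ ∈ Γ ∧ (⇑γ '' K ∩ K).Nonempty}.Finite

/-- Free action on `ℝ^n`. -/
def FreeAction {n : ℕ} (Γ : Subgroup (AffGroup n)) : Prop :=
  ∀ γ ∈ Γ, (∃ x : Vec n, γ x = x) → γ = 1

/-- Cocompact action on `ℝ^n`: some compact set meets every orbit. -/
def CocompactAction {n : ℕ} (Γ : Subgroup (AffGroup n)) : Prop :=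
  ∃ K : Set (Vec n), IsCompact K ∧ ∀ x : Vec n, ∃ γ ∈ Γ, γ x ∈ K

namespace LZ

/-! ### Lorentz algebra -/

/-- The polar bilinear form of the Lorentz form. -/
def lb (m : ℕ) : LinearMap.BilinForm ℝ (Vec (m + 2)) :=
  LinearMap.mk₂ ℝ (fun x y => (∑ i : Fin (m + 1), x i.castSucc * y i.castSucc)
      - x (Fin.last (m + 1)) * y (Fin.last (m + 1)))
    (by intro x x' y; simp [add_mul, Finset.sum_add_distrib]; ring)
    (by intro c x y; simp [mul_assoc, ← Finset.mul_sum]; ring)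
    (by intro x y y'; simp [mul_add, Finset.sum_add_distrib]; ring)
    (by intro c x y; simp; simp only [mul_sub, Finset.mul_sum]
        congr 1
        · exact Finset.sum_congr rfl (fun _ _ => by ring)
        · ring)

/-- time coordinate -/
def tm {m : ℕ} (x : Vec (m + 2)) : ℝ := x (Fin.last (m + 1))

/-- the space part of the form -/
def sp {m : ℕ} (x y : Vec (m + 2)) : ℝ := ∑ i : Fin (m + 1), x i.castSucc * y i.castSucc

variable {m : ℕ}

lemma lb_apply (x y : Vec (m + 2)) : lb m x y = sp x y - tm x * tm y := rfl

lemma lb_self (x : Vec (m + 2)) : lb m x x = lorentzQ m x := by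
  simp only [lb_apply, sp, tm, lorentzQ, pow_two]

lemma lb_comm (x y : Vec (m + 2)) : lb m x y = lb m y x := by
  simp only [lb_apply, sp, tm, mul_comm]

lemma lb_refl : (lb m).IsRefl := fun x y h => by rw [lb_comm]; exact h

lemma sp_self_nonneg (x : Vec (m + 2)) : 0 ≤ sp x x :=
  Finset.sum_nonneg fun _ _ => mul_self_nonneg _

lemma sp_cs (x y : Vec (m + 2)) : sp x y ^ 2 ≤ sp x x * sp y y := by
  have := Finset.sum_mul_sq_le_sq_mul_sq Finset.univ
    (fun i : Fin (m + 1) => x i.castSucc) (fun i => y i.castSucc)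
  simpa [sp, pow_two] using this

lemma Q_eq (x : Vec (m + 2)) : lorentzQ m x = sp x x - tm x ^ 2 := by
  rw [← lb_self, lb_apply]; ring

lemma eq_zero_of_sp_tm (x : Vec (m + 2)) (h : sp x x = 0) (h' : tm x = 0) : x = 0 := by
  have h1 := (Finset.sum_eq_zero_iff_of_nonneg (fun (i : Fin (m + 1)) _ =>
    mul_self_nonneg (x i.castSucc))).1 h
  funext j
  refine Fin.lastCases h' (fun i => ?_) j
  simpa using h1 i (Finset.mem_univ _)

lemma tm_add (x y : Vec (m + 2)) : tm (x + y) = tm x + tm y := rfl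
lemma tm_smul (c : ℝ) (x : Vec (m + 2)) : tm (c • x) = c * tm x := rfl
lemma tm_neg (x : Vec (m + 2)) : tm (-x) = - tm x := rfl
lemma tm_sub (x y : Vec (m + 2)) : tm (x - y) = tm x - tm y := rfl
lemma tm_zero : tm (0 : Vec (m + 2)) = 0 := rfl
lemma continuous_tm : Continuous (tm : Vec (m + 2) → ℝ) := continuous_apply _

lemma Q_smul (c : ℝ) (x : Vec (m + 2)) : lorentzQ m (c • x) = c ^ 2 * lorentzQ m x := by
  rw [← lb_self, ← lb_self]; simp; ring
lemma Q_neg (x : Vec (m + 2)) : lorentzQ m (-x) = lorentzQ m x := by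
  rw [← lb_self, ← lb_self]; simp
lemma Q_zero : lorentzQ m 0 = 0 := by rw [← lb_self]; simp
lemma Q_add (x y : Vec (m + 2)) :
    lorentzQ m (x + y) = lorentzQ m x + 2 * lb m x y + lorentzQ m y := by
  rw [← lb_self, ← lb_self, ← lb_self]; simp; rw [lb_comm y x]; ring
lemma Q_sub (x y : Vec (m + 2)) :
    lorentzQ m (x - y) = lorentzQ m x - 2 * lb m x y + lorentzQ m y := by
  rw [sub_eq_add_neg, Q_add, Q_neg]; simp; ring
lemma continuous_Q : Continuous (lorentzQ m) := by unfold lorentzQ; fun_prop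
lemma continuous_lb : Continuous (fun p : Vec (m + 2) × Vec (m + 2) => lb m p.1 p.2) := by
  simp only [lb_apply, sp, tm]; fun_prop

lemma tm_ne_zero {x : Vec (m + 2)} (h : lorentzQ m x ≤ 0) (hx : x ≠ 0) : tm x ≠ 0 := by
  intro h0
  apply hx
  rw [Q_eq, h0] at h
  exact eq_zero_of_sp_tm x (le_antisymm (by simpa using h) (sp_self_nonneg x)) h0

/-- vectors orthogonal to a causal vector are spacelike or null -/
lemma Q_nonneg_of_orth {v y : Vec (m + 2)} (hv : lorentzQ m v ≤ 0) (hv0 : v ≠ 0)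
    (h : lb m v y = 0) : 0 ≤ lorentzQ m y := by
  have ht := tm_ne_zero hv hv0
  rw [lb_apply] at h
  rw [Q_eq] at hv ⊢
  have hcs := sp_cs v y
  have h1 : (tm v * tm y) ^ 2 ≤ sp v v * sp y y := by
    rw [← sub_eq_zero.1 h]; exact hcs
  have h2 : tm v ^ 2 * tm y ^ 2 ≤ tm v ^ 2 * sp y y := by
    nlinarith [sp_self_nonneg y]
  have h3 : 0 < tm v ^ 2 := by positivity
  have := le_of_mul_le_mul_left h2 h3
  linarith

lemma Q_pos_of_orth {v y : Vec (m + 2)} (hv : lorentzQ m v < 0)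
    (h : lb m v y = 0) (hy : y ≠ 0) : 0 < lorentzQ m y := by
  have hv0 : v ≠ 0 := by rintro rfl; rw [Q_zero] at hv; exact lt_irrefl _ hv
  have ht := tm_ne_zero hv.le hv0
  rw [lb_apply] at h
  rw [Q_eq] at hv ⊢
  have hcs := sp_cs v y
  have h1 : (tm v * tm y) ^ 2 ≤ sp v v * sp y y := by
    rw [← sub_eq_zero.1 h]; exact hcs
  have h3 : 0 < tm v ^ 2 := by positivity
  rcases (sp_self_nonneg y).eq_or_lt with h0 | h0
  · exfalso
    rw [← h0] at h1
    have h5 : (tm v * tm y) ^ 2 = 0 := le_antisymm (by simpa using h1) (sq_nonneg _)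
    have : tm y = 0 := by
      have := pow_eq_zero_iff (two_ne_zero) |>.1 h5
      exact (mul_eq_zero.1 this).resolve_left ht
    exact hy (eq_zero_of_sp_tm y h0.symm this)
  · have h2 : tm v ^ 2 * tm y ^ 2 < tm v ^ 2 * sp y y := by nlinarith
    have := lt_of_mul_lt_mul_left h2 h3.le
    linarith

/-- Two orthogonal null vectors are proportional. -/
lemma null_prop {x y : Vec (m + 2)} (hx : lorentzQ m x = 0) (hx0 : x ≠ 0)
    (hy : lorentzQ m y = 0) (h : lb m x y = 0) : y = (tm y / tm x) • x := by
  have ht := tm_ne_zero hx.le hx0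
  set z := y - (tm y / tm x) • x with hz
  have hz1 : lorentzQ m z = 0 := by
    rw [hz, Q_sub, Q_smul, hx, hy, map_smul, lb_comm, h]; simp
  have hz2 : tm z = 0 := by
    rw [hz, tm_sub, tm_smul]; field_simp; ring
  by_contra hne
  exact tm_ne_zero hz1.le (sub_ne_zero.2 hne) hz2

/-- reverse sign inequality -/
lemma lb_nonpos {x y : Vec (m + 2)} (hx : lorentzQ m x ≤ 0) (hxt : 0 < tm x)
    (hy : lorentzQ m y ≤ 0) (hyt : 0 < tm y) : lb m x y ≤ 0 := by
  rw [Q_eq] at hx hy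
  rw [lb_apply]
  have := sp_cs x y
  have h2 : sp x y ^ 2 ≤ (tm x * tm y) ^ 2 := by
    nlinarith [sp_self_nonneg x, sp_self_nonneg y, sq_nonneg (tm x), sq_nonneg (tm y)]
  have := abs_le_of_sq_le_sq h2 (by positivity)
  linarith [le_abs_self (sp x y)]

lemma lb_neg {x y : Vec (m + 2)} (hx : lorentzQ m x < 0) (hxt : 0 < tm x)
    (hy : lorentzQ m y ≤ 0) (hyt : 0 < tm y) : lb m x y < 0 := by
  refine lt_of_le_of_ne (lb_nonpos hx.le hxt hy hyt) fun h => ?_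
  have hy0 : y ≠ 0 := by rintro rfl; simp [tm_zero] at hyt
  exact absurd (Q_pos_of_orth hx h hy0) (not_lt.2 hy)

/-- linear maps preserving the form -/
def Lor (m : ℕ) (L : Vec (m + 2) →L[ℝ] Vec (m + 2)) : Prop :=
  ∀ v, lorentzQ m (L v) = lorentzQ m v

lemma Lor.lb {L : Vec (m + 2) →L[ℝ] Vec (m + 2)} (h : Lor m L) (x y : Vec (m + 2)) :
    lb m (L x) (L y) = lb m x y := by
  have := h (x + y)
  rw [map_add, Q_add, Q_add, h, h] at this
  linarith

/-- time orientation preserving -/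
def TP (L : Vec (m + 2) →L[ℝ] Vec (m + 2)) : Prop :=
  ∀ x, lorentzQ m x ≤ 0 → 0 < tm x → 0 < tm (L x)

/-- the standard future timelike vector -/
def e0 (m : ℕ) : Vec (m + 2) := Pi.single (Fin.last (m + 1)) 1

lemma tm_e0 : tm (e0 m) = 1 := by simp [tm, e0]
lemma sp_e0 (x : Vec (m + 2)) : sp (e0 m) x = 0 := by
  unfold sp e0
  refine Finset.sum_eq_zero fun i _ => ?_
  rw [Pi.single_eq_of_ne (Fin.castSucc_lt_last i).ne]; simp
lemma Q_e0 : lorentzQ m (e0 m) = -1 := by rw [Q_eq, sp_e0, tm_e0]; norm_num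
lemma lb_e0 (x : Vec (m + 2)) : lb m (e0 m) x = - tm x := by
  rw [lb_apply, sp_e0, tm_e0]; ring

lemma TP_of_e0 {L : Vec (m + 2) →L[ℝ] Vec (m + 2)} (h : Lor m L) (h0 : 0 < tm (L (e0 m))) :
    TP L := by
  intro x hx hxt
  have hx0 : x ≠ 0 := by rintro rfl; simp [tm_zero] at hxt
  have hb : lb m (L (e0 m)) (L x) < 0 := by rw [h.lb, lb_e0]; linarith
  have hQ : lorentzQ m (L x) ≤ 0 := by rw [h]; exact hx
  by_contra hcon
  rcases (not_lt.1 hcon).eq_or_lt with h1 | h1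
  · have : L x = 0 := by
      by_contra hne; exact tm_ne_zero hQ hne h1
    rw [this] at hb; simp at hb
  · have := lb_nonpos (m := m) (x := L (e0 m)) (y := - L x) (by rw [h, Q_e0]; norm_num) h0
      (by rw [Q_neg]; exact hQ) (by rw [tm_neg]; linarith)
    simp at this
    linarith

/-- if `L` is not time preserving then `-L` is -/
lemma tm_neg_of_not {L : Vec (m + 2) →L[ℝ] Vec (m + 2)} (h : Lor m L)
    (h0 : ¬ 0 < tm (L (e0 m))) {x} (hx : lorentzQ m x ≤ 0) (hxt : 0 < tm x) : tm (L x) < 0 := by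
  have h1 : tm (L (e0 m)) ≠ 0 := by
    apply tm_ne_zero (by rw [h, Q_e0]; norm_num)
    intro h2
    have := h (e0 m); rw [h2, Q_zero, Q_e0] at this; norm_num at this
  have h3 : Lor m (-L) := fun v => by simp [Q_neg, h v]
  have := TP_of_e0 h3 (by simp [tm_neg]; exact lt_of_le_of_ne (not_lt.1 h0) h1) x hx hxt
  simp [tm_neg] at this
  exact this

/-- A causal vector whose line is preserved: the eigenvalue. -/
lemma eig_of_timelike {L : Vec (m + 2) →L[ℝ] Vec (m + 2)} (h : Lor m L) (ht : TP L)
    {x : Vec (m + 2)} (hx : lorentzQ m x < 0) (hxt : 0 < tm x) {c : ℝ} (hc : L x = c • x) :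
    L x = x := by
  have h1 := h x
  rw [hc, Q_smul] at h1
  have h2 : c ^ 2 = 1 := by
    have := mul_right_cancel₀ hx.ne (h1.trans (one_mul _).symm); exact this
  have h3 := ht x hx.le hxt
  rw [hc, tm_smul] at h3
  have h4 : 0 < c := pos_of_mul_pos_left h3 hxt.le
  have : c = 1 := by nlinarith
  rw [hc, this, one_smul]

/-! ### Projections -/

/-- orthogonal projection onto a nondegenerate subspace's complement -/
lemma exists_proj (D : Submodule ℝ (Vec (m + 2)))
    (hD : ∀ x ∈ D, (∀ y ∈ D, lb m y x = 0) → x = 0) :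
    ∃ P : Vec (m + 2) →L[ℝ] Vec (m + 2), (∀ x, ∀ y ∈ D, lb m y (P x) = 0) ∧
      (∀ x, x - P x ∈ D) ∧ (∀ x ∈ D, P x = 0) ∧
      (∀ x, (∀ y ∈ D, lb m y x = 0) → P x = x) := by
  have hc : IsCompl D ((lb m).orthogonal D) := by
    rw [LinearMap.BilinForm.isCompl_orthogonal_iff_disjoint lb_refl, Submodule.disjoint_def]
    intro x hx hx'
    exact hD x hx fun y hy => hx' y hy
  refine ⟨LinearMap.toContinuousLinearMap (Submodule.projection _ _ hc.symm), ?_, ?_, ?_, ?_⟩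
  · intro x y hy
    have : Submodule.projection _ _ hc.symm x ∈ (lb m).orthogonal D := by
      simp
    exact this y hy
  · intro x
    exact Submodule.sub_projection_mem hc.symm x
  · intro x hx
    simpa using hx
  · intro x hx
    have : x ∈ (lb m).orthogonal D := fun y hy => hx y hy
    simpa using this

/-- the projection commutes with isometries preserving the subspace -/
lemma proj_comm {D : Submodule ℝ (Vec (m + 2))} {P L : Vec (m + 2) →L[ℝ] Vec (m + 2)}
    (h1 : ∀ x, ∀ y ∈ D, lb m y (P x) = 0) (h2 : ∀ x, x - P x ∈ D) (h3 : ∀ x ∈ D, P x = 0)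
    (h4 : ∀ x, (∀ y ∈ D, lb m y x = 0) → P x = x) (hL : Lor m L)
    (hD : ∀ x ∈ D, L x ∈ D) (hD' : ∀ x ∈ D, ∃ y ∈ D, L y = x) (x) : P (L x) = L (P x) := by
  have e : L x = L (P x) + L (x - P x) := by rw [← map_add]; congr 1; abel
  rw [e, map_add, h3 _ (hD _ (h2 x)), add_zero]
  apply h4
  intro y hy
  obtain ⟨z, hz, rfl⟩ := hD' y hy
  rw [hL.lb]; exact h1 x z hz

/-- positive definiteness gives a norm bound -/
lemma def_bound (X : Submodule ℝ (Vec (m + 2))) (hX : ∀ x ∈ X, x ≠ 0 → 0 < lorentzQ m x) :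
    ∃ κ : ℝ, 0 < κ ∧ ∀ x ∈ X, κ * ‖x‖ ^ 2 ≤ lorentzQ m x := by
  have hcpt : IsCompact (Metric.sphere (0 : Vec (m + 2)) 1 ∩ (X : Set (Vec (m + 2)))) :=
    (isCompact_sphere _ _).inter_right X.closed_of_finiteDimensional
  rcases (Metric.sphere (0 : Vec (m + 2)) 1 ∩ (X : Set (Vec (m + 2)))).eq_empty_or_nonempty
    with he | hne
  · refine ⟨1, one_pos, fun x hx => ?_⟩
    by_cases h0 : x = 0
    · simp [h0, Q_zero]
    · exfalso
      have : (‖x‖⁻¹ • x) ∈ Metric.sphere (0 : Vec (m + 2)) 1 ∩ (X : Set (Vec (m + 2))) :=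
        ⟨by simp [norm_smul, h0], X.smul_mem _ hx⟩
      rw [he] at this; exact this
  · obtain ⟨z, hz, hmin⟩ := hcpt.exists_isMinOn hne continuous_Q.continuousOn
    have hz0 : z ≠ 0 := by
      rintro rfl; simpa using hz.1
    refine ⟨lorentzQ m z, hX z hz.2 hz0, fun x hx => ?_⟩
    by_cases h0 : x = 0
    · simp [h0, Q_zero]
    · have h1 : (‖x‖⁻¹ • x) ∈ Metric.sphere (0 : Vec (m + 2)) 1 ∩ (X : Set (Vec (m + 2))) :=
        ⟨by simp [norm_smul, h0], X.smul_mem _ hx⟩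
      have h2 : lorentzQ m z ≤ lorentzQ m (‖x‖⁻¹ • x) := hmin h1
      rw [Q_smul] at h2
      have h3 : 0 < ‖x‖ := norm_pos_iff.2 h0
      calc lorentzQ m z * ‖x‖ ^ 2 ≤ (‖x‖⁻¹ ^ 2 * lorentzQ m x) * ‖x‖ ^ 2 := by gcongr
        _ = lorentzQ m x := by field_simp

lemma Q_le_norm : ∃ C : ℝ, 0 < C ∧ ∀ x : Vec (m + 2), lorentzQ m x ≤ C * ‖x‖ ^ 2 := by
  refine ⟨m + 1, by positivity, fun x => ?_⟩
  unfold lorentzQ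
  have : ∑ i : Fin (m + 1), x i.castSucc ^ 2 ≤ ∑ i : Fin (m + 1), ‖x‖ ^ 2 := by
    refine Finset.sum_le_sum fun i _ => ?_
    rw [← sq_abs]
    have := norm_le_pi_norm x i.castSucc
    rw [Real.norm_eq_abs] at this
    gcongr
  simp at this
  nlinarith [sq_nonneg (x (Fin.last (m + 1)))]

/-- Boundedness of isometries on a positive definite subspace. -/
lemma bounded_on_def (X : Submodule ℝ (Vec (m + 2))) (hX : ∀ x ∈ X, x ≠ 0 → 0 < lorentzQ m x)
    (P : Vec (m + 2) →L[ℝ] Vec (m + 2)) :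
    ∃ C : ℝ, 0 < C ∧ ∀ M : Vec (m + 2) →L[ℝ] Vec (m + 2),
      (∀ x, M x ∈ X ∧ lorentzQ m (M x) = lorentzQ m (P x)) → ‖M‖ ≤ C := by
  obtain ⟨κ, hκ, hκ'⟩ := def_bound X hX
  obtain ⟨C, hC, hC'⟩ := Q_le_norm (m := m)
  refine ⟨Real.sqrt (C / κ) * (‖P‖ + 1), by positivity, fun M hM => ?_⟩
  refine M.opNorm_le_bound (by positivity) fun x => ?_
  have h1 := hκ' _ (hM x).1
  rw [(hM x).2] at h1
  have h2 := hC' (P x)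
  have h3 : ‖M x‖ ^ 2 ≤ (C / κ) * ‖P x‖ ^ 2 := by
    rw [div_mul_eq_mul_div, le_div_iff₀ hκ]; linarith
  have h4 : ‖M x‖ ≤ Real.sqrt (C / κ) * ‖P x‖ := by
    rw [← Real.sqrt_sq (norm_nonneg (M x)), ← Real.sqrt_sq (norm_nonneg (P x)),
      ← Real.sqrt_mul (by positivity)]
    exact Real.sqrt_le_sqrt h3
  calc ‖M x‖ ≤ Real.sqrt (C / κ) * ‖P x‖ := h4
    _ ≤ Real.sqrt (C / κ) * (‖P‖ * ‖x‖) := by gcongr; exact P.le_opNorm x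
    _ ≤ Real.sqrt (C / κ) * ((‖P‖ + 1) * ‖x‖) := by gcongr; linarith
    _ = _ := by ring

end LZ

namespace LZ
open scoped commutatorElement

/-! ### Group theory -/

/-- virtually solvable subgroup -/
def VS {G : Type*} [Group G] (Γ : Subgroup G) : Prop :=
  ∃ H : Subgroup G, H ≤ Γ ∧ H.relIndex Γ ≠ 0 ∧ Group.IsSolvable H

lemma VS.of_le {G : Type*} [Group G] {Γ' Γ : Subgroup G} (h : VS Γ') (hle : Γ' ≤ Γ)
    (hi : Γ'.relIndex Γ ≠ 0) : VS Γ := by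
  obtain ⟨H, h1, h2, h3⟩ := h
  refine ⟨H, h1.trans hle, ?_, h3⟩
  rw [← Subgroup.relIndex_mul_relIndex H Γ' Γ h1 hle]
  exact mul_ne_zero h2 hi

lemma solv_step {G : Type*} [Group G] {H K : Subgroup G} (hK : Group.IsSolvable K)
    (h : ∀ x ∈ H, ∀ y ∈ H, ⁅x, y⁆ ∈ K) : Group.IsSolvable H := by
  have h1 : (commutator H).map H.subtype ≤ K := by
    rw [commutator_def, Subgroup.map_le_iff_le_comap, Subgroup.commutator_le]
    intro x _ y _
    exact h x x.2 y y.2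
  have h2 : Group.IsSolvable (commutator H) := by
    have hs : Group.IsSolvable ((commutator H).map H.subtype : Subgroup G) :=
      Group.isSolvable_of_isSolvable_injective (Subgroup.inclusion_injective h1)
    exact Group.isSolvable_of_isSolvable_injective
      (f := ((commutator H).equivMapOfInjective H.subtype H.subtype_injective).toMonoidHom)
      ((commutator H).equivMapOfInjective H.subtype H.subtype_injective).injective
  have : Group.IsSolvable (Abelianization H) := inferInstance
  refine Group.isSolvable_of_ker_le_range (commutator H).subtype (Abelianization.of) ?_
  rw [Abelianization.ker_of, Subgroup.range_subtype]

lemma solv_of_comm {G : Type*} [Group G] {H : Subgroup G}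
    (h : ∀ x ∈ H, ∀ y ∈ H, ⁅x, y⁆ = 1) : Group.IsSolvable H :=
  solv_step (K := ⊥) inferInstance fun x hx y hy => by rw [h x hx y hy]; exact Subgroup.mem_bot.2 rfl

/-- finite extension lemma at type level -/
lemma FL_type {G : Type*} [Group G] (A N : Subgroup G) [A.Normal] [N.Normal] (hAN : A ≤ N)
    (hA : Group.IsSolvable A) (hi : A.relIndex N ≠ 0) (K : Subgroup G)
    (hK : ∀ x y : G, ⁅x, y⁆ ∈ K) (hKN : ∀ x ∈ K, ∀ y ∈ K, ⁅x, y⁆ ∈ N) :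
    ∃ H : Subgroup G, H.FiniteIndex ∧ Group.IsSolvable H := by
  classical
  let π := QuotientGroup.mk' A
  let Nb : Subgroup (G ⧸ A) := N.map π
  have : Nb.Normal := Subgroup.Normal.map inferInstance _ (QuotientGroup.mk'_surjective A)
  have : Finite Nb := by
    have : (A.subgroupOf N).FiniteIndex := ⟨hi⟩
    have : Finite (N ⧸ A.subgroupOf N) := inferInstance
    let f : N →* Nb := π.subgroupMap N
    have hf : Function.Surjective f := π.subgroupMap_surjective N
    have hk : A.subgroupOf N ≤ f.ker := by
      intro x hx
      rw [MonoidHom.mem_ker]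
      apply Subtype.ext
      exact (QuotientGroup.eq_one_iff (x : G)).2 hx
    exact Finite.of_surjective (QuotientGroup.lift (A.subgroupOf N) f hk)
      (QuotientGroup.lift_surjective_of_surjective _ _ hf _)
  let c : (G ⧸ A) →* MulAut Nb := MulAut.conjNormal
  have : Finite (MulAut Nb) := Finite.of_injective (fun e : MulAut Nb => (e : Nb → Nb))
    (fun a b h => MulEquiv.ext (fun x => congrFun h x))
  have : c.ker.FiniteIndex := inferInstance
  let H : Subgroup G := c.ker.comap π
  have hcomm : ∀ x ∈ H, ∀ n ∈ N, ⁅x, n⁆ ∈ A := by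
    intro x hx n hn
    have h1 : c (π x) = 1 := hx
    have h2 := congrArg (fun e : MulAut Nb => ((e ⟨π n, ⟨n, hn, rfl⟩⟩ : Nb) : G ⧸ A)) h1
    simp only [c, MulAut.conjNormal_apply, MulAut.one_apply] at h2
    rw [← QuotientGroup.eq_one_iff]
    change π ⁅x, n⁆ = 1
    rw [map_commutatorElement, commutatorElement_def, h2, mul_inv_cancel]
  refine ⟨H, ⟨?_⟩, ?_⟩
  · rw [Subgroup.index_comap_of_surjective _ (QuotientGroup.mk'_surjective A)]
    exact Subgroup.FiniteIndex.index_ne_zero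
  refine solv_step (K := H ⊓ K) ?_ (fun x hx y hy => ⟨?_, hK x y⟩)
  · refine solv_step (K := H ⊓ N) ?_ (fun x hx y hy => ⟨?_, hKN x hx.2 y hy.2⟩)
    · exact solv_step (K := A) hA fun x hx y hy => hcomm x hx.1 y hy.2
    · exact H.mul_mem (H.mul_mem (H.mul_mem hx.1 hy.1) (H.inv_mem hx.1)) (H.inv_mem hy.1)
  · exact H.mul_mem (H.mul_mem (H.mul_mem hx hy) (H.inv_mem hx)) (H.inv_mem hy)

/-- finite extension lemma, subgroup version -/
lemma FL {G : Type*} [Group G] (A N K Γ : Subgroup G) (hAN : A ≤ N) (hNΓ : N ≤ Γ)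
    (hA : Group.IsSolvable A) (hi : A.relIndex N ≠ 0)
    (hAn : ∀ g ∈ Γ, ∀ a ∈ A, g * a * g⁻¹ ∈ A) (hNn : ∀ g ∈ Γ, ∀ a ∈ N, g * a * g⁻¹ ∈ N)
    (hK : ∀ x ∈ Γ, ∀ y ∈ Γ, ⁅x, y⁆ ∈ K) (hKN : ∀ x ∈ K, ∀ y ∈ K, ⁅x, y⁆ ∈ N) : VS Γ := by
  have h1 : (A.subgroupOf Γ).Normal := ⟨fun n hn g => hAn g g.2 n hn⟩
  have h2 : (N.subgroupOf Γ).Normal := ⟨fun n hn g => hNn g g.2 n hn⟩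
  obtain ⟨H, hH1, hH2⟩ := FL_type (A.subgroupOf Γ) (N.subgroupOf Γ)
    (fun x hx => hAN hx)
    (Group.isSolvable_of_isSolvable_injective
      (f := ((Subgroup.subgroupOfEquivOfLe (hAN.trans hNΓ)) : _ →* A)) (MulEquiv.injective _))
    (by rw [Subgroup.relIndex_subgroupOf hNΓ]; exact hi)
    (K.subgroupOf Γ) (fun x y => hK x x.2 y y.2) (fun x hx y hy => hKN x hx y hy)
  refine ⟨H.map Γ.subtype, ?_, ?_, ?_⟩
  · exact Subgroup.map_subtype_le H
  · rw [Subgroup.relIndex]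
    have : (H.map Γ.subtype).subgroupOf Γ = H := by
      rw [Subgroup.subgroupOf, Subgroup.comap_map_eq_self_of_injective Γ.subtype_injective]
    rw [this]; exact hH1.1
  · exact Group.isSolvable_of_isSolvable_injective
      (f := (H.equivMapOfInjective Γ.subtype Γ.subtype_injective).symm.toMonoidHom)
      (H.equivMapOfInjective Γ.subtype Γ.subtype_injective).symm.injective

end LZ

namespace LZ
open scoped commutatorElement

/-! ### Zassenhaus type estimates -/

/-- commutators of a given weight -/
def cw {G : Type*} [Group G] (S : Set G) : ℕ → Set G
  | 0 => S
  | k + 1 => {x | ∃ s ∈ S, ∃ c ∈ cw S k, x = ⁅s, c⁆}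

/-- iterated commutator -/
def itc {G : Type*} [Group G] (a b : G) : ℕ → G
  | 0 => b
  | k + 1 => ⁅a, itc a b k⁆

lemma itc_mem_cw {G : Type*} [Group G] (a b : G) (k : ℕ) : itc a b k ∈ cw {a, b} k := by
  induction k with
  | zero => simp [itc, cw]
  | succ k ih => exact ⟨a, by simp, _, ih, rfl⟩

section Z
variable {G E : Type*} [Group G] [NormedAddCommGroup E] [NormedSpace ℝ E]

lemma norm_one_le : ‖(1 : E →L[ℝ] E)‖ ≤ 1 := ContinuousLinearMap.norm_id_le

lemma norm_inv_le (σ : G →* (E →L[ℝ] E)) {s : G} (hs : ‖σ s - 1‖ ≤ 1 / 10) :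
    ‖σ s⁻¹‖ ≤ 10 / 9 := by
  have h1 : σ s * σ s⁻¹ = 1 := by rw [← map_mul, mul_inv_cancel, map_one]
  have h2 : σ s⁻¹ = 1 - (σ s - 1) * σ s⁻¹ := by rw [sub_mul, h1, one_mul]; abel
  have h3 : ‖σ s⁻¹‖ ≤ ‖(1 : E →L[ℝ] E)‖ + ‖(σ s - 1) * σ s⁻¹‖ := by
    conv_lhs => rw [h2]
    exact norm_sub_le _ _
  have h4 := norm_mul_le (σ s - 1) (σ s⁻¹)
  have h5 := norm_one_le (E := E)
  nlinarith [norm_nonneg (σ s⁻¹)]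

lemma comm_sub_one (σ : G →* (E →L[ℝ] E)) (s c : G) :
    σ ⁅s, c⁆ - 1 = ((σ s - 1) * (σ c - 1) - (σ c - 1) * (σ s - 1)) * (σ s⁻¹ * σ c⁻¹) := by
  have h : (σ s - 1) * (σ c - 1) - (σ c - 1) * (σ s - 1) = σ (s * c) - σ (c * s) := by
    rw [map_mul, map_mul]; noncomm_ring
  rw [h, sub_mul, ← map_mul, ← map_mul, ← map_mul, commutatorElement_def]
  congr 1
  · congr 1; group
  · rw [← map_one σ]; congr 1; group

lemma norm_comm_sub_one (σ : G →* (E →L[ℝ] E)) (s c : G) :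
    ‖σ ⁅s, c⁆ - 1‖ ≤ 2 * (‖σ s - 1‖ * ‖σ c - 1‖) * (‖σ s⁻¹‖ * ‖σ c⁻¹‖) := by
  rw [comm_sub_one]
  refine (norm_mul_le _ _).trans ?_
  gcongr
  · refine (norm_sub_le _ _).trans ?_
    have := norm_mul_le (σ s - 1) (σ c - 1)
    have := norm_mul_le (σ c - 1) (σ s - 1)
    linarith
  · exact norm_mul_le _ _

lemma z_step_lin (σ : G →* (E →L[ℝ] E)) {s c : G} (hs : ‖σ s - 1‖ ≤ 1 / 10)
    (hc : ‖σ c - 1‖ ≤ 1 / 10) : ‖σ ⁅s, c⁆ - 1‖ ≤ ‖σ c - 1‖ / 4 := by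
  refine (norm_comm_sub_one σ s c).trans ?_
  have h1 := norm_inv_le σ hs
  have h2 := norm_inv_le σ hc
  have h3 : ‖σ s⁻¹‖ * ‖σ c⁻¹‖ ≤ 10 / 9 * (10 / 9) := by gcongr
  calc _ ≤ 2 * (1 / 10 * ‖σ c - 1‖) * (10 / 9 * (10 / 9)) := by gcongr
    _ ≤ _ := by nlinarith [norm_nonneg (σ c - 1)]

lemma z_step_tau (σ : G →* (E →L[ℝ] E)) (τ : G → E)
    (hτ : ∀ g h, τ (g * h) = τ g + σ g (τ h)) {s c : G} (hs : ‖σ s - 1‖ ≤ 1 / 10)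
    (hc : ‖σ c - 1‖ ≤ 1 / 10) :
    ‖τ ⁅s, c⁆‖ ≤ 1275 / 1000 * ‖σ c - 1‖ * ‖τ s‖ + ‖τ c‖ / 8 := by
  set d := ⁅s, c⁆ with hd
  have hD := z_step_lin σ hs hc
  rw [← hd] at hD
  have e : s * c = d * (c * s) := by rw [hd, commutatorElement_def]; group
  have e2 : τ d = (1 - σ d * σ c) (τ s) + (σ s - σ d) (τ c) := by
    have := congrArg τ e
    rw [hτ, hτ, hτ, map_add] at this
    simp only [sub_apply, one_apply_eq_self,
      mul_apply_eq_comp]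
    have h2 : τ d = τ s + σ s (τ c) - (σ d (τ c) + σ d (σ c (τ s))) := by
      rw [this]; abel
    rw [h2]; abel
  rw [e2]
  have h1 : ‖1 - σ d * σ c‖ ≤ 1275 / 1000 * ‖σ c - 1‖ := by
    have : 1 - σ d * σ c = -((σ d - 1) * (σ c - 1) + (σ d - 1) + (σ c - 1)) := by noncomm_ring
    rw [this, norm_neg]
    have h3 := norm_mul_le (σ d - 1) (σ c - 1)
    have h4 := norm_add_le ((σ d - 1) * (σ c - 1) + (σ d - 1)) (σ c - 1)
    have h5 := norm_add_le ((σ d - 1) * (σ c - 1)) (σ d - 1)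
    nlinarith [norm_nonneg (σ c - 1), norm_nonneg (σ d - 1)]
  have h2 : ‖σ s - σ d‖ ≤ 1 / 8 := by
    have : σ s - σ d = (σ s - 1) - (σ d - 1) := by abel
    rw [this]
    have := norm_sub_le (σ s - 1) (σ d - 1)
    linarith
  refine (norm_add_le _ _).trans ?_
  have h3 := (1 - σ d * σ c).le_of_opNorm_le h1 (τ s)
  have h4 := (σ s - σ d).le_of_opNorm_le h2 (τ c)
  linarith

lemma z_est (σ : G →* (E →L[ℝ] E)) (τ : G → E)
    (hτ : ∀ g h, τ (g * h) = τ g + σ g (τ h)) {S : Set G} {R : ℝ}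
    (hs : ∀ s ∈ S, ‖σ s - 1‖ ≤ 1 / 10) (hR : ∀ s ∈ S, ‖τ s‖ ≤ R) (k : ℕ) :
    ∀ c ∈ cw S k, ‖σ c - 1‖ ≤ 1 / 10 * (1 / 2) ^ k ∧ ‖σ c - 1‖ ≤ 1 / 10 * (1 / 4) ^ k ∧
      ‖τ c‖ ≤ R * (1 / 2) ^ k := by
  induction k with
  | zero => intro c hc; simpa using ⟨by simpa using hs c hc, hR c hc⟩
  | succ k ih =>
    rintro _ ⟨s, hsS, c, hc, rfl⟩
    obtain ⟨h1, h2, h3⟩ := ih c hc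
    have hp : (1 / 2 : ℝ) ^ k ≤ 1 := pow_le_one₀ (by norm_num) (by norm_num)
    have hp0 : (0 : ℝ) < (1 / 2) ^ k := by positivity
    have hq : (1 / 4 : ℝ) ^ k ≤ (1 / 2) ^ k := by gcongr; norm_num
    have hq0 : (0 : ℝ) < (1 / 4) ^ k := by positivity
    have hR0 : 0 ≤ R := (norm_nonneg _).trans (hR s hsS)
    have hc10 : ‖σ c - 1‖ ≤ 1 / 10 := by linarith
    have h4 := z_step_lin σ (hs s hsS) hc10
    have h5 := z_step_tau σ τ hτ (hs s hsS) hc10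
    rw [pow_succ, pow_succ]
    refine ⟨by linarith, by linarith, h5.trans ?_⟩
    have h6 : ‖σ c - 1‖ * ‖τ s‖ ≤ (1 / 10 * (1 / 2) ^ k) * R := by
      gcongr
      exact hR s hsS
    nlinarith [mul_nonneg hR0 hp0.le]

/-- Zassenhaus lemma -/
lemma zass (σ : G →* (E →L[ℝ] E)) (τ : G → E)
    (hτ : ∀ g h, τ (g * h) = τ g + σ g (τ h))
    (hfin : ∀ R : ℝ, ((fun g => (σ g, τ g)) '' {g | ‖τ g‖ ≤ R}).Finite)
    {S : Set G} (hS : S.Finite) (hs : ∀ s ∈ S, ‖σ s - 1‖ ≤ 1 / 10) :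
    ∃ K, ∀ k ≥ K, ∀ c ∈ cw S k, σ c = 1 ∧ τ c = 0 := by
  obtain ⟨R, hR⟩ : ∃ R : ℝ, ∀ s ∈ S, ‖τ s‖ ≤ R := by
    obtain ⟨R, hR⟩ := (hS.image (fun s => ‖τ s‖)).bddAbove
    exact ⟨R, fun s hs => hR ⟨s, hs, rfl⟩⟩
  set R' := max R 0
  have hR' : ∀ s ∈ S, ‖τ s‖ ≤ R' := fun s hs => (hR s hs).trans (le_max_left _ _)
  have hR0 : 0 ≤ R' := le_max_right _ _
  have hcl := ((hfin R').subset (Set.sdiff_subset (t := {((1 : E →L[ℝ] E), (0 : E))}))).isClosed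
  obtain ⟨η, hη, hball⟩ := Metric.isOpen_iff.1 hcl.isOpen_compl ((1 : E →L[ℝ] E), (0 : E))
    (by simp)
  have hpow := tendsto_pow_atTop_nhds_zero_of_lt_one (r := (1 / 2 : ℝ)) (by norm_num) (by norm_num)
  have h2 := (hpow.const_mul (1 / 10 + R')).eventually_lt_const (u := η) (by simpa using hη)
  obtain ⟨K, hK⟩ := Filter.eventually_atTop.1 h2
  refine ⟨K, fun k hk c hc => ?_⟩
  obtain ⟨h1, -, h3⟩ := z_est σ τ hτ hs hR' k c hc
  have hkK := hK k hk
  have hp : (1 / 2 : ℝ) ^ k ≤ 1 := pow_le_one₀ (by norm_num) (by norm_num)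
  have hp0 : (0 : ℝ) < (1 / 2) ^ k := by positivity
  have hmem : (σ c, τ c) ∈ Metric.ball ((1 : E →L[ℝ] E), (0 : E)) η := by
    rw [Metric.mem_ball, Prod.dist_eq, max_lt_iff, dist_eq_norm, dist_eq_norm, sub_zero]
    constructor
    · refine h1.trans_lt (lt_of_le_of_lt ?_ hkK)
      gcongr; linarith
    · refine h3.trans_lt (lt_of_le_of_lt ?_ hkK)
      gcongr; linarith
  have h5 := hball hmem
  by_contra hne
  apply h5
  refine ⟨⟨c, ?_, rfl⟩, ?_⟩
  · exact h3.trans (mul_le_of_le_one_right hR0 hp)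
  · intro he
    rw [Set.mem_singleton_iff, Prod.mk.injEq] at he
    exact hne he

/-- no small subgroups -/
lemma nss (x : E →L[ℝ] E) (h : ∀ k : ℕ, ‖x ^ k - 1‖ ≤ 1 / 2) : x = 1 := by
  have h1 : ∀ y : E →L[ℝ] E, ‖y - 1‖ ≤ 1 / 2 → 3 / 2 * ‖y - 1‖ ≤ ‖y ^ 2 - 1‖ := by
    intro y hy
    have e : (2 : ℝ) • (y - 1) = (y ^ 2 - 1) - (y - 1) * (y - 1) := by
      rw [two_smul]; noncomm_ring
    have h2 := norm_sub_le (y ^ 2 - 1) ((y - 1) * (y - 1))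
    rw [← e, norm_smul] at h2
    have h3 := norm_mul_le (y - 1) (y - 1)
    norm_num at h2
    nlinarith [norm_nonneg (y - 1)]
  have h2 : ∀ j : ℕ, (3 / 2 : ℝ) ^ j * ‖x - 1‖ ≤ ‖x ^ (2 ^ j) - 1‖ := by
    intro j
    induction j with
    | zero => simp
    | succ j ih =>
      have := h1 (x ^ (2 ^ j)) (h _)
      rw [pow_succ 2, pow_mul, pow_succ]
      linarith
  by_contra hne
  have hpos : 0 < ‖x - 1‖ := norm_pos_iff.2 (sub_ne_zero.2 hne)
  obtain ⟨j, hj⟩ := pow_unbounded_of_one_lt (1 / ‖x - 1‖) (show (1 : ℝ) < 3 / 2 by norm_num)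
  rw [div_lt_iff₀ hpos] at hj
  linarith [h2 j, h (2 ^ j)]

lemma unit_step (σ : G →* (E →L[ℝ] E)) {C δ : ℝ} (hC : 1 ≤ C) (hσ : ∀ g, ‖σ g‖ ≤ C)
    (hδ : (C * C + 1) * δ * C ≤ 1 / 2) {a b : G} (hb : ‖σ b - 1‖ ≤ δ)
    (h : σ ⁅a, ⁅a, b⁆⁆ = 1) : σ ⁅a, b⁆ = 1 := by
  set c := ⁅a, b⁆ with hc
  have hac : σ a * σ c = σ c * σ a := by
    have : σ (⁅a, c⁆ * (c * a)) = σ (c * a) := by rw [map_mul, h, one_mul]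
    rw [← map_mul, ← map_mul, ← this]; congr 1; rw [commutatorElement_def]; group
  have key : ∀ k : ℕ, σ (a ^ k * b * (a ^ k)⁻¹) = σ c ^ k * σ b := by
    intro k
    induction k with
    | zero => simp
    | succ k ih =>
      have e : a ^ (k + 1) * b * (a ^ (k + 1))⁻¹ = a * (a ^ k * b * (a ^ k)⁻¹) * a⁻¹ := by
        rw [pow_succ']; group
      have hk : σ a * σ c ^ k = σ c ^ k * σ a :=
        (Commute.pow_right (show Commute (σ a) (σ c) from hac) k)
      rw [e, map_mul, map_mul, ih, ← mul_assoc, hk, mul_assoc, mul_assoc, ← map_mul, ← map_mul,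
        pow_succ, mul_assoc, ← map_mul]
      congr 2; rw [hc, commutatorElement_def]; group
  apply nss
  intro k
  have e : σ c ^ k - 1
      = (σ (a ^ k) * (σ b - 1) * σ (a ^ k)⁻¹ - (σ b - 1)) * σ b⁻¹ := by
    have h1 : σ (a ^ k) * (σ b - 1) * σ (a ^ k)⁻¹ = σ c ^ k * σ b - 1 := by
      rw [← key, mul_sub, sub_mul, mul_one, ← map_mul, ← map_mul, ← map_mul, mul_inv_cancel, map_one]
    have hbb : σ b * σ b⁻¹ = 1 := by rw [← map_mul, mul_inv_cancel, map_one]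
    rw [h1, sub_mul, sub_mul, sub_mul, mul_assoc, hbb]; simp
  rw [e]
  have hδ0 : 0 ≤ δ := (norm_nonneg _).trans hb
  have h1 : ‖σ (a ^ k) * (σ b - 1) * σ (a ^ k)⁻¹‖ ≤ C * δ * C :=
    (norm_mul_le _ _).trans (mul_le_mul ((norm_mul_le _ _).trans
      (mul_le_mul (hσ _) hb (norm_nonneg _) (by linarith))) (hσ _) (norm_nonneg _)
        (by positivity))
  have h2 := norm_sub_le (σ (a ^ k) * (σ b - 1) * σ (a ^ k)⁻¹) (σ b - 1)
  refine (norm_mul_le _ _).trans (le_trans ?_ hδ)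
  refine mul_le_mul ?_ (hσ _) (norm_nonneg _) (by positivity)
  nlinarith

lemma unit_iter (σ : G →* (E →L[ℝ] E)) {C δ : ℝ} (hC : 1 ≤ C) (hσ : ∀ g, ‖σ g‖ ≤ C)
    (hδ : (C * C + 1) * δ * C ≤ 1 / 2) {a b : G} (ha : ‖σ a - 1‖ ≤ δ) (hb : ‖σ b - 1‖ ≤ δ)
    (h : ∃ k, σ (itc a b k) = 1) : σ ⁅a, b⁆ = 1 := by
  have hδ0 : 0 ≤ δ := (norm_nonneg _).trans ha
  have hb' : ∀ k, ‖σ (itc a b k) - 1‖ ≤ δ := by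
    intro k
    induction k with
    | zero => exact hb
    | succ k ih =>
      refine (norm_comm_sub_one σ a _).trans ?_
      have h1 : 2 * (‖σ a - 1‖ * ‖σ (itc a b k) - 1‖) * (‖σ a⁻¹‖ * ‖σ (itc a b k)⁻¹‖)
        ≤ 2 * (δ * δ) * (C * C) := by gcongr <;> apply hσ
      have hm : δ * C * C ≤ 1 / 2 := by nlinarith [mul_nonneg hδ0 (by linarith : 0 ≤ C)]
      nlinarith
  obtain ⟨k, hk⟩ := h
  have down : ∀ k, σ (itc a b (k + 1)) = 1 → σ ⁅a, b⁆ = 1 := by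
    intro k
    induction k with
    | zero => exact fun h => h
    | succ k ih => exact fun h => ih (unit_step σ hC hσ hδ (hb' k) h)
  refine down k ?_
  change σ ⁅a, itc a b k⁆ = 1
  rw [commutatorElement_def, map_mul, map_mul, map_mul, hk, mul_one, ← map_mul, mul_inv_cancel,
    map_one, one_mul]
  have : σ (itc a b k) * σ (itc a b k)⁻¹ = 1 := by rw [← map_mul, mul_inv_cancel, map_one]
  rwa [hk, one_mul] at this

lemma exists_delta {C ε0 : ℝ} (hC : 1 ≤ C) (h0 : 0 < ε0) :
    ∃ δ, 0 < δ ∧ δ ≤ ε0 ∧ (C * C + 1) * δ * C ≤ 1 / 2 := by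
  refine ⟨min ε0 (1 / (2 * ((C * C + 1) * C))), lt_min h0 (by positivity), min_le_left _ _, ?_⟩
  have h1 : 0 < (C * C + 1) * C := by positivity
  calc _ = ((C * C + 1) * C) * min ε0 (1 / (2 * ((C * C + 1) * C))) := by ring
    _ ≤ ((C * C + 1) * C) * (1 / (2 * ((C * C + 1) * C))) := by gcongr; exact min_le_right _ _
    _ = 1 / 2 := by field_simp

lemma norm_conj_sub_one (σ : G →* (E →L[ℝ] E)) {C δ : ℝ} (hC : 0 ≤ C) (hσ : ∀ g, ‖σ g‖ ≤ C)
    {g : G} (hg : ‖σ g - 1‖ ≤ δ) (h : G) : ‖σ (h * g * h⁻¹) - 1‖ ≤ C * δ * C := by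
  have : σ (h * g * h⁻¹) - 1 = σ h * (σ g - 1) * σ h⁻¹ := by
    rw [mul_sub, sub_mul, mul_one, ← map_mul, ← map_mul, ← map_mul, mul_inv_cancel, map_one]
  rw [this]
  have hδ0 : 0 ≤ δ := (norm_nonneg _).trans hg
  exact (norm_mul_le _ _).trans (mul_le_mul ((norm_mul_le _ _).trans
      (mul_le_mul (hσ _) hg (norm_nonneg _) hC)) (hσ _) (norm_nonneg _) (by positivity))

/-- pigeonhole: a subgroup containing all elements of `N` close to 1 has finite index -/
lemma finite_index_of_near [FiniteDimensional ℝ E] (σ : G →* (E →L[ℝ] E)) {C η : ℝ}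
    (hη : 0 < η) (hσ : ∀ g, ‖σ g‖ ≤ C) (A N : Subgroup G)
    (hA : ∀ g ∈ N, ‖σ g - 1‖ < η → g ∈ A) : A.relIndex N ≠ 0 := by
  have hC : 0 ≤ C := (norm_nonneg _).trans (hσ 1)
  set η' := η / (C + 1)
  have hη' : 0 < η' := by positivity
  have htb : TotallyBounded (Metric.closedBall (0 : E →L[ℝ] E) C) :=
    (isCompact_closedBall _ _).totallyBounded
  obtain ⟨t, ht, hcov⟩ := Metric.totallyBounded_iff.1 htb (η' / 2) (by positivity)
  have hx : ∀ g : N, ∃ y ∈ t, dist (σ g) y < η' / 2 := by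
    intro g
    have := hcov (show σ g ∈ Metric.closedBall (0 : E →L[ℝ] E) C by
      rw [mem_closedBall_zero_iff]; exact hσ _)
    simpa using this
  choose f hf1 hf2 using hx
  have key : ∀ g g' : N, f g = f g' → g⁻¹ * g' ∈ A.subgroupOf N := by
    intro g g' h
    rw [Subgroup.mem_subgroupOf]
    refine hA _ (g⁻¹ * g').2 ?_
    have e : σ (↑(g⁻¹ * g') : G) - 1 = σ (g : G)⁻¹ * (σ g' - σ g) := by
      rw [mul_sub, ← map_mul, ← map_mul]; simp
    rw [e]
    have h1 : ‖σ g' - σ g‖ < η' := by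
      rw [← dist_eq_norm]
      have := dist_triangle_right (σ g') (σ g) (f g)
      have h2 := hf2 g'
      rw [← h] at h2
      linarith [hf2 g]
    calc _ ≤ ‖σ (g : G)⁻¹‖ * ‖σ g' - σ g‖ := norm_mul_le _ _
      _ ≤ C * ‖σ g' - σ g‖ := by gcongr; exact hσ _
      _ ≤ (C + 1) * ‖σ g' - σ g‖ := by gcongr; linarith
      _ < (C + 1) * η' := by gcongr
      _ = η := by simp only [η']; field_simp
  have hfin : Finite (N ⧸ A.subgroupOf N) := by
    have : Finite t := ht
    refine Finite.of_injective
      (fun q : N ⧸ A.subgroupOf N => (⟨f q.out, hf1 _⟩ : t)) ?_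
    intro q q' h
    have := key _ _ (congrArg Subtype.val h)
    rw [← QuotientGroup.eq, QuotientGroup.out_eq', QuotientGroup.out_eq'] at this
    exact this
  exact (Subgroup.finiteIndex_of_finite_quotient (H := A.subgroupOf N)).index_ne_zero

lemma abel_lemma [FiniteDimensional ℝ E] (σ : G →* (E →L[ℝ] E)) {C : ℝ}
    (hσ : ∀ g, ‖σ g‖ ≤ C) (N : Subgroup G) [N.Normal] {ε0 : ℝ} (hε0 : 0 < ε0)
    (hZ : ∀ α ∈ N, ∀ β ∈ N, ‖σ α - 1‖ ≤ ε0 → ‖σ β - 1‖ ≤ ε0 → ∃ k, σ (itc α β k) = 1) :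
    ∃ A : Subgroup G, A.Normal ∧ A ≤ N ∧ A.relIndex N ≠ 0 ∧
      ∀ x ∈ A, ∀ y ∈ A, σ ⁅x, y⁆ = 1 := by
  set C' := max C 1
  have hC' : 1 ≤ C' := le_max_right _ _
  have hσ' : ∀ g, ‖σ g‖ ≤ C' := fun g => (hσ g).trans (le_max_left _ _)
  obtain ⟨δ, hδ0, hδ1, hδ2⟩ := exists_delta hC' hε0
  set S : Set G := {g | g ∈ N ∧ ∀ h, ‖σ (h * g * h⁻¹) - 1‖ ≤ δ}
  have hSn : ∀ g ∈ S, ‖σ g - 1‖ ≤ δ := fun g hg => by simpa using hg.2 1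
  have hconj : ∀ g ∈ S, ∀ h, h * g * h⁻¹ ∈ S := by
    intro g hg h
    refine ⟨Subgroup.Normal.conj_mem inferInstance g hg.1 h, fun k => ?_⟩
    have : k * (h * g * h⁻¹) * k⁻¹ = (k * h) * g * (k * h)⁻¹ := by group
    rw [this]; exact hg.2 _
  have hcomm : ∀ x ∈ S, ∀ y ∈ S, σ x * σ y = σ y * σ x := by
    intro x hx y hy
    have h1 := unit_iter σ hC' hσ' hδ2 (hSn x hx) (hSn y hy)
      (hZ x hx.1 y hy.1 ((hSn x hx).trans hδ1) ((hSn y hy).trans hδ1))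
    have : σ (⁅x, y⁆ * (y * x)) = σ (y * x) := by rw [map_mul, h1, one_mul]
    rw [← map_mul, ← map_mul, ← this]; congr 1; rw [commutatorElement_def]; group
  have hlem : ∀ x y : G, σ x * σ y = σ y * σ x → σ ⁅x, y⁆ = 1 := by
    intro x y h
    rw [commutatorElement_def, mul_assoc (x * y), ← mul_inv_rev, map_mul, map_mul, h, ← map_mul,
      ← map_mul, mul_inv_cancel, map_one]
  refine ⟨Subgroup.closure S, ⟨?_⟩, ?_, ?_, ?_⟩
  · intro n hn g
    induction hn using Subgroup.closure_induction with
    | mem x hx => exact Subgroup.subset_closure (hconj x hx g)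
    | one => simp
    | mul x y _ _ hx hy =>
      have : g * (x * y) * g⁻¹ = (g * x * g⁻¹) * (g * y * g⁻¹) := by group
      rw [this]; exact mul_mem hx hy
    | inv x _ hx =>
      have : g * x⁻¹ * g⁻¹ = (g * x * g⁻¹)⁻¹ := by group
      rw [this]; exact inv_mem hx
  · rw [Subgroup.closure_le]; exact fun x hx => hx.1
  · refine finite_index_of_near σ (η := δ / (C' * C')) (by positivity) hσ' _ N ?_
    intro g hg hgn
    refine Subgroup.subset_closure ⟨hg, fun h => ?_⟩
    refine (norm_conj_sub_one σ (by linarith) hσ' hgn.le h).trans (le_of_eq ?_)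
    field_simp
  · intro x hx y hy
    apply hlem
    have hSc : ∀ x ∈ S, ∀ y ∈ Subgroup.closure S, σ x * σ y = σ y * σ x := by
      intro x hx y hy
      induction hy using Subgroup.closure_induction with
      | mem y hy => exact hcomm x hx y hy
      | one => simp
      | mul y z _ _ hy hz => rw [map_mul, ← mul_assoc, hy, mul_assoc, hz, mul_assoc]
      | inv y _ hy =>
        have h1 : σ y * σ y⁻¹ = 1 := by rw [← map_mul, mul_inv_cancel, map_one]
        have h2 : σ y⁻¹ * σ y = 1 := by rw [← map_mul, inv_mul_cancel, map_one]
        calc σ x * σ y⁻¹ = σ y⁻¹ * (σ y * σ x) * σ y⁻¹ := by rw [← mul_assoc, h2, one_mul]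
          _ = σ y⁻¹ * σ x * (σ y * σ y⁻¹) := by rw [← hy]; simp only [mul_assoc]
          _ = _ := by rw [h1, mul_one]
    induction hx using Subgroup.closure_induction with
    | mem x hx => exact hSc x hx y hy
    | one => simp
    | mul x z _ _ hx hz => rw [map_mul, ← mul_assoc, ← hx, mul_assoc, hz, mul_assoc]
    | inv x _ hx =>
        have h1 : σ x * σ x⁻¹ = 1 := by rw [← map_mul, mul_inv_cancel, map_one]
        have h2 : σ x⁻¹ * σ x = 1 := by rw [← map_mul, inv_mul_cancel, map_one]
        symm
        calc σ y * σ x⁻¹ = σ x⁻¹ * (σ x * σ y) * σ x⁻¹ := by rw [← mul_assoc, h2, one_mul]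
          _ = σ x⁻¹ * σ y * (σ x * σ x⁻¹) := by rw [hx]; simp only [mul_assoc]
          _ = _ := by rw [h1, mul_one]

end Z
end LZ

namespace LZ
open scoped commutatorElement

variable {m : ℕ}

/-- virtually solvable group -/
def VSt (G : Type*) [Group G] : Prop := ∃ H : Subgroup G, H.FiniteIndex ∧ Group.IsSolvable H

lemma VSt.of_sub {G : Type*} [Group G] (H : Subgroup G) (hH : H.FiniteIndex) (h : VSt H) :
    VSt G := by
  obtain ⟨K, hK, hs⟩ := h
  refine ⟨K.map H.subtype, ⟨?_⟩, ?_⟩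
  · rw [Subgroup.index_map_subtype]
    exact mul_ne_zero hK.index_ne_zero hH.index_ne_zero
  · exact Group.isSolvable_of_isSolvable_injective
      (f := (K.equivMapOfInjective H.subtype H.subtype_injective).symm.toMonoidHom)
      (K.equivMapOfInjective H.subtype H.subtype_injective).symm.injective

/-- an affine Lorentzian crystallographic action -/
structure IsAct {G : Type*} [Group G] (ℓ : G →* (Vec (m + 2) →L[ℝ] Vec (m + 2)))
    (τ : G → Vec (m + 2)) : Prop where
  coc : ∀ g h, τ (g * h) = τ g + ℓ g (τ h)
  lor : ∀ g, Lor m (ℓ g)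
  inj : ∀ g, ℓ g = 1 → τ g = 0 → g = 1
  pd : ∀ R : ℝ, {g | ∃ x, ‖x‖ ≤ R ∧ ‖ℓ g x + τ g‖ ≤ R}.Finite
  cc : ∃ R : ℝ, ∀ x, ∃ g, ‖ℓ g x + τ g‖ ≤ R

section act
variable {G : Type*} [Group G] {ℓ : G →* (Vec (m + 2) →L[ℝ] Vec (m + 2))} {τ : G → Vec (m + 2)}

lemma mul_inv_l {G E : Type*} [Group G] [NormedAddCommGroup E] [NormedSpace ℝ E]
    (ℓ : G →* (E →L[ℝ] E)) (g : G) : ℓ g * ℓ g⁻¹ = 1 := by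
  rw [← map_mul, mul_inv_cancel, map_one]
lemma inv_mul_l {G E : Type*} [Group G] [NormedAddCommGroup E] [NormedSpace ℝ E]
    (ℓ : G →* (E →L[ℝ] E)) (g : G) : ℓ g⁻¹ * ℓ g = 1 := by
  rw [← map_mul, inv_mul_cancel, map_one]
lemma inv_app {G E : Type*} [Group G] [NormedAddCommGroup E] [NormedSpace ℝ E]
    (ℓ : G →* (E →L[ℝ] E)) (g : G) (x : E) : ℓ g⁻¹ (ℓ g x) = x := by
  rw [← mul_apply_eq_comp, inv_mul_l]; rfl
lemma app_inv {G E : Type*} [Group G] [NormedAddCommGroup E] [NormedSpace ℝ E]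
    (ℓ : G →* (E →L[ℝ] E)) (g : G) (x : E) : ℓ g (ℓ g⁻¹ x) = x := by
  rw [← mul_apply_eq_comp, mul_inv_l]; rfl
lemma mul_app {G E : Type*} [Group G] [NormedAddCommGroup E] [NormedSpace ℝ E]
    (ℓ : G →* (E →L[ℝ] E)) (g h : G) (x : E) : ℓ (g * h) x = ℓ g (ℓ h x) := by
  rw [map_mul]; rfl

lemma IsAct.tau_one (h : IsAct ℓ τ) : τ 1 = 0 := by
  have := h.coc 1 1
  rw [mul_one, map_one] at this
  simpa using this

lemma IsAct.tau_inv (h : IsAct ℓ τ) (g : G) : ℓ g (τ g⁻¹) = - τ g := by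
  have := h.coc g g⁻¹
  rw [mul_inv_cancel, h.tau_one] at this
  exact (neg_eq_of_add_eq_zero_right this.symm).symm

lemma IsAct.inj2 (h : IsAct ℓ τ) {g k : G} (h1 : ℓ g = ℓ k) (h2 : τ g = τ k) : g = k := by
  have e : g * (g⁻¹ * k) = k := by group
  have h3 := congrArg τ e
  rw [h.coc, h2] at h3
  have h4 : ℓ g (τ (g⁻¹ * k)) = 0 := by simpa using h3
  have h5 : τ (g⁻¹ * k) = 0 := by rw [← inv_app ℓ g (τ (g⁻¹ * k)), h4, map_zero]
  have h6 := h.inj (g⁻¹ * k) (by rw [map_mul, ← h1, inv_mul_l]) h5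
  exact (inv_mul_eq_one.1 h6)

lemma IsAct.pd0 (h : IsAct ℓ τ) (R : ℝ) : {g | ‖τ g‖ ≤ R}.Finite := by
  refine (h.pd (max R 0)).subset fun g hg => ⟨0, by simp, ?_⟩
  simpa using Or.inl hg

lemma IsAct.ker_comm (h : IsAct ℓ τ) {g k : G} (h1 : ℓ g = 1) (h2 : ℓ k = 1) : g * k = k * g := by
  apply h.inj2
  · rw [map_mul, map_mul, h1, h2]
  · rw [h.coc, h.coc, h1, h2]; simp [add_comm]

lemma IsAct.ker_solv (h : IsAct ℓ τ) : Group.IsSolvable (ℓ.ker : Subgroup G) := by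
  refine solv_of_comm fun x hx y hy => ?_
  rw [commutatorElement_eq_one_iff_mul_comm]
  exact h.ker_comm hx hy

lemma IsAct.res (h : IsAct ℓ τ) (H : Subgroup G) (hH : H.FiniteIndex) :
    IsAct (ℓ.comp H.subtype) (fun g : H => τ g) where
  coc g k := h.coc g k
  lor g := h.lor g
  inj g h1 h2 := Subtype.ext (h.inj g h1 h2)
  pd R := by
    have := (h.pd R).preimage (f := (Subtype.val : H → G)) Subtype.val_injective.injOn
    exact this
  cc := by
    obtain ⟨R, hR⟩ := h.cc
    have : Finite (G ⧸ H) := inferInstance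
    obtain ⟨B, hB⟩ := (Set.finite_range (fun q : G ⧸ H =>
      ‖ℓ q.out⁻¹‖ * R + ‖τ q.out⁻¹‖)).bddAbove
    refine ⟨B, fun x => ?_⟩
    obtain ⟨g, hg⟩ := hR x
    have hR0 : 0 ≤ R := (norm_nonneg _).trans hg
    have hm : ((g : G ⧸ H).out)⁻¹ * g ∈ H := by
      rw [← QuotientGroup.eq, QuotientGroup.out_eq']
    refine ⟨⟨_, hm⟩, ?_⟩
    refine le_trans ?_ (hB ⟨(g : G ⧸ H), rfl⟩)
    change ‖ℓ (((g : G ⧸ H).out)⁻¹ * g) x + τ (((g : G ⧸ H).out)⁻¹ * g)‖ ≤ _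
    have e : ℓ (((g : G ⧸ H).out)⁻¹ * g) x + τ (((g : G ⧸ H).out)⁻¹ * g)
      = ℓ ((g : G ⧸ H).out)⁻¹ (ℓ g x + τ g) + τ ((g : G ⧸ H).out)⁻¹ := by
      rw [h.coc, mul_app, map_add]; abel
    rw [e]
    refine (norm_add_le _ _).trans ?_
    change _ ≤ ‖ℓ ((g : G ⧸ H).out)⁻¹‖ * R + ‖τ ((g : G ⧸ H).out)⁻¹‖
    gcongr
    refine (ContinuousLinearMap.le_opNorm _ _).trans ?_
    gcongr

/-- Zassenhaus after conjugation -/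
lemma IsAct.zass_conj (h : IsAct ℓ τ) (d d' : Vec (m + 2) →L[ℝ] Vec (m + 2)) (h1 : d * d' = 1)
    (h2 : d' * d = 1) {S : Set G} (hS : S.Finite) (hs : ∀ s ∈ S, ‖d * ℓ s * d' - 1‖ ≤ 1 / 10) :
    ∃ K, ∀ k ≥ K, ∀ c ∈ cw S k, c = 1 := by
  let σ : G →* (Vec (m + 2) →L[ℝ] Vec (m + 2)) :=
    { toFun := fun g => d * ℓ g * d'
      map_one' := by simp [h1]
      map_mul' := fun x y => by
        have : d * ℓ x * d' * (d * ℓ y * d') = d * ℓ x * (d' * d) * (ℓ y * d') := by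
          simp only [mul_assoc]
        rw [this, h2, map_mul]; simp only [mul_assoc, one_mul] }
  obtain ⟨K, hK⟩ := zass σ (fun g => d (τ g)) (by
    intro g k
    change d (τ (g * k)) = d (τ g) + (d * ℓ g * d') (d (τ k))
    rw [h.coc, map_add]
    congr 1
    change _ = d (ℓ g ((d' * d) (τ k)))
    rw [h2]; rfl) (by
    intro R
    refine ((h.pd0 (‖d'‖ * R)).subset ?_).image _
    intro g hg
    have : τ g = d' (d (τ g)) := by
      change _ = (d' * d) (τ g); rw [h2]; rfl
    change ‖τ g‖ ≤ _
    rw [this]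
    exact (ContinuousLinearMap.le_opNorm _ _).trans (by gcongr; exact hg)) hS hs
  refine ⟨K, fun k hk c hc => ?_⟩
  obtain ⟨e1, e2⟩ := hK k hk c hc
  apply h.inj
  · have e1 : d * ℓ c * d' = 1 := e1
    calc ℓ c = (d' * d) * ℓ c * (d' * d) := by rw [h2]; simp
      _ = d' * (d * ℓ c * d') * d := by simp only [mul_assoc]
      _ = 1 := by rw [e1, mul_one, h2]
  · have : τ c = d' (d (τ c)) := by
      change _ = (d' * d) (τ c); rw [h2]; rfl
    rw [this, e2, map_zero]

lemma IsAct.zass (h : IsAct ℓ τ) {S : Set G} (hS : S.Finite) (hs : ∀ s ∈ S, ‖ℓ s - 1‖ ≤ 1 / 10) :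
    ∃ K, ∀ k ≥ K, ∀ c ∈ cw S k, c = 1 :=
  h.zass_conj 1 1 (by simp) (by simp) hS (by simpa using hs)

/-- orthogonal complement of a vector -/
def vperp (v : Vec (m + 2)) : Submodule ℝ (Vec (m + 2)) := LinearMap.ker (lb m v)

lemma mem_vperp {v x : Vec (m + 2)} : x ∈ vperp v ↔ lb m v x = 0 := LinearMap.mem_ker

/-- case (a): fixed timelike vector -/
lemma case_a (h : IsAct ℓ τ) {v : Vec (m + 2)} (hv : lorentzQ m v < 0) (hfix : ∀ g, ℓ g v = v) :
    VSt G := by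
  have hspan : ∀ x ∈ Submodule.span ℝ {v}, (∀ y ∈ Submodule.span ℝ {v}, lb m y x = 0) → x = 0 := by
    intro x hx hy
    obtain ⟨c, rfl⟩ := Submodule.mem_span_singleton.1 hx
    have := hy v (Submodule.mem_span_singleton_self v)
    rw [map_smul, lb_self, smul_eq_mul] at this
    rcases mul_eq_zero.1 this with h0 | h0
    · rw [h0, zero_smul]
    · exact absurd h0 hv.ne
  obtain ⟨P, p1, p2, p3, p4⟩ := exists_proj _ hspan
  obtain ⟨C, hC, hC'⟩ := bounded_on_def (vperp v)
    (fun x hx hx0 => Q_pos_of_orth hv (mem_vperp.1 hx) hx0) P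
  have hb : ∀ g, ‖ℓ g‖ ≤ C + ‖1 - P‖ := by
    intro g
    have e : ℓ g = ℓ g * P + (1 - P) := by
      ext1 x
      obtain ⟨c, hc⟩ := Submodule.mem_span_singleton.1 (p2 x)
      change ℓ g x = ℓ g (P x) + (x - P x)
      have : ℓ g x = ℓ g (P x) + ℓ g (x - P x) := by rw [← map_add]; congr 1; abel
      rw [this, ← hc, map_smul, hfix]
    rw [e]
    refine (norm_add_le _ _).trans (add_le_add_left (hC' _ fun x => ⟨?_, ?_⟩) _)
    · rw [mem_vperp]
      change lb m v (ℓ g (P x)) = 0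
      conv_lhs => rw [← hfix g, (h.lor g).lb]
      exact p1 x v (Submodule.mem_span_singleton_self v)
    · exact h.lor g (P x)
  have htop : (⊤ : Subgroup G).Normal := inferInstance
  obtain ⟨A, -, -, hA2, hA3⟩ := abel_lemma ℓ hb ⊤ (ε0 := 1 / 10) (by norm_num) (by
    intro α _ β _ h1 h2
    obtain ⟨K, hK⟩ := h.zass (S := {α, β}) (by simp) (by
      rintro s (rfl | rfl) <;> assumption)
    exact ⟨K, by rw [hK K le_rfl _ (itc_mem_cw α β K), map_one]⟩)
  refine ⟨A, ⟨by rwa [Subgroup.relIndex_top_right] at hA2⟩, ?_⟩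
  exact solv_step h.ker_solv (fun x hx y hy => hA3 x hx y hy)

end act
end LZ

namespace LZ
open scoped commutatorElement

variable {m : ℕ}
variable {G : Type*} [Group G] {ℓ : G →* (Vec (m + 2) →L[ℝ] Vec (m + 2))} {τ : G → Vec (m + 2)}

/-- linear functional `lb v` as a continuous map -/
def lbc (v : Vec (m + 2)) : Vec (m + 2) →L[ℝ] ℝ := LinearMap.toContinuousLinearMap (lb m v)

lemma lbc_apply (v x : Vec (m + 2)) : lbc v x = lb m v x := rfl

/-- case (b): invariant null line -/
lemma case_b (h : IsAct ℓ τ) {a : Vec (m + 2)} (ha : lorentzQ m a = 0) (hat : 0 < tm a)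
    (hline : ∀ g, ∃ c : ℝ, ℓ g a = c • a) : VSt G := by
  have ha0 : a ≠ 0 := by rintro rfl; simp [tm_zero] at hat
  set b : Vec (m + 2) := (2 * tm a) • e0 m - a with hb
  have hQb : lorentzQ m b = 0 := by
    rw [hb, Q_sub, Q_smul, Q_e0, ha, map_smul, LinearMap.smul_apply, lb_e0, smul_eq_mul]; ring
  set β := lb m a b with hβ
  have hβ' : β = -2 * tm a ^ 2 := by
    rw [hβ, hb, map_sub, map_smul, lb_self, ha, lb_comm, lb_e0, smul_eq_mul]; ring
  have hβ0 : β < 0 := by rw [hβ']; nlinarith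
  have hβ0' : β ≠ 0 := hβ0.ne
  have laa : lb m a a = 0 := by rw [lb_self, ha]
  have lbb : lb m b b = 0 := by rw [lb_self, hQb]
  have lba : lb m b a = β := by rw [lb_comm]
  -- coordinates
  set f : Vec (m + 2) →L[ℝ] ℝ := β⁻¹ • lbc b with hf
  set g : Vec (m + 2) →L[ℝ] ℝ := β⁻¹ • lbc a with hg
  have fx : ∀ x, f x = β⁻¹ * lb m b x := fun x => rfl
  have gx : ∀ x, g x = β⁻¹ * lb m a x := fun x => rfl
  have fa : f a = 1 := by rw [fx, lba, inv_mul_cancel₀ hβ0']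
  have fb : f b = 0 := by rw [fx, lbb, mul_zero]
  have ga : g a = 0 := by rw [gx, laa, mul_zero]
  have gb : g b = 1 := by rw [gx, ← hβ, inv_mul_cancel₀ hβ0']
  set P : Vec (m + 2) →L[ℝ] Vec (m + 2) := 1 - f.smulRight a - g.smulRight b with hP
  have Px : ∀ x, P x = x - f x • a - g x • b := fun x => rfl
  have xP : ∀ x, x = P x + f x • a + g x • b := fun x => by rw [Px]; abel
  have fP : ∀ x, f (P x) = 0 := fun x => by rw [Px]; simp [fa, fb]
  have gP : ∀ x, g (P x) = 0 := fun x => by rw [Px]; simp [ga, gb]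
  have PP : ∀ x, P (P x) = P x := fun x => by rw [Px (P x), fP, gP]; simp
  have Pa : P a = 0 := by rw [Px, fa, ga]; simp
  have Pb : P b = 0 := by rw [Px, fb, gb]; simp
  have lbP : ∀ x, lb m b (P x) = 0 := fun x => by
    have := fP x; rw [fx] at this; simpa [hβ0'] using this
  have laP : ∀ x, lb m a (P x) = 0 := fun x => by
    have := gP x; rw [gx] at this; simpa [hβ0'] using this
  choose lam hlam using hline
  have hlam0 : ∀ γ, lam γ ≠ 0 := by
    intro γ h0
    have := hlam γ
    rw [h0, zero_smul] at this
    exact ha0 (by rw [← inv_app ℓ γ a, this, map_zero])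
  have lam_of : ∀ γ c, ℓ γ a = c • a → c = lam γ := by
    intro γ c hc
    rw [hlam] at hc
    exact (smul_left_injective ℝ ha0 hc).symm
  have lam_mul : ∀ γ δ, lam (γ * δ) = lam γ * lam δ := by
    intro γ δ
    symm
    apply lam_of
    rw [mul_app, hlam, map_smul, hlam, smul_smul, mul_comm]
  have lam_one : lam 1 = 1 := (lam_of 1 1 (by rw [map_one]; simp)).symm
  -- g of ℓ
  have gl : ∀ γ x, lam γ * g (ℓ γ x) = g x := by
    intro γ x
    rw [gx, gx, ← (h.lor γ).lb a x, hlam, map_smul, LinearMap.smul_apply, smul_eq_mul]; ring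
  have glP : ∀ γ x, g (ℓ γ (P x)) = 0 := by
    intro γ x
    have := gl γ (P x)
    rw [gP] at this
    exact (mul_eq_zero.1 this).resolve_left (hlam0 γ)
  let σ : G →* (Vec (m + 2) →L[ℝ] Vec (m + 2)) :=
    { toFun := fun γ => P * ℓ γ * P + (1 - P)
      map_one' := by
        ext1 x
        change P (ℓ 1 (P x)) + (x - P x) = x
        rw [map_one]
        change P (P x) + (x - P x) = x
        rw [PP]; abel
      map_mul' := fun γ δ => by
        ext1 x
        change P (ℓ (γ * δ) (P x)) + (x - P x)
          = P (ℓ γ (P (P (ℓ δ (P x)) + (x - P x)))) +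
            ((P (ℓ δ (P x)) + (x - P x)) - P (P (ℓ δ (P x)) + (x - P x)))
        have e1 : P (P (ℓ δ (P x)) + (x - P x)) = P (ℓ δ (P x)) := by
          rw [map_add, PP, map_sub, PP]; abel
        rw [e1, mul_app]
        conv_lhs => rw [xP (ℓ δ (P x)), glP]
        simp only [map_add, map_smul, hlam, Pa]
        simp }
  have σx : ∀ γ x, σ γ x = P (ℓ γ (P x)) + (x - P x) := fun γ x => rfl
  -- definiteness of X
  let X : Submodule ℝ (Vec (m + 2)) := vperp a ⊓ vperp b
  have hXdef : ∀ x ∈ X, x ≠ 0 → 0 < lorentzQ m x := by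
    intro x hx hx0
    have hx1 := mem_vperp.1 hx.1
    have hx2 := mem_vperp.1 hx.2
    refine Q_pos_of_orth (v := a + b) ?_ ?_ hx0
    · rw [Q_add, ha, hQb]; linarith
    · rw [map_add, LinearMap.add_apply, hx1, hx2, add_zero]
  obtain ⟨C, hC, hC'⟩ := bounded_on_def X hXdef P
  have hbd : ∀ γ, ‖σ γ‖ ≤ C + ‖1 - P‖ := by
    intro γ
    refine (norm_add_le _ _).trans (add_le_add_left (hC' _ fun x => ⟨?_, ?_⟩) _)
    · exact ⟨mem_vperp.2 (laP _), mem_vperp.2 (lbP _)⟩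
    · change lorentzQ m (P (ℓ γ (P x))) = _
      have e : P (ℓ γ (P x)) = ℓ γ (P x) - f (ℓ γ (P x)) • a := by
        rw [Px (ℓ γ (P x)), glP]; simp
      have e2 : lb m (ℓ γ (P x)) a = 0 := by
        have := glP γ x
        rw [gx, lb_comm] at this
        simpa [hβ0'] using this
      rw [e, Q_sub, map_smul, e2, Q_smul, ha, h.lor]; simp
  let N : Subgroup G :=
    { carrier := {γ | lam γ = 1}
      mul_mem' := fun {x y} hx hy => by
        change lam (x * y) = 1
        rw [lam_mul, hx, hy, one_mul]
      one_mem' := lam_one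
      inv_mem' := fun {x} hx => by
        have h1 : lam (x * x⁻¹) = 1 := by rw [mul_inv_cancel, lam_one]
        have hx : lam x = 1 := hx
        rw [lam_mul, hx, one_mul] at h1
        exact h1 }
  have memN : ∀ γ, γ ∈ N ↔ lam γ = 1 := fun γ => Iff.rfl
  have lam_inv : ∀ γ, lam γ * lam γ⁻¹ = 1 := fun γ => by rw [← lam_mul, mul_inv_cancel, lam_one]
  have hN : N.Normal := ⟨fun n hn γ => by
    rw [memN] at hn ⊢
    rw [lam_mul, lam_mul, hn, mul_one, lam_inv]⟩
  have hcN : ∀ x y, ⁅x, y⁆ ∈ N := fun x y => by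
    rw [memN, commutatorElement_def, lam_mul, lam_mul, lam_mul]
    linear_combination (lam y * lam y⁻¹) * lam_inv x + lam_inv y
  have lN : ∀ γ ∈ N, ℓ γ a = a := fun γ hγ => by rw [hlam, (memN γ).1 hγ, one_smul]
  have gN : ∀ γ ∈ N, ∀ x, g (ℓ γ x) = g x := fun γ hγ x => by
    have := gl γ x
    rwa [(memN γ).1 hγ, one_mul] at this
  -- boosts
  let d : ℝ → (Vec (m + 2) →L[ℝ] Vec (m + 2)) := fun s =>
    P + s • f.smulRight a + s⁻¹ • g.smulRight b
  have dx : ∀ s x, d s x = P x + s • f x • a + s⁻¹ • g x • b := fun s x => rfl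
  have dP : ∀ s x, P (d s x) = P x := fun s x => by
    rw [dx, map_add, map_add, map_smul, map_smul, map_smul, map_smul, Pa, Pb, PP]; simp
  have df : ∀ s x, f (d s x) = s * f x := fun s x => by
    rw [dx, map_add, map_add, map_smul, map_smul, map_smul, map_smul, fa, fb, fP]; simp
  have dg : ∀ s x, g (d s x) = s⁻¹ * g x := fun s x => by
    rw [dx, map_add, map_add, map_smul, map_smul, map_smul, map_smul, ga, gb, gP]; simp
  have dd : ∀ s, s ≠ 0 → d s * d s⁻¹ = 1 := by
    intro s hs
    ext1 x
    change d s (d s⁻¹ x) = x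
    rw [dx s, dP, df, dg, smul_smul, smul_smul, ← mul_assoc, ← mul_assoc, mul_inv_cancel₀ hs,
      inv_inv, inv_mul_cancel₀ hs, one_mul, one_mul]
    exact (xP x).symm
  have hlim : ∀ γ ∈ N, ∃ s0 > 0, ∀ s, 0 < s → s ≤ s0 → ‖d s * ℓ γ * d s⁻¹ - σ γ‖ ≤ 1 / 20 := by
    intro γ hγ
    set M1 : Vec (m + 2) →L[ℝ] Vec (m + 2) :=
      (f.comp ((ℓ γ).comp P)).smulRight a + g.smulRight (P (ℓ γ b)) with hM1
    set M2 : Vec (m + 2) →L[ℝ] Vec (m + 2) := g.smulRight (f (ℓ γ b) • a) with hM2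
    refine ⟨min 1 (1 / (20 * (‖M1‖ + ‖M2‖ + 1))), by positivity, fun s hs hs1 => ?_⟩
    have hs2 := hs1.trans (min_le_left _ _)
    have hs3 := hs1.trans (min_le_right _ _)
    have e : d s * ℓ γ * d s⁻¹ - σ γ = s • M1 + (s * s) • M2 := by
      ext1 x
      change d s (ℓ γ (d s⁻¹ x)) - σ γ x
        = s • (f (ℓ γ (P x)) • a + g x • P (ℓ γ b)) + (s * s) • (g x • f (ℓ γ b) • a)
      have e1 : ℓ γ (d s⁻¹ x) = ℓ γ (P x) + s⁻¹ • f x • a + s • g x • ℓ γ b := by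
        rw [dx, map_add, map_add, map_smul, map_smul, map_smul, map_smul, lN γ hγ, inv_inv]
      rw [e1, dx, σx]
      simp only [map_add, map_smul, glP, gN γ hγ b, gb, fa, ga, Pa, smul_eq_mul]
      have e2 : x - P x = f x • a + g x • b := by rw [Px]; abel
      rw [e2]
      have hss : s * s⁻¹ = 1 := mul_inv_cancel₀ hs.ne'
      have hss' : s⁻¹ * s = 1 := inv_mul_cancel₀ hs.ne'
      ext i
      simp only [Pi.add_apply, Pi.sub_apply, Pi.smul_apply, smul_eq_mul, Pi.zero_apply]
      linear_combination (f x * a i + g x * b i) * hss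
    rw [e]
    have hpos : 0 < 20 * (‖M1‖ + ‖M2‖ + 1) := by positivity
    rw [le_div_iff₀ hpos] at hs3
    calc ‖s • M1 + (s * s) • M2‖ ≤ s * ‖M1‖ + (s * s) * ‖M2‖ := by
          refine (norm_add_le _ _).trans ?_
          rw [norm_smul, norm_smul, Real.norm_of_nonneg hs.le, Real.norm_of_nonneg (by positivity)]
      _ ≤ s * ‖M1‖ + s * ‖M2‖ := by gcongr; nlinarith
      _ ≤ 1 / 20 := by nlinarith
  obtain ⟨A, hAn, hAN, hAi, hAc⟩ := abel_lemma σ hbd N (ε0 := 1 / 20) (by norm_num) (by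
    intro α hα δ hδ h1 h2
    obtain ⟨s1, hs1, hs1'⟩ := hlim α hα
    obtain ⟨s2, hs2, hs2'⟩ := hlim δ hδ
    set s := min s1 s2
    have hs : 0 < s := lt_min hs1 hs2
    have h3 := hs1' s hs (min_le_left _ _)
    have h4 := hs2' s hs (min_le_right _ _)
    have tri : ∀ A B : Vec (m + 2) →L[ℝ] Vec (m + 2), ‖A - B‖ ≤ 1 / 20 → ‖B - 1‖ ≤ 1 / 20 →
        ‖A - 1‖ ≤ 1 / 10 := by
      intro A B hA hB
      have := norm_add_le (A - B) (B - 1)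
      rw [sub_add_sub_cancel] at this
      linarith
    obtain ⟨K, hK⟩ := h.zass_conj (d s) (d s⁻¹) (dd s hs.ne')
      (by have := dd s⁻¹ (inv_ne_zero hs.ne'); rwa [inv_inv] at this) (S := {α, δ}) (by simp) (by
        rintro x (rfl | rfl)
        · exact tri _ _ h3 h1
        · exact tri _ _ h4 h2)
    exact ⟨K, by rw [hK K le_rfl _ (itc_mem_cw α δ K), map_one]⟩)
  have hAs : Group.IsSolvable A := by
    refine solv_step (K := σ.ker ⊓ N) ?_ fun x hx y hy => ⟨hAc x hx y hy, hcN x y⟩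
    refine solv_step h.ker_solv fun x hx y hy => ?_
    -- description of elements of the unipotent part
    have hU : ∀ γ ∈ σ.ker ⊓ N, ∀ x, ℓ γ (P x) = P x + f (ℓ γ (P x)) • a := by
      intro γ hγ x
      have h1 : σ γ (P x) = P x := by
        have : σ γ = 1 := hγ.1
        rw [this]; rfl
      rw [σx, PP, sub_self, add_zero] at h1
      conv_lhs => rw [xP (ℓ γ (P x)), glP, h1]
      simp
    have hUb : ∀ γ ∈ σ.ker ⊓ N, ℓ γ b = b + P (ℓ γ b) + f (ℓ γ b) • a := by
      intro γ hγ
      conv_lhs => rw [xP (ℓ γ b), gN γ hγ.2, gb, one_smul]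
      abel
    have hUf : ∀ γ ∈ σ.ker ⊓ N, ∀ x, f (ℓ γ (P x)) * β = - lb m (P (ℓ γ b)) (P x) := by
      intro γ hγ x
      have h1 := (h.lor γ).lb b (P x)
      rw [lbP, hU γ hγ x, hUb γ hγ] at h1
      simp only [map_add, map_smul, LinearMap.add_apply, LinearMap.smul_apply, smul_eq_mul, laa,
        lba, lbP, laP] at h1
      have h2 : lb m (P (ℓ γ b)) a = 0 := by rw [lb_comm, laP]
      rw [h2] at h1
      linarith
    have hcomm : ∀ z, ℓ x (ℓ y z) = ℓ y (ℓ x z) := by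
      intro z
      have hk : f (ℓ x (P (ℓ y b))) = f (ℓ y (P (ℓ x b))) := by
        have h1 := hUf x hx (ℓ y b)
        have h2 := hUf y hy (ℓ x b)
        rw [lb_comm] at h2
        exact mul_right_cancel₀ hβ0' (by rw [h1, h2])
      have e1 : ∀ u v : G, u ∈ σ.ker ⊓ N → v ∈ σ.ker ⊓ N →
          ℓ u (ℓ v z) = P z + f (ℓ u (P z)) • a + f (ℓ v (P z)) • a + f z • a
            + g z • (b + P (ℓ u b) + f (ℓ u b) • a + P (ℓ v b) + f (ℓ u (P (ℓ v b))) • a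
              + f (ℓ v b) • a) := by
        intro u v hu hv
        have e2 : ℓ v z = P z + f (ℓ v (P z)) • a + f z • a
            + g z • (b + P (ℓ v b) + f (ℓ v b) • a) := by
          conv_lhs => rw [xP z]
          rw [map_add, map_add, map_smul, map_smul, lN v hv.2, ← hUb v hv, ← hU v hv]
        rw [e2]
        simp only [map_add, map_smul, lN u hu.2]
        rw [hU u hu z]
        conv_lhs => rw [hUb u hu, hU u hu (ℓ v b)]
        simp only [map_add, map_smul, fP, fa]
        simp only [smul_add]
        simp
        abel
      rw [e1 x y hx hy, e1 y x hy hx, hk]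
      simp only [smul_add]
      abel
    rw [MonoidHom.mem_ker, commutatorElement_def, mul_assoc (x * y), ← mul_inv_rev]
    have : ℓ (x * y) = ℓ (y * x) := by
      ext1 z; rw [mul_app, mul_app, hcomm]
    rw [map_mul, this, ← map_mul, mul_inv_cancel, map_one]
  exact FL_type A N hAN hAs hAi N hcN (fun x _ y _ => hcN x y)

end LZ

namespace LZ
open scoped commutatorElement
open Filter Topology

variable {m : ℕ}
variable {G : Type*} [Group G] {ℓ : G →* (Vec (m + 2) →L[ℝ] Vec (m + 2))} {τ : G → Vec (m + 2)}

/-- fixed vectors -/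
def fixs (L : Vec (m + 2) →L[ℝ] Vec (m + 2)) : Submodule ℝ (Vec (m + 2)) where
  carrier := {x | L x = x}
  add_mem' {x y} hx hy := by
    change L (x + y) = x + y
    rw [map_add, hx, hy]
  zero_mem' := map_zero L
  smul_mem' c x hx := by
    change L (c • x) = c • x
    rw [map_smul, hx]

/-- stabilizer of a subspace -/
def stab (ℓ : G →* (Vec (m + 2) →L[ℝ] Vec (m + 2))) (X : Submodule ℝ (Vec (m + 2))) :
    Subgroup G where
  carrier := {g | ∀ x ∈ X, ℓ g x ∈ X ∧ ℓ g⁻¹ x ∈ X}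
  mul_mem' {a b} ha hb x hx := by
    rw [mul_inv_rev, mul_app, mul_app]
    exact ⟨(ha _ (hb x hx).1).1, (hb _ (ha x hx).2).2⟩
  one_mem' x hx := by simpa using hx
  inv_mem' {a} ha x hx := by rw [inv_inv]; exact ⟨(ha x hx).2, (ha x hx).1⟩

lemma cw_sub {S : Set G} {H : Subgroup G} (h : ∀ s ∈ S, s ∈ H) (k : ℕ) : ∀ c ∈ cw S k, c ∈ H := by
  induction k with
  | zero => exact h
  | succ k ih =>
    rintro _ ⟨s, hs, c, hc, rfl⟩
    exact H.mul_mem (H.mul_mem (H.mul_mem (h s hs) (ih c hc)) (H.inv_mem (h s hs)))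
      (H.inv_mem (ih c hc))

/-- reversed Cauchy-Schwarz on the hyperboloid -/
lemma lb_hyp {u w : Vec (m + 2)} (hu : lorentzQ m u < 0) (hut : 0 < tm u) (hwt : 0 < tm w)
    (h : lorentzQ m u = lorentzQ m w) : lb m u w ≤ lorentzQ m u := by
  have h1 : lb m (u + w) (u - w) = 0 := by
    simp only [map_add, map_sub, LinearMap.add_apply, lb_self, lb_comm w u]; linarith
  have h2 : 0 ≤ lorentzQ m (u - w) := by
    refine Q_nonneg_of_orth (v := u + w) ?_ ?_ h1
    · rw [Q_add]
      have := lb_nonpos hu.le hut (h ▸ hu.le) hwt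
      linarith
    · intro h0
      have : tm (u + w) = 0 := by rw [h0, tm_zero]
      rw [tm_add] at this; linarith
  rw [Q_sub] at h2
  linarith

lemma bounded_case (X : Submodule ℝ (Vec (m + 2))) {v : Vec (m + 2)}
    (hv : lorentzQ m v < 0) {z : Vec (m + 2) →L[ℝ] Vec (m + 2)}
    (hX : ∀ k : ℕ, (z ^ k) v ∈ X) (hQ : ∀ k : ℕ, lorentzQ m ((z ^ k) v) = lorentzQ m v)
    (ht : ∀ k : ℕ, 0 < tm ((z ^ k) v)) {B : ℝ} (hB : ∀ k : ℕ, ‖(z ^ k) v‖ ≤ B) :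
    ∃ x ∈ X, lorentzQ m x < 0 ∧ 0 < tm x ∧ z x = x := by
  let a : ℕ → Vec (m + 2) := fun n =>
    ((n + 1 : ℝ)⁻¹) • ∑ k ∈ Finset.range (n + 1), (z ^ k) v
  have haX : ∀ n, a n ∈ X := fun n => X.smul_mem _ (X.sum_mem fun k _ => hX k)
  have haB : ∀ n, a n ∈ Metric.closedBall (0 : Vec (m + 2)) B := by
    intro n
    rw [mem_closedBall_zero_iff, norm_smul, Real.norm_of_nonneg (by positivity),
      inv_mul_le_iff₀ (by positivity)]
    refine (norm_sum_le _ _).trans ((Finset.sum_le_sum fun k _ => hB k).trans (le_of_eq ?_))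
    simp
  obtain ⟨x, -, φ, hφ, hlim⟩ := (isCompact_closedBall (0 : Vec (m + 2)) B).tendsto_subseq haB
  have havg : ∀ (F : Vec (m + 2) →ₗ[ℝ] ℝ) (c : ℝ), (∀ k : ℕ, F ((z ^ k) v) ≤ c) →
      ∀ n, F (a n) ≤ c := by
    intro F c hF n
    simp only [a]
    rw [map_smul, map_sum, smul_eq_mul, inv_mul_le_iff₀ (by positivity)]
    refine (Finset.sum_le_sum fun k _ => hF k).trans (le_of_eq ?_)
    simp
  have hlimF : ∀ (F : Vec (m + 2) →ₗ[ℝ] ℝ) (c : ℝ), (∀ k : ℕ, F ((z ^ k) v) ≤ c) → F x ≤ c := by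
    intro F c hF
    have hc : Continuous F := F.continuous_of_finiteDimensional
    exact le_of_tendsto ((hc.tendsto x).comp hlim) (Eventually.of_forall fun n => havg F c hF _)
  have h1 : ∀ j : ℕ, lb m x ((z ^ j) v) ≤ lorentzQ m v := by
    intro j
    rw [lb_comm]
    refine hlimF (lb m ((z ^ j) v)) _ fun k => ?_
    rw [← hQ j]
    exact lb_hyp (by rw [hQ]; exact hv) (ht j) (ht k) (by rw [hQ, hQ])
  have h2 : lorentzQ m x ≤ lorentzQ m v := by
    rw [← lb_self]
    exact hlimF (lb m x) _ h1
  have hx0 : lorentzQ m x < 0 := h2.trans_lt hv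
  have hxne : x ≠ 0 := by rintro rfl; rw [Q_zero] at hx0; exact lt_irrefl _ hx0
  refine ⟨x, ?_, hx0, ?_, ?_⟩
  · exact X.closed_of_finiteDimensional.mem_of_tendsto hlim (Eventually.of_forall fun n => haX _)
  · have h3 : 0 ≤ tm x := by
      have := hlimF (-(LinearMap.proj (Fin.last (m + 1)))) 0 (fun k => by
        have := ht k
        simp only [tm] at this
        simp only [LinearMap.neg_apply, LinearMap.proj_apply]; linarith)
      simp only [LinearMap.neg_apply, LinearMap.proj_apply] at this
      simp only [tm]; linarith
    exact lt_of_le_of_ne h3 (tm_ne_zero hx0.le hxne).symm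
  · have h4 : Tendsto (fun n => z (a (φ n)) - a (φ n)) atTop (𝓝 (z x - x)) :=
      ((z.continuous.tendsto x).comp hlim).sub hlim
    have h5 : Tendsto (fun n => z (a (φ n)) - a (φ n)) atTop (𝓝 0) := by
      have h6 : Tendsto (fun n : ℕ => (n + 1 : ℝ)⁻¹ * (2 * B)) atTop (𝓝 0) := by
        have := (tendsto_one_div_add_atTop_nhds_zero_nat (𝕜 := ℝ)).mul_const (2 * B)
        simpa using this
      refine squeeze_zero_norm (fun n => ?_) (h6.comp hφ.tendsto_atTop)
      have e : z (a (φ n)) - a (φ n) = ((φ n + 1 : ℝ)⁻¹) • ((z ^ (φ n + 1)) v - v) := by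
        simp only [a]
        rw [map_smul, ← smul_sub, map_sum, ← Finset.sum_sub_distrib]
        have e2 := Finset.sum_range_sub (fun k => (z ^ k) v) (φ n + 1)
        rw [pow_zero] at e2
        congr 1
        change _ = (z ^ (φ n + 1)) v - v at e2
        rw [← e2]
        refine Finset.sum_congr rfl fun k _ => ?_
        rw [pow_succ']; rfl
      rw [e, norm_smul, Real.norm_of_nonneg (by positivity)]
      change _ ≤ ((φ n : ℝ) + 1)⁻¹ * (2 * B)
      gcongr
      have := norm_sub_le ((z ^ (φ n + 1)) v) v
      have h7 := hB (φ n + 1)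
      have h8 := hB 0
      rw [pow_zero] at h8
      change ‖v‖ ≤ B at h8
      linarith
    exact sub_eq_zero.1 (tendsto_nhds_unique h4 h5)

lemma unbounded_case (X : Submodule ℝ (Vec (m + 2))) {v : Vec (m + 2)}
    {z : Vec (m + 2) →L[ℝ] Vec (m + 2)}
    (hX : ∀ k : ℕ, (z ^ k) v ∈ X) (hQ : ∀ k : ℕ, lorentzQ m ((z ^ k) v) = lorentzQ m v)
    (ht : ∀ k : ℕ, 0 < tm ((z ^ k) v)) (hB : ∀ B : ℝ, ∃ k : ℕ, B < ‖(z ^ k) v‖) :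
    ∃ x ∈ X, lorentzQ m x = 0 ∧ 0 < tm x ∧ ∀ s : Vec (m + 2) →L[ℝ] Vec (m + 2), Lor m s →
      (∀ k : ℕ, lb m ((z ^ k) v) (s ((z ^ k) v)) = lb m v (s v)) → ∃ c : ℝ, s x = c • x := by
  choose k hk using fun j : ℕ => hB (j + 1)
  set r : ℕ → ℝ := fun j => ‖(z ^ (k j)) v‖⁻¹ with hr
  have hpos : ∀ j, 0 < ‖(z ^ (k j)) v‖ := fun j => lt_trans (by positivity) (hk j)
  have hr0 : ∀ j, 0 < r j := fun j => inv_pos.2 (hpos j)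
  have hrlim : Tendsto r atTop (𝓝 0) := by
    refine squeeze_zero (fun j => (hr0 j).le) (fun j => ?_)
      (tendsto_one_div_add_atTop_nhds_zero_nat (𝕜 := ℝ))
    rw [one_div]
    exact inv_anti₀ (by positivity) (hk j).le
  let u : ℕ → Vec (m + 2) := fun j => r j • (z ^ (k j)) v
  have hu : ∀ j, u j ∈ Metric.sphere (0 : Vec (m + 2)) 1 := by
    intro j
    rw [mem_sphere_zero_iff_norm, norm_smul, Real.norm_of_nonneg (hr0 j).le]
    exact inv_mul_cancel₀ (hpos j).ne'
  obtain ⟨x, hx, φ, hφ, hlim⟩ := (isCompact_sphere (0 : Vec (m + 2)) 1).tendsto_subseq hu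
  have hx0 : x ≠ 0 := by
    rintro rfl; simp at hx
  have hrφ : Tendsto (fun n => r (φ n) ^ 2) atTop (𝓝 0) := by
    have := (hrlim.comp hφ.tendsto_atTop).pow 2
    simpa using this
  have hQx : lorentzQ m x = 0 := by
    have h1 := ((continuous_Q (m := m)).tendsto x).comp hlim
    have h2 : (lorentzQ m ∘ u ∘ φ) = fun n => r (φ n) ^ 2 * lorentzQ m v := by
      funext n
      simp only [Function.comp, u]
      rw [Q_smul, hQ]
    rw [h2] at h1
    have h3 := hrφ.mul_const (lorentzQ m v)
    rw [zero_mul] at h3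
    exact tendsto_nhds_unique h1 h3
  refine ⟨x, ?_, hQx, ?_, ?_⟩
  · exact X.closed_of_finiteDimensional.mem_of_tendsto hlim
      (Eventually.of_forall fun n => X.smul_mem _ (hX _))
  · have h3 : 0 ≤ tm x := by
      refine ge_of_tendsto ((continuous_tm.tendsto x).comp hlim) (Eventually.of_forall fun n => ?_)
      simp only [Function.comp, u]
      rw [tm_smul]
      exact (mul_pos (hr0 _) (ht _)).le
    exact lt_of_le_of_ne h3 (tm_ne_zero hQx.le hx0).symm
  · intro s hs hcomm
    have h1 : lb m x (s x) = 0 := by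
      have hc : Continuous (fun y : Vec (m + 2) => lb m y (s y)) :=
        continuous_lb.comp (continuous_id.prodMk s.continuous)
      have h1 := (hc.tendsto x).comp hlim
      have h2 : ((fun y : Vec (m + 2) => lb m y (s y)) ∘ u ∘ φ)
          = fun n => r (φ n) ^ 2 * lb m v (s v) := by
        funext n
        simp only [Function.comp, u]
        rw [map_smul, map_smul, map_smul, LinearMap.smul_apply, hcomm, smul_eq_mul, smul_eq_mul]
        ring
      rw [h2] at h1
      have h3 := hrφ.mul_const (lb m v (s v))
      rw [zero_mul] at h3
      exact tendsto_nhds_unique h1 h3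
    exact ⟨_, null_prop hQx hx0 (by rw [hs, hQx]) h1⟩

lemma nstep (hl : ∀ g, Lor m (ℓ g)) (htp : ∀ g, TP (ℓ g)) (n : ℕ) :
    ∀ X : Submodule ℝ (Vec (m + 2)), Module.finrank ℝ X ≤ n → ∀ v ∈ X, lorentzQ m v < 0 →
    0 < tm v → ∀ (S : Set G) (K : ℕ), (∀ s ∈ S, s ∈ stab ℓ X) →
    (∀ c ∈ cw S K, ∀ x ∈ X, ℓ c x = x) →
    ∃ x ∈ X, lorentzQ m x ≤ 0 ∧ 0 < tm x ∧ ∀ s ∈ S, ∃ c : ℝ, ℓ s x = c • x := by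
  classical
  induction n with
  | zero =>
    intro X hX v hv hQ
    have : X = ⊥ := Submodule.finrank_eq_zero.1 (Nat.le_zero.1 hX)
    rw [this, Submodule.mem_bot] at hv
    rw [hv, Q_zero] at hQ
    exact absurd hQ (lt_irrefl _)
  | succ n ih =>
    intro X hX v hv hQ hvt S K hS hK
    have hex : ∃ k, ∀ c ∈ cw S k, ∀ x ∈ X, ℓ c x = x := ⟨K, hK⟩
    obtain ⟨k, hk, hmin⟩ : ∃ k, (∀ c ∈ cw S k, ∀ x ∈ X, ℓ c x = x) ∧
        ∀ j < k, ¬ ∀ c ∈ cw S j, ∀ x ∈ X, ℓ c x = x :=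
      ⟨Nat.find hex, Nat.find_spec hex, fun j hj => Nat.find_min hex hj⟩
    rcases k with _ | k
    · exact ⟨v, hv, hQ.le, hvt, fun s hs => ⟨1, by rw [one_smul]; exact hk s hs v hv⟩⟩
    have hnot := hmin k (Nat.lt_succ_self k)
    push Not at hnot
    obtain ⟨z, hz, y, hy, hzy⟩ := hnot
    have hzX : z ∈ stab ℓ X := cw_sub hS k z hz
    have hcomm : ∀ s ∈ S, ∀ x ∈ X, ℓ s (ℓ z x) = ℓ z (ℓ s x) := by
      intro s hs x hx
      have h1 := hk ⁅s, z⁆ ⟨s, hs, z, hz, rfl⟩ (ℓ (z * s) x)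
        (((stab ℓ X).mul_mem hzX (hS s hs)) x hx).1
      rw [← mul_app, ← mul_app, ← h1, ← mul_app]
      congr 2
      rw [commutatorElement_def]; group
    have hzk : ∀ j : ℕ, (ℓ z) ^ j = ℓ (z ^ j) := fun j => (map_pow ℓ z j).symm
    have c1 : ∀ j : ℕ, ((ℓ z) ^ j) v ∈ X := fun j => by
      rw [hzk]; exact ((stab ℓ X).pow_mem hzX j v hv).1
    have c2 : ∀ j : ℕ, lorentzQ m (((ℓ z) ^ j) v) = lorentzQ m v := fun j => by rw [hzk]; exact hl _ v
    have c3 : ∀ j : ℕ, 0 < tm (((ℓ z) ^ j) v) := fun j => by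
      rw [hzk]; exact htp _ v hQ.le hvt
    by_cases hB : ∃ B, ∀ j : ℕ, ‖((ℓ z) ^ j) v‖ ≤ B
    · obtain ⟨B, hB⟩ := hB
      obtain ⟨x, hxX, hxQ, hxt, hzx⟩ := bounded_case X hQ c1 c2 c3 hB
      let X' : Submodule ℝ (Vec (m + 2)) := X ⊓ fixs (ℓ z)
      have memX' : ∀ w, w ∈ X' ↔ w ∈ X ∧ ℓ z w = w := by
        intro w
        exact Iff.rfl
      have hlt : X' < X := by
        refine lt_of_le_of_ne inf_le_left fun he => hzy ?_
        rw [← he] at hy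
        exact ((memX' y).1 hy).2
      have hfr := Submodule.finrank_lt_finrank_of_lt hlt
      obtain ⟨x', hx', r⟩ := ih X' (by omega) x ((memX' x).2 ⟨hxX, hzx⟩) hxQ hxt S K (by
        intro s hs w hw
        obtain ⟨hw1, hw2⟩ := (memX' w).1 hw
        have hsX := hS s hs w hw1
        refine ⟨(memX' _).2 ⟨hsX.1, ?_⟩, (memX' _).2 ⟨hsX.2, ?_⟩⟩
        · rw [← hcomm s hs w hw1, hw2]
        · have h1 := hcomm s hs _ hsX.2
          rw [app_inv, hw2] at h1
          rw [← inv_app ℓ s (ℓ z (ℓ s⁻¹ w)), h1])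
        (fun c hc x hx => hK c hc x ((memX' x).1 hx).1)
      exact ⟨x', ((memX' x').1 hx').1, r⟩
    · push Not at hB
      obtain ⟨x, hxX, hxQ, hxt, hs⟩ := unbounded_case X c1 c2 c3 hB
      refine ⟨x, hxX, hxQ.le, hxt, fun s hsS => hs (ℓ s) (hl s) fun j => ?_⟩
      have h1 : ∀ j : ℕ, ℓ s (((ℓ z) ^ j) v) = ((ℓ z) ^ j) (ℓ s v) := by
        intro j
        induction j with
        | zero => rfl
        | succ j ihj =>
          rw [pow_succ']
          change ℓ s (ℓ z (((ℓ z) ^ j) v)) = ℓ z (((ℓ z) ^ j) (ℓ s v))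
          rw [hcomm s hsS _ (c1 j), ihj]
      rw [h1, hzk, (hl _).lb]

lemma compact_causal : IsCompact {x : Vec (m + 2) | tm x = 1 ∧ lorentzQ m x ≤ 0} := by
  refine Metric.isCompact_of_isClosed_isBounded ?_ ?_
  · exact (isClosed_eq continuous_tm continuous_const).inter
      (isClosed_le continuous_Q continuous_const)
  · refine (Metric.isBounded_closedBall (x := (0 : Vec (m + 2))) (r := 1)).subset ?_
    rintro x ⟨h1, h2⟩
    rw [mem_closedBall_zero_iff, pi_norm_le_iff_of_nonneg zero_le_one]
    intro i
    refine Fin.lastCases ?_ (fun i => ?_) i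
    · change ‖tm x‖ ≤ 1
      rw [h1]; simp
    · rw [Q_eq, h1] at h2
      have h3 : x i.castSucc * x i.castSucc ≤ sp x x :=
        Finset.single_le_sum (f := fun i : Fin (m + 1) => x i.castSucc * x i.castSucc)
          (fun j _ => mul_self_nonneg _) (Finset.mem_univ i)
      rw [Real.norm_eq_abs, abs_le]
      constructor <;> nlinarith

/-- all elements with linear part close to one have a common causal eigenvector -/
lemma common_causal (h : IsAct ℓ τ) (htp : ∀ g, TP (ℓ g)) :
    ∃ x, tm x = 1 ∧ lorentzQ m x ≤ 0 ∧ ∀ g, ‖ℓ g - 1‖ ≤ 1 / 10 → ℓ g x = tm (ℓ g x) • x := by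
  let ι := {g : G // ‖ℓ g - 1‖ ≤ 1 / 10}
  let t : ι → Set (Vec (m + 2)) := fun g => {x | ℓ g.1 x = tm (ℓ g.1 x) • x}
  obtain ⟨x, hx1, hx2⟩ := compact_causal.inter_iInter_nonempty t
    (fun g => isClosed_eq (ℓ g.1).continuous
      ((continuous_tm.comp (ℓ g.1).continuous).smul continuous_id)) (by
    intro u
    let S : Set G := Subtype.val '' (u : Set ι)
    obtain ⟨K, hK⟩ := h.zass (S := S) (u.finite_toSet.image _) (by
      rintro _ ⟨s, -, rfl⟩; exact s.2)
    obtain ⟨x, -, hx1, hx2, hx3⟩ := nstep h.lor htp _ ⊤ le_rfl (e0 m) trivial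
      (by rw [Q_e0]; norm_num) (by rw [tm_e0]; norm_num) S K
      (fun s _ x _ => ⟨trivial, trivial⟩)
      (fun c hc x _ => by rw [hK K le_rfl c hc, map_one]; rfl)
    refine ⟨(tm x)⁻¹ • x, ⟨?_, ?_⟩, ?_⟩
    · rw [tm_smul, inv_mul_cancel₀ hx2.ne']
    · rw [Q_smul]; exact mul_nonpos_of_nonneg_of_nonpos (sq_nonneg _) hx1
    · simp only [Set.mem_iInter]
      intro g hg
      obtain ⟨c, hc⟩ := hx3 g.1 ⟨g, hg, rfl⟩
      change ℓ g.1 ((tm x)⁻¹ • x) = tm (ℓ g.1 ((tm x)⁻¹ • x)) • (tm x)⁻¹ • x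
      rw [map_smul, hc, tm_smul, tm_smul, mul_left_comm, inv_mul_cancel₀ hx2.ne', mul_one,
        smul_comm])
  exact ⟨x, hx1.1, hx1.2, fun g hg => (Set.mem_iInter.1 hx2) ⟨g, hg⟩⟩

end LZ

namespace LZ
open scoped commutatorElement
open Filter Topology

variable {m : ℕ}
variable {G : Type*} [Group G] {ℓ : G →* (Vec (m + 2) →L[ℝ] Vec (m + 2))} {τ : G → Vec (m + 2)}

lemma near_conj (ℓ : G →* (Vec (m + 2) →L[ℝ] Vec (m + 2))) (h : G) {ε : ℝ} (hε : 0 < ε) :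
    ∃ ε' > 0, ∀ g, ‖ℓ g - 1‖ < ε' → ‖ℓ (h⁻¹ * g * h) - 1‖ < ε := by
  refine ⟨ε / (‖ℓ h⁻¹‖ * ‖ℓ h‖ + 1), by positivity, fun g hg => ?_⟩
  have e : ℓ (h⁻¹ * g * h) - 1 = ℓ h⁻¹ * (ℓ g - 1) * ℓ h := by
    rw [mul_sub, sub_mul, mul_one, inv_mul_l, map_mul, map_mul]
  rw [lt_div_iff₀ (by positivity)] at hg
  rw [e]
  calc _ ≤ ‖ℓ h⁻¹‖ * ‖ℓ g - 1‖ * ‖ℓ h‖ :=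
        (norm_mul_le _ _).trans (by gcongr; exact norm_mul_le _ _)
    _ ≤ ‖ℓ g - 1‖ * (‖ℓ h⁻¹‖ * ‖ℓ h‖ + 1) := by nlinarith [norm_nonneg (ℓ g - 1)]
    _ < ε := hg

/-- vectors fixed by all elements close to one -/
def Fsp (ℓ : G →* (Vec (m + 2) →L[ℝ] Vec (m + 2))) : Submodule ℝ (Vec (m + 2)) where
  carrier := {v | ∃ ε > 0, ∀ g, ‖ℓ g - 1‖ < ε → ℓ g v = v}
  add_mem' := by
    rintro x y ⟨ε, h1, h2⟩ ⟨ε', h1', h2'⟩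
    refine ⟨min ε ε', lt_min h1 h1', fun g hg => ?_⟩
    rw [map_add, h2 g (hg.trans_le (min_le_left _ _)), h2' g (hg.trans_le (min_le_right _ _))]
  zero_mem' := ⟨1, one_pos, fun g _ => map_zero _⟩
  smul_mem' := by
    rintro c x ⟨ε, h1, h2⟩
    exact ⟨ε, h1, fun g hg => by rw [map_smul, h2 g hg]⟩

lemma Fsp_inv (g : G) {x : Vec (m + 2)} (hx : x ∈ Fsp ℓ) : ℓ g x ∈ Fsp ℓ := by
  obtain ⟨ε, h1, h2⟩ := hx
  obtain ⟨ε', h1', h2'⟩ := near_conj ℓ g h1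
  refine ⟨ε', h1', fun k hk => ?_⟩
  have := h2 _ (h2' k hk)
  rw [mul_app, mul_app] at this
  conv_rhs => rw [← this]
  rw [app_inv]

lemma Fsp_unif (ℓ : G →* (Vec (m + 2) →L[ℝ] Vec (m + 2))) :
    ∃ ε > 0, ∀ g, ‖ℓ g - 1‖ < ε → ∀ x ∈ Fsp ℓ, ℓ g x = x := by
  classical
  obtain ⟨s, hs⟩ := (IsNoetherian.noetherian (Fsp ℓ) : (Fsp ℓ).FG)
  have h : ∀ t : Finset (Vec (m + 2)), (∀ x ∈ t, x ∈ Fsp ℓ) →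
      ∃ ε > 0, ∀ g, ‖ℓ g - 1‖ < ε → ∀ x ∈ t, ℓ g x = x := by
    intro t
    induction t using Finset.induction_on with
    | empty => exact fun _ => ⟨1, one_pos, fun g _ x hx => by simp at hx⟩
    | insert a t ha ih =>
      intro ht
      obtain ⟨ε, h1, h2⟩ := ih fun x hx => ht x (Finset.mem_insert_of_mem hx)
      obtain ⟨ε', h1', h2'⟩ := ht a (Finset.mem_insert_self a t)
      refine ⟨min ε ε', lt_min h1 h1', fun g hg x hx => ?_⟩
      rcases Finset.mem_insert.1 hx with rfl | hx
      · exact h2' g (hg.trans_le (min_le_right _ _))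
      · exact h2 g (hg.trans_le (min_le_left _ _)) x hx
  obtain ⟨ε, h1, h2⟩ := h s fun x hx => by rw [← hs]; exact Submodule.subset_span hx
  refine ⟨ε, h1, fun g hg x hx => ?_⟩
  have : Fsp ℓ ≤ fixs (ℓ g) := by
    rw [← hs, Submodule.span_le]
    exact fun x hx => h2 g hg x hx
  exact this hx

/-- null directions preserved by all elements close to one -/
def Eset (ℓ : G →* (Vec (m + 2) →L[ℝ] Vec (m + 2))) : Set (Vec (m + 2)) :=
  {a | tm a = 1 ∧ lorentzQ m a = 0 ∧ ∃ ε > 0, ∀ g, ‖ℓ g - 1‖ < ε → ∃ c : ℝ, ℓ g a = c • a}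

lemma ne_zero_of_tm {a : Vec (m + 2)} (h : 0 < tm a) : a ≠ 0 := by
  rintro rfl; simp [tm_zero] at h

lemma lb_ne_of_null {a b : Vec (m + 2)} (ha : tm a = 1) (ha' : lorentzQ m a = 0)
    (hb : tm b = 1) (hb' : lorentzQ m b = 0) (hab : a ≠ b) : lb m a b < 0 := by
  refine lt_of_le_of_ne (lb_nonpos ha'.le (by rw [ha]; norm_num) hb'.le (by rw [hb]; norm_num))
    fun h0 => hab ?_
  have := null_prop ha' (ne_zero_of_tm (by rw [ha]; norm_num)) hb' h0
  rw [this, ha, hb]; simp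

lemma stab_line_VS (h : IsAct ℓ τ) {a : Vec (m + 2)} (hE : (Eset ℓ).Finite)
    (ha : a ∈ Eset ℓ) (htp : ∀ g, TP (ℓ g)) : VSt G := by
  have ha0 : a ≠ 0 := ne_zero_of_tm (by rw [ha.1]; norm_num)
  let H : Subgroup G :=
    { carrier := {g | ∃ c : ℝ, ℓ g a = c • a}
      mul_mem' := by
        rintro x y ⟨c, hc⟩ ⟨d, hd⟩
        exact ⟨d * c, by rw [mul_app, hd, map_smul, hc, smul_smul]⟩
      one_mem' := ⟨1, by rw [map_one]; simp⟩
      inv_mem' := by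
        rintro x ⟨c, hc⟩
        have hc0 : c ≠ 0 := by
          rintro rfl
          rw [zero_smul] at hc
          exact ha0 (by rw [← inv_app ℓ x a, hc, map_zero])
        refine ⟨c⁻¹, ?_⟩
        have : ℓ x⁻¹ (c • a) = a := by rw [← hc, inv_app]
        rw [map_smul] at this
        nth_rw 2 [← this]
        rw [smul_smul, inv_mul_cancel₀ hc0, one_smul] }
  have hat : ∀ g, 0 < tm (ℓ g a) := fun g => htp g a ha.2.1.le (by rw [ha.1]; norm_num)
  let φ : G → Vec (m + 2) := fun g => (tm (ℓ g a))⁻¹ • ℓ g a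
  have hφ : ∀ g, φ g ∈ Eset ℓ := by
    intro g
    obtain ⟨h1, h2, ε, h3, h4⟩ := ha
    refine ⟨?_, ?_, ?_⟩
    · simp only [φ]; rw [tm_smul, inv_mul_cancel₀ (hat g).ne']
    · simp only [φ]; rw [Q_smul, h.lor, h2, mul_zero]
    · obtain ⟨ε', h1', h2'⟩ := near_conj ℓ g h3
      refine ⟨ε', h1', fun k hk => ?_⟩
      obtain ⟨c, hc⟩ := h4 _ (h2' k hk)
      refine ⟨c, ?_⟩
      simp only [φ]
      rw [mul_app, mul_app] at hc
      have : ℓ k (ℓ g a) = c • ℓ g a := by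
        rw [← app_inv ℓ g (ℓ k (ℓ g a)), hc, map_smul]
      rw [map_smul, this, smul_comm]
  have hfin : Finite (G ⧸ H) := by
    have : Finite (Eset ℓ) := hE
    refine Finite.of_injective (fun q : G ⧸ H => (⟨φ q.out, hφ _⟩ : Eset ℓ)) ?_
    intro q q' hq
    have hq : φ q.out = φ q'.out := congrArg Subtype.val hq
    rw [← QuotientGroup.out_eq' q, ← QuotientGroup.out_eq' q', QuotientGroup.eq]
    set g := q.out
    set g' := q'.out
    refine ⟨(tm (ℓ g' a)) * (tm (ℓ g a))⁻¹, ?_⟩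
    have e : ℓ g' a = (tm (ℓ g' a)) • φ g' := by
      simp only [φ]; rw [smul_smul, mul_inv_cancel₀ (hat g').ne', one_smul]
    have e2 : ℓ g' a = ((tm (ℓ g' a)) * (tm (ℓ g a))⁻¹) • ℓ g a := by
      rw [mul_smul]
      change _ = _ • φ g
      rw [hq]; exact e
    rw [mul_app, e2, map_smul, inv_app]
    rw [← e2]
  have hH : H.FiniteIndex := Subgroup.finiteIndex_of_finite_quotient
  refine VSt.of_sub H hH (case_b (h.res H hH) ha.2.1 (by rw [ha.1]; norm_num) ?_)
  exact fun g => g.2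

lemma F_step (h : IsAct ℓ τ) (htp : ∀ g, TP (ℓ g)) (hns : ¬ VSt G) :
    ∃ v ∈ Fsp ℓ, lorentzQ m v < 0 ∧ 0 < tm v := by
  obtain ⟨x, hx1, hx2, hx3⟩ := common_causal h htp
  rcases hx2.lt_or_eq with hx2 | hx2
  · refine ⟨x, ⟨1 / 10, by norm_num, fun g hg => ?_⟩, hx2, by rw [hx1]; norm_num⟩
    exact eig_of_timelike (h.lor g) (htp g) hx2 (by rw [hx1]; norm_num) (hx3 g hg.le)
  have hxE : x ∈ Eset ℓ := ⟨hx1, hx2, 1 / 10, by norm_num, fun g hg => ⟨_, hx3 g hg.le⟩⟩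
  by_cases hE : (Eset ℓ).Finite
  · exact absurd (stab_line_VS h hE hxE htp) hns
  obtain ⟨t, ht, ht3⟩ := Set.Infinite.exists_subset_card_eq hE 3
  obtain ⟨a, b, c, hab, hac, hbc, rfl⟩ := Finset.card_eq_three.1 ht3
  obtain ⟨a1, a2, εa, a3, a4⟩ : a ∈ Eset ℓ := ht (by simp)
  obtain ⟨b1, b2, εb, b3, b4⟩ : b ∈ Eset ℓ := ht (by simp)
  obtain ⟨c1, c2, εc, c3, c4⟩ : c ∈ Eset ℓ := ht (by simp)
  have l1 := lb_ne_of_null a1 a2 b1 b2 hab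
  have l2 := lb_ne_of_null a1 a2 c1 c2 hac
  have l3 := lb_ne_of_null b1 b2 c1 c2 hbc
  refine ⟨a + b, ⟨min εa (min εb εc), by positivity, fun g hg => ?_⟩, ?_, ?_⟩
  · obtain ⟨p, hp⟩ := a4 g (hg.trans_le (min_le_left _ _))
    obtain ⟨q, hq⟩ := b4 g (hg.trans_le ((min_le_right _ _).trans (min_le_left _ _)))
    obtain ⟨r, hr⟩ := c4 g (hg.trans_le ((min_le_right _ _).trans (min_le_right _ _)))
    have key : ∀ {u v : Vec (m + 2)} {α β : ℝ}, ℓ g u = α • u → ℓ g v = β • v →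
        lb m u v < 0 → α * β = 1 := by
      intro u v α β hu hv huv
      have := (h.lor g).lb u v
      rw [hu, hv, map_smul, map_smul, LinearMap.smul_apply, smul_eq_mul, smul_eq_mul] at this
      have h2 : (α * β - 1) * lb m u v = 0 := by linarith
      rcases mul_eq_zero.1 h2 with h2 | h2
      · linarith
      · exact absurd h2 huv.ne
    have pos : ∀ {u : Vec (m + 2)} {α : ℝ}, ℓ g u = α • u → tm u = 1 → lorentzQ m u = 0 → 0 < α := by
      intro u α hu h1 h2
      have := htp g u h2.le (by rw [h1]; norm_num)
      rw [hu, tm_smul, h1] at this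
      linarith
    have k1 := key hp hq l1
    have k2 := key hp hr l2
    have k3 := key hq hr l3
    have p0 := pos hp a1 a2
    have q0 := pos hq b1 b2
    have r0 := pos hr c1 c2
    have hqr : q = r := mul_left_cancel₀ p0.ne' (by rw [k1, k2])
    have hq1 : q = 1 := by rw [← hqr] at k3; nlinarith
    have hp1 : p = 1 := by rw [hq1, mul_one] at k1; exact k1
    rw [map_add, hp, hq, hp1, hq1, one_smul, one_smul]
  · rw [Q_add, a2, b2]; linarith
  · rw [tm_add, a1, b1]; norm_num

end LZ

namespace LZ
open scoped commutatorElement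
open Filter Topology

variable {m : ℕ}
variable {G : Type*} [Group G] {ℓ : G →* (Vec (m + 2) →L[ℝ] Vec (m + 2))} {τ : G → Vec (m + 2)}

lemma timelike_data (ℓ : G →* (Vec (m + 2) →L[ℝ] Vec (m + 2))) (hl : ∀ g, Lor m (ℓ g))
    (D : Submodule ℝ (Vec (m + 2))) (hD : ∀ g, ∀ x ∈ D, ℓ g x ∈ D) {v : Vec (m + 2)}
    (hv : v ∈ D) (hv' : lorentzQ m v < 0) :
    ∃ (P : Vec (m + 2) →L[ℝ] Vec (m + 2)) (σ : G →* (Vec (m + 2) →L[ℝ] Vec (m + 2))) (C : ℝ),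
      1 ≤ C ∧ (∀ x, ∀ y ∈ D, lb m y (P x) = 0) ∧ (∀ x, x - P x ∈ D) ∧ (∀ x ∈ D, P x = 0) ∧
      (∀ g x, P (ℓ g x) = ℓ g (P x)) ∧ (∀ g x, σ g x = ℓ g (P x) + (x - P x)) ∧
      (∀ g, ‖σ g‖ ≤ C) ∧ (∀ x, P x ≠ 0 → 0 < lorentzQ m (P x)) ∧ (∀ x, P (P x) = P x) := by
  have hnd : ∀ x ∈ D, (∀ y ∈ D, lb m y x = 0) → x = 0 := by
    intro x hx hy
    by_contra h0
    have := Q_pos_of_orth hv' (hy v hv) h0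
    rw [← lb_self, hy x hx] at this
    exact lt_irrefl _ this
  obtain ⟨P, p1, p2, p3, p4⟩ := exists_proj D hnd
  have pc : ∀ g x, P (ℓ g x) = ℓ g (P x) := fun g x =>
    proj_comm p1 p2 p3 p4 (hl g) (hD g)
      (fun y hy => ⟨ℓ g⁻¹ y, hD _ _ hy, app_inv ℓ g y⟩) x
  have pp : ∀ x, P (P x) = P x := fun x => p4 _ (p1 x)
  obtain ⟨C, hC, hC'⟩ := bounded_on_def (vperp v)
    (fun x hx hx0 => Q_pos_of_orth hv' (mem_vperp.1 hx) hx0) P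
  let σ : G →* (Vec (m + 2) →L[ℝ] Vec (m + 2)) :=
    { toFun := fun g => ℓ g * P + (1 - P)
      map_one' := by ext1 x; simp
      map_mul' := by
        intro a b
        ext1 x
        change ℓ (a * b) (P x) + (x - P x) =
          ℓ a (P (ℓ b (P x) + (x - P x))) + ((ℓ b (P x) + (x - P x)) - P (ℓ b (P x) + (x - P x)))
        have : P (ℓ b (P x) + (x - P x)) = ℓ b (P x) := by
          rw [map_add, pc, pp, map_sub, pp]; simp
        rw [this, mul_app]; abel }
  refine ⟨P, σ, max 1 (C + ‖1 - P‖), le_max_left _ _, p1, p2, p3, pc, fun g x => rfl, ?_, ?_, pp⟩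
  · intro g
    refine le_trans ?_ (le_max_right _ _)
    refine (norm_add_le _ _).trans (add_le_add_left (hC' _ fun x => ⟨?_, ?_⟩) _)
    · rw [mem_vperp]
      change lb m v (ℓ g (P x)) = 0
      rw [← pc]
      exact p1 _ v hv
    · exact hl g (P x)
  · intro x hx
    exact Q_pos_of_orth hv' (p1 x v hv) hx

/-- cocompactness forces an invariant timelike affine subspace to be everything -/
lemma cc_top (h : IsAct ℓ τ) (D : Submodule ℝ (Vec (m + 2))) (hD : ∀ g, ∀ x ∈ D, ℓ g x ∈ D)
    {v : Vec (m + 2)} (hv : v ∈ D) (hv' : lorentzQ m v < 0) (p : Vec (m + 2))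
    (hp : ∀ g, ℓ g p + τ g - p ∈ D) : D = ⊤ := by
  obtain ⟨P, σ, C, -, p1, p2, p3, pc, -, -, ppos, -⟩ := timelike_data ℓ h.lor D hD hv hv'
  obtain ⟨R, hR⟩ := h.cc
  obtain ⟨C, hC, hC'⟩ := Q_le_norm (m := m)
  have hb : ∀ y, lorentzQ m (P y) ≤ C * (‖P‖ * (R + ‖p‖)) ^ 2 := by
    intro y
    obtain ⟨g, hg⟩ := hR (y + p)
    have e : P (ℓ g (y + p) + τ g - p) = ℓ g (P y) := by
      have : ℓ g (y + p) + τ g - p = ℓ g y + (ℓ g p + τ g - p) := by rw [map_add]; abel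
      rw [this, map_add, p3 _ (hp g), pc, add_zero]
    rw [← h.lor g (P y), ← e]
    refine (hC' _).trans ?_
    gcongr
    refine (P.le_opNorm _).trans ?_
    gcongr
    exact (norm_sub_le _ _).trans (by gcongr)
  rw [eq_top_iff]
  intro y _
  by_cases h0 : P y = 0
  · have := p2 y
    rwa [h0, sub_zero] at this
  · exfalso
    have h1 := ppos y h0
    set B := C * (‖P‖ * (R + ‖p‖)) ^ 2
    have hB : 0 ≤ B := by positivity
    have h2 := hb ((1 + B / lorentzQ m (P y)) • y)
    rw [map_smul, Q_smul] at h2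
    have h3 : (1 + B / lorentzQ m (P y)) * lorentzQ m (P y) = lorentzQ m (P y) + B := by
      field_simp
    have h4 : 0 ≤ B / lorentzQ m (P y) := by positivity
    nlinarith

lemma fix_orth {A : Vec (m + 2) →L[ℝ] Vec (m + 2)} (hA : Lor m A) {t : Vec (m + 2)} (ht : A t = t)
    (b : Vec (m + 2)) : lb m t (A b - b) = 0 := by
  have := hA.lb t b
  rw [ht] at this
  rw [map_sub, this, sub_self]

lemma unip {A : Vec (m + 2) →L[ℝ] Vec (m + 2)} (hA : Lor m A) {v : Vec (m + 2)}
    (hv : lorentzQ m v < 0) (hfix : A v = v) {x : Vec (m + 2)}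
    (hx : A (A x - x) = A x - x) : A x = x := by
  have h1 := fix_orth hA hfix x
  have h2 := fix_orth hA hx x
  rw [lb_self] at h2
  by_contra h0
  exact (Q_pos_of_orth hv h1 (sub_ne_zero.2 h0)).ne' h2

lemma fix_mul {a b : G} {x : Vec (m + 2)} (ha : ℓ a x = x) (hb : ℓ b x = x) : ℓ (a * b) x = x := by
  rw [mul_app, hb, ha]
lemma fix_inv {a : G} {x : Vec (m + 2)} (ha : ℓ a x = x) : ℓ a⁻¹ x = x := by
  conv_lhs => rw [← ha]
  rw [inv_app]
lemma fix_comm {a b : G} {x : Vec (m + 2)} (ha : ℓ a x = x) (hb : ℓ b x = x) : ℓ ⁅a, b⁆ x = x := by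
  rw [commutatorElement_def]
  exact fix_mul (fix_mul (fix_mul ha hb) (fix_inv ha)) (fix_inv hb)

lemma comm_ker_tau (h : IsAct ℓ τ) {a c : G} (hc : ℓ c = 1) :
    ℓ ⁅a, c⁆ = 1 ∧ τ ⁅a, c⁆ = ℓ a (τ c) - τ c := by
  have h1 : ℓ ⁅a, c⁆ = 1 := by
    have hi : ℓ c⁻¹ = 1 := by
      have := inv_mul_l ℓ c
      rwa [hc, mul_one] at this
    rw [commutatorElement_def, map_mul, map_mul, map_mul, hc, hi, mul_one, mul_one, mul_inv_l]
  refine ⟨h1, ?_⟩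
  have e : ⁅a, c⁆ * (c * a) = a * c := by rw [commutatorElement_def]; group
  have := congrArg τ e
  rw [h.coc, h.coc, h.coc, h1, hc] at this
  simp only [one_apply_eq_self] at this
  rw [eq_sub_iff_add_eq]
  have h2 : (τ ⁅a, c⁆ + τ c) + τ a = ℓ a (τ c) + τ a := by rw [add_assoc, this]; abel
  exact add_right_cancel h2

/-- if linear parts commute and iterated commutators die, the translation part of the commutator
is fixed -/
lemma comm_fix (h : IsAct ℓ τ) {v : Vec (m + 2)} (hv : lorentzQ m v < 0) {a b : G}
    (ha : ℓ a v = v) (hab : ℓ ⁅a, b⁆ = 1) (hk : ∃ K, ∀ k ≥ K, itc a b k = 1) :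
    ℓ a (τ ⁅a, b⁆) = τ ⁅a, b⁆ := by
  obtain ⟨K, hK⟩ := hk
  have hl : ∀ k, ℓ (itc a b (k + 1)) = 1 := by
    intro k
    induction k with
    | zero => exact hab
    | succ k ih => exact (comm_ker_tau h ih).1
  have hs : ∀ k, τ (itc a b (k + 2)) = ℓ a (τ (itc a b (k + 1))) - τ (itc a b (k + 1)) :=
    fun k => (comm_ker_tau h (hl k)).2
  have hd : ∀ j k, τ (itc a b (k + j + 2)) = 0 → τ (itc a b (k + 2)) = 0 := by
    intro j
    induction j with
    | zero => exact fun k hk => hk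
    | succ j ih =>
      intro k hk
      apply ih
      have e1 : k + (j + 1) + 2 = (k + j + 1) + 2 := by ring
      rw [e1, hs] at hk
      have e2 : k + j + 1 + 1 = (k + j) + 2 := by ring
      rw [e2, hs] at hk
      rw [hs, unip (h.lor a) hv ha (sub_eq_zero.1 hk), sub_self]
  have := hd K 0 (by rw [hK _ (by omega), h.tau_one])
  rw [hs] at this
  exact sub_eq_zero.1 this

lemma itc_one (h : IsAct ℓ τ) {a b : G} (ha : ‖ℓ a - 1‖ ≤ 1 / 10) (hb : ‖ℓ b - 1‖ ≤ 1 / 10) :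
    ∃ K, ∀ k ≥ K, itc a b k = 1 := by
  obtain ⟨K, hK⟩ := h.zass (S := {a, b}) (by simp) (by rintro s (rfl | rfl) <;> assumption)
  exact ⟨K, fun k hk => hK k hk _ (itc_mem_cw a b k)⟩

lemma comm_one (h : IsAct ℓ τ) {v : Vec (m + 2)} (hv : lorentzQ m v < 0) {a b : G}
    (ha : ℓ a v = v) (hb : ℓ b v = v) (hab : ℓ ⁅a, b⁆ = 1)
    (ha' : ‖ℓ a - 1‖ ≤ 1 / 10) (hb' : ‖ℓ b - 1‖ ≤ 1 / 10) : ⁅a, b⁆ = 1 := by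
  have h1 := comm_fix h hv ha hab (itc_one h ha' hb')
  have e1 : ⁅b, a⁆ = ⁅a, b⁆⁻¹ := (commutatorElement_inv a b).symm
  have hi : ℓ ⁅a, b⁆⁻¹ = 1 := by
    have := inv_mul_l ℓ ⁅a, b⁆
    rwa [hab, mul_one] at this
  have h2 := comm_fix h hv hb (by rw [e1, hi]) (itc_one h hb' ha')
  have e2 : τ ⁅b, a⁆ = - τ ⁅a, b⁆ := by
    have := h.tau_inv ⁅a, b⁆
    rw [hab, ← e1] at this
    exact this
  rw [e2, map_neg, neg_inj] at h2
  have e : ⁅a, b⁆ * (b * a) = a * b := by rw [commutatorElement_def]; group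
  have h3 := congrArg τ e
  rw [h.coc, h.coc, h.coc, hab] at h3
  simp only [one_apply_eq_self] at h3
  have h4 : τ ⁅a, b⁆ = (ℓ a (τ b) - τ b) - (ℓ b (τ a) - τ a) := by
    rw [eq_sub_of_add_eq h3]; abel
  apply h.inj _ hab
  by_contra h0
  have h5 : lb m v (τ ⁅a, b⁆) = 0 := by
    rw [h4, map_sub, fix_orth (h.lor a) ha, fix_orth (h.lor b) hb, sub_zero]
  have h6 := Q_pos_of_orth hv h5 h0
  rw [← lb_self] at h6
  have h7 : lb m (τ ⁅a, b⁆) (τ ⁅a, b⁆) = 0 := by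
    have : ∀ w, w = (ℓ a (τ b) - τ b) - (ℓ b (τ a) - τ a) → lb m (τ ⁅a, b⁆) w = 0 := by
      rintro w rfl
      rw [map_sub, fix_orth (h.lor a) h1, fix_orth (h.lor b) h2, sub_zero]
    exact this _ h4
  exact h6.ne' h7

/-- subspace fixed by a set -/
def DS (ℓ : G →* (Vec (m + 2) →L[ℝ] Vec (m + 2))) (T : Set G) : Submodule ℝ (Vec (m + 2)) where
  carrier := {x | ∀ a ∈ T, ℓ a x = x}
  add_mem' := fun hx hy a ha => by rw [map_add, hx a ha, hy a ha]
  zero_mem' := fun a _ => map_zero _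
  smul_mem' := fun c x hx a ha => by rw [map_smul, hx a ha]

/-- generalized axis -/
def MS (ℓ : G →* (Vec (m + 2) →L[ℝ] Vec (m + 2))) (τ : G → Vec (m + 2)) (T : Set G) :
    Set (Vec (m + 2)) := {x | ∀ a ∈ T, ℓ a (ℓ a x + τ a - x) = ℓ a x + τ a - x}

lemma DS_inv {T : Set G} {g : G} (hT : ∀ a ∈ T, g⁻¹ * a * g ∈ T) {x : Vec (m + 2)}
    (hx : x ∈ DS ℓ T) : ℓ g x ∈ DS ℓ T := by
  intro a ha
  have := hx _ (hT a ha)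
  rw [mul_app, mul_app] at this
  conv_rhs => rw [← this]
  rw [app_inv]

lemma MS_inv (h : IsAct ℓ τ) {T : Set G} {g : G} (hT : ∀ a ∈ T, g⁻¹ * a * g ∈ T) {x : Vec (m + 2)}
    (hx : x ∈ MS ℓ τ T) : ℓ g x + τ g ∈ MS ℓ τ T := by
  intro a ha
  have h1 := hx _ (hT a ha)
  set b := g⁻¹ * a * g
  have e : a * g = g * b := by simp only [b]; group
  clear_value b
  have e1 : ℓ a (ℓ g x + τ g) + τ a - (ℓ g x + τ g) = ℓ g (ℓ b x + τ b - x) := by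
    have h2 : ℓ a (ℓ g x + τ g) + τ a = ℓ (a * g) x + τ (a * g) := by
      rw [h.coc, mul_app, map_add]; abel
    have h3 : ℓ g (ℓ b x + τ b) + τ g = ℓ (g * b) x + τ (g * b) := by
      rw [h.coc, mul_app, map_add]; abel
    rw [h2, e, ← h3, map_sub]; abel
  rw [e1, ← mul_app, e, mul_app, h1]

lemma MS_sub (h : IsAct ℓ τ) {T : Set G} {v : Vec (m + 2)} (hv : lorentzQ m v < 0)
    (hT : ∀ a ∈ T, ℓ a v = v) {x y : Vec (m + 2)}
    (hx : x ∈ MS ℓ τ T) (hy : y ∈ MS ℓ τ T) : x - y ∈ DS ℓ T := by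
  intro a ha
  apply unip (h.lor a) hv (hT a ha)
  have e : ℓ a (x - y) - (x - y) = (ℓ a x + τ a - x) - (ℓ a y + τ a - y) := by
    rw [map_sub]; abel
  rw [e, map_sub, hx a ha, hy a ha]

/-- kernel/range decomposition -/
lemma ker_range {A : Vec (m + 2) →L[ℝ] Vec (m + 2)} (D : Submodule ℝ (Vec (m + 2)))
    (hD : ∀ x ∈ D, A x ∈ D) (hA : ∀ x, A (A x - x) = A x - x → A x = x) {d : Vec (m + 2)}
    (hd : d ∈ D) : ∃ y ∈ D, A (A y - y + d) = A y - y + d := by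
  let N : D →ₗ[ℝ] D := ((A : Vec (m + 2) →ₗ[ℝ] Vec (m + 2)).restrict hD) - 1
  have hN : ∀ x : D, ((N x : D) : Vec (m + 2)) = A x - x := fun x => rfl
  have hdis : Disjoint (LinearMap.range N) (LinearMap.ker N) := by
    rw [Submodule.disjoint_def]
    rintro _ ⟨x, rfl⟩ hx
    have h1 : ((N (N x) : D) : Vec (m + 2)) = 0 := by rw [LinearMap.mem_ker.1 hx]; rfl
    rw [hN, hN, sub_eq_zero] at h1
    apply Subtype.ext
    rw [hN, hA _ h1]; simp
  have hsup : LinearMap.range N ⊔ LinearMap.ker N = ⊤ := by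
    apply Submodule.eq_top_of_disjoint _ _ _ hdis
    rw [LinearMap.finrank_range_add_finrank_ker]
  obtain ⟨_, ⟨y, rfl⟩, k, hk, e⟩ := Submodule.mem_sup.1 (hsup ▸ Submodule.mem_top : (⟨d, hd⟩ : D) ∈ LinearMap.range N ⊔ LinearMap.ker N)
  have e' : A y - y + k = d := by
    have := congrArg Subtype.val e
    exact this
  have hk' : A k - k = 0 := by
    have := congrArg Subtype.val (LinearMap.mem_ker.1 hk)
    exact this
  refine ⟨-y, D.neg_mem y.2, ?_⟩
  have : A (-(y : Vec (m + 2))) - -(y : Vec (m + 2)) + d = k := by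
    rw [← e', map_neg]; abel
  rw [this]; exact sub_eq_zero.1 hk'

/-- the linear holonomy is discrete -/
lemma D_step (h : IsAct ℓ τ) {v : Vec (m + 2)} (hvF : v ∈ Fsp ℓ) (hv : lorentzQ m v < 0) :
    ∃ ε > 0, ∀ g, ‖ℓ g - 1‖ < ε → ℓ g = 1 := by
  obtain ⟨P, σ, C, hC1, p1, p2, p3, pc, hσ, hσC, ppos, pp⟩ :=
    timelike_data ℓ h.lor (Fsp ℓ) (fun g x hx => Fsp_inv g hx) hvF hv
  have hσl : ∀ g, (∀ x ∈ Fsp ℓ, ℓ g x = x) → σ g = ℓ g := by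
    intro g hg
    ext1 x
    rw [hσ]
    conv_lhs => rw [← hg _ (p2 x)]
    rw [← map_add]; congr 1; abel
  obtain ⟨ε, hε, hF⟩ := Fsp_unif ℓ
  obtain ⟨δ, hδ0, hδ1, hδ2⟩ := exists_delta hC1 (ε0 := 1 / 10) (by norm_num)
  let S : Set G := {g | (∀ x ∈ Fsp ℓ, ℓ g x = x) ∧ ∀ k, ‖ℓ (k * g * k⁻¹) - 1‖ ≤ δ}
  have hfc : ∀ g, (∀ x ∈ Fsp ℓ, ℓ g x = x) → ∀ k, ∀ x ∈ Fsp ℓ, ℓ (k * g * k⁻¹) x = x := by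
    intro g hg k x hx
    rw [mul_app, mul_app, hg _ (Fsp_inv _ hx), app_inv]
  have hSn : ∀ g ∈ S, ‖ℓ g - 1‖ ≤ δ := by
    intro g hg
    have := hg.2 1
    simpa using this
  have hSc : ∀ a ∈ S, ∀ b ∈ S, a * b = b * a := by
    intro a ha b hb
    rw [← commutatorElement_eq_one_iff_mul_comm]
    have na := hSn a ha
    have nb := hSn b hb
    refine comm_one h hv (ha.1 v hvF) (hb.1 v hvF) ?_ (na.trans hδ1) (nb.trans hδ1)
    rw [← hσl _ fun x hx => fix_comm (ha.1 x hx) (hb.1 x hx)]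
    obtain ⟨K, hK⟩ := itc_one h (na.trans hδ1) (nb.trans hδ1)
    refine unit_iter σ hC1 hσC hδ2 ?_ ?_ ⟨K, by rw [hK K le_rfl, map_one]⟩
    · rwa [hσl _ ha.1]
    · rwa [hσl _ hb.1]
  have hSi : ∀ g, ∀ a ∈ S, g⁻¹ * a * g ∈ S := by
    intro g a ha
    refine ⟨?_, fun k => ?_⟩
    · have := hfc a ha.1 g⁻¹
      simpa using this
    · have := ha.2 (k * g⁻¹)
      have e : k * g⁻¹ * a * (k * g⁻¹)⁻¹ = k * (g⁻¹ * a * g) * k⁻¹ := by group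
      rwa [e] at this
  have hSnear : ∀ g, ‖ℓ g - 1‖ < min ε (δ / (C * C)) → g ∈ S := by
    intro g hg
    have h1 := hF g (hg.trans_le (min_le_left _ _))
    refine ⟨h1, fun k => ?_⟩
    rw [← hσl _ (hfc g h1 k)]
    have h2 : ‖σ g - 1‖ ≤ δ / (C * C) := by
      rw [hσl _ h1]; exact (hg.trans_le (min_le_right _ _)).le
    refine (norm_conj_sub_one σ (by linarith) hσC h2 k).trans (le_of_eq ?_)
    field_simp
  -- minimal fixed space
  obtain ⟨n, ⟨T, hTS, hTM, hTn⟩, hmin⟩ : ∃ n, (∃ T ⊆ S, (MS ℓ τ T).Nonempty ∧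
      Module.finrank ℝ (DS ℓ T) = n) ∧ ∀ k < n, ¬ ∃ T ⊆ S, (MS ℓ τ T).Nonempty ∧
      Module.finrank ℝ (DS ℓ T) = k := by
    classical
    have : ∃ n, ∃ T ⊆ S, (MS ℓ τ T).Nonempty ∧ Module.finrank ℝ (DS ℓ T) = n :=
      ⟨_, ∅, Set.empty_subset _, ⟨0, fun a ha => absurd ha (Set.notMem_empty a)⟩, rfl⟩
    exact ⟨Nat.find this, Nat.find_spec this, fun k hk => Nat.find_min this hk⟩
  obtain ⟨p, hp⟩ := hTM
  have hTconj : ∀ b ∈ S, ∀ a ∈ T, b⁻¹ * a * b ∈ T := by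
    intro b hb a ha
    have e : b⁻¹ * a * b = a := by rw [mul_assoc, hSc a (hTS ha) b hb]; group
    rwa [e]
  have hTv : ∀ a ∈ T, ℓ a v = v := fun a ha => (hTS ha).1 v hvF
  have hfix : ∀ b ∈ S, ∀ x ∈ DS ℓ T, ℓ b x = x := by
    intro b hb
    by_contra hcon
    push Not at hcon
    obtain ⟨x0, hx0, hx0'⟩ := hcon
    obtain ⟨y, hy, hy'⟩ := ker_range (A := ℓ b) (DS ℓ T) (fun x hx => DS_inv (hTconj b hb) hx)
      (fun x hx => unip (h.lor b) hv (hb.1 v hvF) hx)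
      (MS_sub h hv hTv (MS_inv h (hTconj b hb) hp) hp)
    have hlt : DS ℓ (insert b T) < DS ℓ T := by
      refine lt_of_le_of_ne (fun x hx a ha => hx a (Set.mem_insert_of_mem _ ha)) fun he => ?_
      rw [← he] at hx0
      exact hx0' (hx0 b (Set.mem_insert _ _))
    refine hmin (Module.finrank ℝ (DS ℓ (insert b T))) ?_
      ⟨insert b T, Set.insert_subset hb hTS, ⟨p + y, ?_⟩, rfl⟩
    · rw [← hTn]; exact Submodule.finrank_lt_finrank_of_lt hlt
    · rintro a (rfl | ha)
      · have e : ℓ a (p + y) + τ a - (p + y) = ℓ a y - y + (ℓ a p + τ a - p) := by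
          rw [map_add]; abel
        rw [e]; exact hy'
      · have e : ℓ a (p + y) + τ a - (p + y) = (ℓ a p + τ a - p) := by
          rw [map_add, hy a ha]; abel
        rw [e]; exact hp a ha
  have hpS : p ∈ MS ℓ τ S := by
    intro b hb
    exact hfix b hb _ (MS_sub h hv hTv (MS_inv h (hTconj b hb) hp) hp)
  have htop : DS ℓ S = ⊤ := by
    refine cc_top h (DS ℓ S) (fun g x hx => DS_inv (hSi g) hx) (v := v)
      (fun a ha => ha.1 v hvF) hv p fun g => ?_
    exact MS_sub h hv (fun a ha => ha.1 v hvF) (MS_inv h (hSi g) hpS) hpS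
  refine ⟨min ε (δ / (C * C)), lt_min hε (by positivity), fun g hg => ?_⟩
  ext1 x
  have : x ∈ DS ℓ S := by rw [htop]; trivial
  exact this g (hSnear g hg)

end LZ

namespace LZ
open scoped commutatorElement
open Filter Topology

variable {m : ℕ}
variable {G : Type*} [Group G] {ℓ : G →* (Vec (m + 2) →L[ℝ] Vec (m + 2))} {τ : G → Vec (m + 2)}

lemma ker_inv {t : G} (ht : ℓ t = 1) : ℓ t⁻¹ = 1 := by
  have := inv_mul_l ℓ t
  rwa [ht, mul_one] at this

/-- the translation lattice -/
def Lat (h : IsAct ℓ τ) : AddSubgroup (Vec (m + 2)) where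
  carrier := {x | ∃ t, ℓ t = 1 ∧ τ t = x}
  add_mem' := by
    rintro _ _ ⟨t, ht, rfl⟩ ⟨s, hs, rfl⟩
    exact ⟨t * s, by rw [map_mul, ht, hs, mul_one], by rw [h.coc, ht]; rfl⟩
  zero_mem' := ⟨1, map_one _, h.tau_one⟩
  neg_mem' := by
    rintro _ ⟨t, ht, rfl⟩
    refine ⟨t⁻¹, ker_inv ht, ?_⟩
    have := h.tau_inv t
    rw [ht] at this
    exact this

/-- the span of the translations -/
def Bsp (ℓ : G →* (Vec (m + 2) →L[ℝ] Vec (m + 2))) (τ : G → Vec (m + 2)) :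
    Submodule ℝ (Vec (m + 2)) := Submodule.span ℝ {x | ∃ t, ℓ t = 1 ∧ τ t = x}

lemma tau_conj (h : IsAct ℓ τ) {t : G} (ht : ℓ t = 1) (g : G) :
    τ (g * t * g⁻¹) = ℓ g (τ t) := by
  rw [h.coc, h.coc, map_mul, ht, mul_one, h.tau_inv]; abel

lemma Bsp_inv (h : IsAct ℓ τ) (g : G) : ∀ x ∈ Bsp ℓ τ, ℓ g x ∈ Bsp ℓ τ := by
  intro x hx
  have : Bsp ℓ τ ≤ (Bsp ℓ τ).comap (ℓ g : Vec (m + 2) →ₗ[ℝ] Vec (m + 2)) := by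
    unfold Bsp
    rw [Submodule.span_le]
    rintro _ ⟨t, ht, rfl⟩
    refine Submodule.subset_span ⟨g * t * g⁻¹, ?_, tau_conj h ht g⟩
    rw [map_mul, map_mul, ht, mul_one, mul_inv_l]
  exact this hx

lemma Lat_cobdd (Λ : AddSubgroup (Vec (m + 2))) :
    ∃ C : ℝ, 0 ≤ C ∧ ∀ x ∈ Submodule.span ℝ (Λ : Set (Vec (m + 2))), ∃ l ∈ Λ, ‖x - l‖ ≤ C := by
  classical
  obtain ⟨s, hs, hs'⟩ := (Submodule.fg_span_iff_fg_span_finset_subset (R := ℝ)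
    (Λ : Set (Vec (m + 2)))).1 (IsNoetherian.noetherian _)
  rw [hs']
  clear hs'
  induction s using Finset.induction_on with
  | empty =>
    refine ⟨0, le_rfl, fun x hx => ⟨0, Λ.zero_mem, ?_⟩⟩
    have : x = 0 := by simpa using hx
    simp [this]
  | insert a s ha ih =>
    rw [Finset.coe_insert, Set.insert_subset_iff] at hs
    obtain ⟨C, hC, hC'⟩ := ih hs.2
    refine ⟨‖a‖ + C, by positivity, fun x hx => ?_⟩
    rw [Finset.coe_insert, Submodule.mem_span_insert] at hx
    obtain ⟨c, z, hz, rfl⟩ := hx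
    obtain ⟨l, hl, hl'⟩ := hC' z hz
    refine ⟨⌊c⌋ • a + l, Λ.add_mem (Λ.zsmul_mem hs.1 _) hl, ?_⟩
    have e : c • a + z - (⌊c⌋ • a + l) = Int.fract c • a + (z - l) := by
      rw [← Int.self_sub_floor, sub_smul, ← Int.cast_smul_eq_zsmul ℝ]; abel
    rw [e]
    refine (norm_add_le _ _).trans (add_le_add ?_ hl')
    rw [norm_smul, Real.norm_eq_abs, abs_of_nonneg (Int.fract_nonneg c)]
    exact mul_le_of_le_one_left (norm_nonneg _) (Int.fract_lt_one c).le

lemma Bsp_cobdd (h : IsAct ℓ τ) :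
    ∃ C : ℝ, 0 ≤ C ∧ ∀ x ∈ Bsp ℓ τ, ∃ t, ℓ t = 1 ∧ ‖x - τ t‖ ≤ C := by
  obtain ⟨C, h0, hC⟩ := Lat_cobdd (Lat h)
  refine ⟨C, h0, fun x hx => ?_⟩
  obtain ⟨_, ⟨t, ht, rfl⟩, h2⟩ := hC x hx
  exact ⟨t, ht, h2⟩

lemma trans_timelike (h : IsAct ℓ τ) {v : Vec (m + 2)} (hvB : v ∈ Bsp ℓ τ)
    (hv : lorentzQ m v < 0) : VSt G := by
  obtain ⟨P, σ, C, hC1, p1, p2, p3, pc, hσ, hσC, ppos, pp⟩ :=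
    timelike_data ℓ h.lor (Bsp ℓ τ) (Bsp_inv h) hvB hv
  obtain ⟨C1, hC10, hC1'⟩ := Bsp_cobdd h
  have hcoc : ∀ g k, P (τ (g * k)) = P (τ g) + σ g (P (τ k)) := by
    intro g k
    rw [h.coc, map_add, pc, hσ, pp, sub_self, add_zero]
  have hσker : ∀ t, ℓ t = 1 → σ t = 1 := by
    intro t ht
    ext1 x
    rw [hσ, ht]; simp
  have hPker : ∀ t, ℓ t = 1 → P (τ t) = 0 := fun t ht => p3 _ (Submodule.subset_span ⟨t, ht, rfl⟩)
  -- reduction modulo translations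
  have hred : ∀ g, ∃ t g', ℓ t = 1 ∧ g = t * g' ∧ ‖τ g'‖ ≤ C1 + ‖P (τ g)‖ := by
    intro g
    obtain ⟨t, ht, ht'⟩ := hC1' _ (p2 (τ g))
    refine ⟨t, t⁻¹ * g, ht, by group, ?_⟩
    have e1 : τ g = τ t + τ (t⁻¹ * g) := by
      conv_lhs => rw [show g = t * (t⁻¹ * g) by group, h.coc, ht]
      rfl
    have e2 : τ (t⁻¹ * g) = (τ g - P (τ g) - τ t) + P (τ g) := by
      rw [eq_sub_of_add_eq' e1.symm]; abel
    rw [e2]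
    exact (norm_add_le _ _).trans (by gcongr)
  have hfin : ∀ R : ℝ, ((fun g => (σ g, P (τ g))) '' {g | ‖P (τ g)‖ ≤ R}).Finite := by
    intro R
    refine ((h.pd0 (C1 + R)).image (fun g => (σ g, P (τ g)))).subset ?_
    rintro _ ⟨g, hg, rfl⟩
    obtain ⟨t, g', ht, e, hn⟩ := hred g
    refine ⟨g', hn.trans (by gcongr; exact hg), ?_⟩
    simp only [e]
    rw [map_mul, hσker t ht, one_mul, hcoc, hPker t ht, hσker t ht]
    simp
  have htop : (⊤ : Subgroup G).Normal := inferInstance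
  obtain ⟨A, hAn, -, hA2, hA3⟩ := abel_lemma σ hσC ⊤ (ε0 := 1 / 10) (by norm_num) (by
    intro α _ β _ h1 h2
    obtain ⟨K, hK⟩ := zass σ (fun g => P (τ g)) hcoc hfin (S := {α, β}) (by simp) (by
      rintro s (rfl | rfl) <;> assumption)
    exact ⟨K, (hK K le_rfl _ (itc_mem_cw α β K)).1⟩)
  have hAi : A.FiniteIndex := ⟨by rwa [Subgroup.relIndex_top_right] at hA2⟩
  have hone : P (τ 1) = 0 := by rw [h.tau_one, map_zero]
  have hPi : ∀ g, σ g (P (τ g⁻¹)) = - P (τ g) := by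
    intro g
    have := hcoc g g⁻¹
    rw [mul_inv_cancel, hone] at this
    exact (neg_eq_of_add_eq_zero_right this.symm).symm
  let N : Subgroup G :=
    { carrier := {g | σ g = 1 ∧ P (τ g) = 0}
      mul_mem' := by
        rintro a b ⟨h1, h2⟩ ⟨h3, h4⟩
        exact ⟨by rw [map_mul, h1, h3, one_mul], by rw [hcoc, h2, h4]; simp⟩
      one_mem' := ⟨map_one _, hone⟩
      inv_mem' := by
        rintro a ⟨h1, h2⟩
        have h3 := hPi a
        rw [h1, h2] at h3
        exact ⟨ker_inv h1, by simpa using h3⟩ }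
  have hNn : N.Normal := by
    constructor
    rintro n ⟨h1, h2⟩ g
    refine ⟨by rw [map_mul, map_mul, h1, mul_one, mul_inv_l], ?_⟩
    rw [hcoc, hcoc, h2, map_zero, add_zero, map_mul, h1, mul_one, hPi, add_neg_cancel]
  have hTN : ℓ.ker ≤ N := fun t ht => ⟨hσker t ht, hPker t ht⟩
  have hTi : ℓ.ker.relIndex N ≠ 0 := by
    have hf : Finite {g : N // ‖τ g‖ ≤ C1} := by
      have := ((h.pd0 C1).preimage (f := (Subtype.val : N → G)) Subtype.val_injective.injOn)
      exact this.to_subtype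
    have hs : Function.Surjective
        (fun g : {g : N // ‖τ g‖ ≤ C1} => (QuotientGroup.mk g.1 : N ⧸ ℓ.ker.subgroupOf N)) := by
      intro q
      obtain ⟨g, rfl⟩ := QuotientGroup.mk_surjective q
      obtain ⟨t, g', ht, e, hn⟩ := hred g
      rw [g.2.2, norm_zero, add_zero] at hn
      have hg' : g' ∈ N := by
        have : g' = t⁻¹ * g := by rw [e]; group
        rw [this]; exact N.mul_mem (N.inv_mem (hTN ht)) g.2
      refine ⟨⟨⟨g', hg'⟩, hn⟩, ?_⟩
      rw [QuotientGroup.eq, Subgroup.mem_subgroupOf]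
      change ℓ (g'⁻¹ * g) = 1
      rw [e, map_mul, map_mul, ht, one_mul, inv_mul_l]
    have hfq := Finite.of_surjective _ hs
    exact Subgroup.index_ne_zero_of_finite
  refine VSt.of_sub A hAi ?_
  refine FL_type (ℓ.ker.subgroupOf A) (N.subgroupOf A) (fun x hx => hTN hx) ?_ ?_
    (σ.ker.subgroupOf A) (fun x y => hA3 x x.2 y y.2) ?_
  · refine solv_of_comm fun x hx y hy => ?_
    rw [commutatorElement_eq_one_iff_mul_comm]
    exact Subtype.ext (h.ker_comm hx hy)
  · unfold Subgroup.subgroupOf at *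
    rw [Subgroup.relIndex_comap]
    intro h0
    exact hTi (Subgroup.relIndex_eq_zero_of_le_right (by
      rintro _ ⟨x, hx, rfl⟩; exact hx) h0)
  · rintro x hx y hy
    have hx : σ (x : G) = 1 := hx
    have hy : σ (y : G) = 1 := hy
    have h1 : σ ⁅(x : G), (y : G)⁆ = 1 := hA3 x x.2 y y.2
    refine ⟨h1, ?_⟩
    change P (τ ⁅(x : G), (y : G)⁆) = 0
    have e : ⁅(x : G), (y : G)⁆ * (y * x) = x * y := by rw [commutatorElement_def]; group
    have h2 := congrArg (fun g => P (τ g)) e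
    simp only [hcoc, h1, hx, hy, one_apply_eq_self] at h2
    have h3 : P (τ ⁅(x : G), (y : G)⁆) + (P (τ y) + P (τ x)) = 0 + (P (τ y) + P (τ x)) := by
      rw [h2]; abel
    exact add_right_cancel h3

lemma trans_null (h : IsAct ℓ τ) (hnt : ∀ x ∈ Bsp ℓ τ, 0 ≤ lorentzQ m x) {a : Vec (m + 2)}
    (haB : a ∈ Bsp ℓ τ) (ha0 : a ≠ 0) (ha : lorentzQ m a = 0) : VSt G := by
  have horth : ∀ y ∈ Bsp ℓ τ, lb m a y = 0 := by
    intro y hy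
    by_contra h0
    have h1 := hnt _ ((Bsp ℓ τ).add_mem ((Bsp ℓ τ).smul_mem (-(lorentzQ m y + 1) / (2 * lb m a y)) haB) hy)
    rw [Q_add, Q_smul, ha, map_smul, LinearMap.smul_apply, smul_eq_mul] at h1
    have : 2 * (-(lorentzQ m y + 1) / (2 * lb m a y) * lb m a y) = -(lorentzQ m y + 1) := by
      field_simp
    linarith
  have hline : ∀ g, ∃ c : ℝ, ℓ g a = c • a := fun g =>
    ⟨_, null_prop ha ha0 (by rw [h.lor g, ha]) (horth _ (Bsp_inv h g a haB))⟩
  rcases lt_or_gt_of_ne (tm_ne_zero ha.le ha0) with h1 | h1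
  · refine case_b h (a := -a) (by rw [Q_neg, ha]) (by rw [tm_neg]; linarith) fun g => ?_
    obtain ⟨c, hc⟩ := hline g
    exact ⟨c, by rw [map_neg, hc, smul_neg]⟩
  · exact case_b h ha h1 hline

end LZ

namespace LZ
open scoped commutatorElement
open Filter Topology

variable {m : ℕ}
variable {G : Type*} [Group G] {ℓ : G →* (Vec (m + 2) →L[ℝ] Vec (m + 2))} {τ : G → Vec (m + 2)}

section MR
open MeasureTheory
open scoped ENNReal

lemma lb_sep : (lb m).SeparatingLeft := by
  intro x hx
  by_contra h0
  have h1 : lb m (e0 m) x = 0 := by rw [lb_comm]; exact hx _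
  have := Q_pos_of_orth (v := e0 m) (by rw [Q_e0]; norm_num) h1 h0
  rw [← lb_self, hx] at this
  exact lt_irrefl _ this

lemma det_lor {L : Vec (m + 2) →L[ℝ] Vec (m + 2)} (hL : Lor m L) : |L.det| = 1 := by
  have e : (lb m).compl₁₂ (L : Vec (m + 2) →ₗ[ℝ] Vec (m + 2))
      (L : Vec (m + 2) →ₗ[ℝ] Vec (m + 2)) = lb m := by
    refine LinearMap.ext fun x => LinearMap.ext fun y => hL.lb x y
  have h1 := LinearMap.toMatrix₂'_compl₁₂ (R := ℝ) (lb m) (L : Vec (m + 2) →ₗ[ℝ] Vec (m + 2))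
      (L : Vec (m + 2) →ₗ[ℝ] Vec (m + 2))
  rw [e] at h1
  have h2 := congrArg Matrix.det h1
  rw [Matrix.det_mul, Matrix.det_mul, Matrix.det_transpose, LinearMap.det_toMatrix'] at h2
  have h3 : (LinearMap.toMatrix₂' ℝ (lb m)).det ≠ 0 :=
    Matrix.separatingLeft_iff_det_ne_zero.1 lb_sep.toMatrix₂'
  change |LinearMap.det (L : Vec (m + 2) →ₗ[ℝ] Vec (m + 2))| = 1
  set d := LinearMap.det (L : Vec (m + 2) →ₗ[ℝ] Vec (m + 2))
  have h4 : d ^ 2 = 1 := by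
    have : (LinearMap.toMatrix₂' ℝ (lb m)).det * (d ^ 2 - 1) = 0 := by linarith
    rcases mul_eq_zero.1 this with h | h
    · exact absurd h h3
    · linarith
  have h5 : d * d = 1 := by rw [← sq]; exact h4
  rcases mul_self_eq_one_iff.1 h5 with h | h <;> simp [h]

lemma act_inv (h : IsAct ℓ τ) (g : G) (x : Vec (m + 2)) :
    ℓ g (ℓ g⁻¹ x + τ g⁻¹) + τ g = x := by
  rw [map_add, app_inv, h.tau_inv]; abel

lemma act_mul (h : IsAct ℓ τ) (g k : G) (x : Vec (m + 2)) :
    ℓ (g * k) x + τ (g * k) = ℓ g (ℓ k x + τ k) + τ g := by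
  rw [h.coc, mul_app, map_add]; abel

lemma act_one (h : IsAct ℓ τ) (x : Vec (m + 2)) : ℓ 1 x + τ 1 = x := by
  rw [h.tau_one, map_one]; simp

lemma lint_act (h : IsAct ℓ τ) (g : G) (F : Vec (m + 2) → ℝ≥0∞) :
    ∫⁻ x, F (ℓ g x + τ g) = ∫⁻ x, F x := by
  have key := lintegral_image_eq_lintegral_abs_det_fderiv_mul (volume : Measure (Vec (m + 2)))
    (s := Set.univ) (f := fun x => ℓ g x + τ g) (f' := fun _ => ℓ g) MeasurableSet.univ
    (fun x _ => ((ℓ g).hasFDerivAt.add_const _).hasFDerivWithinAt)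
    (by
      intro x _ y _ hxy
      have : ℓ g x = ℓ g y := by simpa using hxy
      rw [← inv_app ℓ g x, this, inv_app]) F
  have hs : (fun x => ℓ g x + τ g) '' Set.univ = Set.univ := by
    rw [Set.image_univ]
    exact Set.range_eq_univ.2 fun x => ⟨_, act_inv h g x⟩
  rw [hs, det_lor (h.lor g)] at key
  simpa using key.symm

lemma countable_G (h : IsAct ℓ τ) : Countable G := by
  have : (Set.univ : Set G) = ⋃ n : ℕ, {g | ‖τ g‖ ≤ n} := by
    ext g
    simp only [Set.mem_univ, Set.mem_iUnion, Set.mem_ofPred_eq, true_iff]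
    exact exists_nat_ge _
  rw [← Set.countable_univ_iff, this]
  exact Set.countable_iUnion fun n => (h.pd0 n).countable

lemma unfold_int (h : IsAct ℓ τ) {F F' J : Vec (m + 2) → ℝ≥0∞} (hF : Measurable F)
    (hF' : Measurable F') (hJ : Measurable J) (hJi : ∀ g x, J (ℓ g x + τ g) = J x) :
    ∫⁻ x, F x * (∑' g, F' (ℓ g x + τ g)) * J x = ∫⁻ x, F' x * (∑' g, F (ℓ g x + τ g)) * J x := by
  have := countable_G h
  have hm : ∀ g : G, Measurable fun x => ℓ g x + τ g := fun g => by fun_prop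
  have e1 : ∀ F F' : Vec (m + 2) → ℝ≥0∞, Measurable F → Measurable F' →
      ∫⁻ x, F x * (∑' g, F' (ℓ g x + τ g)) * J x =
      ∑' g, ∫⁻ x, F x * F' (ℓ g x + τ g) * J x := by
    intro F F' hF hF'
    rw [← lintegral_tsum]
    · congr 1; ext x
      rw [← ENNReal.tsum_mul_left, ← ENNReal.tsum_mul_right]
    · intro g
      exact ((hF.mul (hF'.comp (hm g))).mul hJ).aemeasurable
  rw [e1 F F' hF hF', e1 F' F hF' hF, ← (Equiv.inv G).tsum_eq]
  congr 1; ext g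
  simp only [Equiv.inv_apply]
  rw [← lint_act h g]
  congr 1; ext x
  have e2 : ℓ g⁻¹ (ℓ g x + τ g) + τ g⁻¹ = x := by
    have := act_inv h g⁻¹ x
    rwa [inv_inv] at this
  rw [e2, hJi]; ring

/-- Lagrange interpolation of determinants -/
lemma det_interp {s : Finset ℝ} (hs : m + 2 < s.card) :
    ∃ c : ℝ → ℝ, (∑ i ∈ s, c i = 1) ∧ ∀ M : Vec (m + 2) →L[ℝ] Vec (m + 2),
      (1 + M).det = ∑ i ∈ s, c i * (1 + i • M).det := by
  classical
  have key : ∀ p : Polynomial ℝ, p.degree < s.card → p.eval 1 =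
      ∑ i ∈ s, (Lagrange.basis s id i).eval 1 * p.eval i := by
    intro p hp
    conv_lhs => rw [Lagrange.eq_interpolate (s := s) (v := id) (fun x _ y _ h => h) hp]
    rw [Lagrange.interpolate_apply, Polynomial.eval_finsetSum]
    refine Finset.sum_congr rfl fun i _ => ?_
    simp [mul_comm]
  refine ⟨fun i => (Lagrange.basis s id i).eval 1, ?_, fun M => ?_⟩
  · have := key 1 (by
      rw [Polynomial.degree_one]; exact_mod_cast (by omega : 0 < s.card))
    simpa using this.symm
  · let A := LinearMap.toMatrix' (M : Vec (m + 2) →ₗ[ℝ] Vec (m + 2))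
    let p : Polynomial ℝ := Matrix.det ((Polynomial.X : Polynomial ℝ) • A.map Polynomial.C
      + (1 : Matrix (Fin (m + 2)) (Fin (m + 2)) ℝ).map Polynomial.C)
    have hev : ∀ t : ℝ, p.eval t = (1 + t • M).det := by
      intro t
      have e1 : p.eval t = Matrix.det (t • A + 1) := by
        change Polynomial.evalRingHom t p = _
        simp only [p]
        rw [RingHom.map_det]
        congr 1
        ext i j
        by_cases hij : i = j
        · subst hij; simp; ring
        · simp [hij]; ring
      rw [e1]
      change _ = LinearMap.det ((1 + t • M : Vec (m + 2) →L[ℝ] Vec (m + 2)) :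
        Vec (m + 2) →ₗ[ℝ] Vec (m + 2))
      rw [← LinearMap.det_toMatrix']
      congr 1
      have : ((1 + t • M : Vec (m + 2) →L[ℝ] Vec (m + 2)) : Vec (m + 2) →ₗ[ℝ] Vec (m + 2))
        = LinearMap.id + t • (M : Vec (m + 2) →ₗ[ℝ] Vec (m + 2)) := rfl
      rw [this, map_add, map_smul, LinearMap.toMatrix'_id]
      exact add_comm _ _
    have hdeg : p.degree < s.card := by
      refine lt_of_le_of_lt Polynomial.degree_le_natDegree ?_
      have := Polynomial.natDegree_det_X_add_C_le A 1
      rw [Fintype.card_fin] at this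
      exact_mod_cast lt_of_le_of_lt this hs
    have := key p hdeg
    rw [hev, one_smul] at this
    rw [this]
    exact Finset.sum_congr rfl fun i _ => by rw [hev]

end MR
end LZ

namespace LZ
open scoped commutatorElement
open Filter Topology

variable {m : ℕ}
variable {G : Type*} [Group G] {ℓ : G →* (Vec (m + 2) →L[ℝ] Vec (m + 2))} {τ : G → Vec (m + 2)}

section MR
open MeasureTheory
open scoped ENNReal

lemma part_unity (h : IsAct ℓ τ) : ∃ φ : Vec (m + 2) → ℝ≥0∞, Measurable φ ∧ (∀ x, φ x ≤ 1) ∧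
    (∃ R : ℝ, ∀ x, R < ‖x‖ → φ x = 0) ∧ (∀ x, ∑' g, φ (ℓ g x + τ g) = 1) ∧ ∫⁻ x, φ x ≠ 0 := by
  have := countable_G h
  obtain ⟨R, hR⟩ := h.cc
  have hm : ∀ g : G, Measurable fun x => ℓ g x + τ g := fun g => by fun_prop
  let χ : Vec (m + 2) → ℝ≥0∞ := (Metric.closedBall (0 : Vec (m + 2)) R).indicator 1
  have hχm : Measurable χ := measurable_one.indicator Metric.isClosed_closedBall.measurableSet
  let S : Vec (m + 2) → ℝ≥0∞ := fun x => ∑' g, χ (ℓ g x + τ g)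
  have hSm : Measurable S := Measurable.tsum fun g => hχm.comp (hm g)
  have hSi : ∀ k x, S (ℓ k x + τ k) = S x := by
    intro k x
    simp only [S]
    rw [← (Equiv.mulRight k).tsum_eq (fun g => χ (ℓ g x + τ g))]
    congr 1; ext g
    rw [Equiv.coe_mulRight, act_mul h]
  have hχ1 : ∀ x, ‖x‖ ≤ R → χ x = 1 := by
    intro x hx
    simp [χ, hx]
  have hχ0 : ∀ x, R < ‖x‖ → χ x = 0 := by
    intro x hx
    simp [χ, hx]
  have hχle : ∀ x, χ x ≤ 1 := by
    intro x
    rcases le_or_gt ‖x‖ R with hx | hx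
    · rw [hχ1 x hx]
    · rw [hχ0 x hx]; exact zero_le_one
  have hS0 : ∀ x, S x ≠ 0 := by
    intro x h0
    obtain ⟨g, hg⟩ := hR x
    have := ENNReal.le_tsum (f := fun g => χ (ℓ g x + τ g)) g
    rw [hχ1 _ hg] at this
    change 1 ≤ S x at this
    rw [h0] at this
    exact absurd this (by simp)
  have hST : ∀ x, S x ≠ ⊤ := by
    intro x
    have hf := h.pd (max ‖x‖ R)
    have : S x = ∑ g ∈ hf.toFinset, χ (ℓ g x + τ g) := by
      refine tsum_eq_sum fun g hg => hχ0 _ ?_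
      by_contra hle
      push Not at hle
      exact hg (hf.mem_toFinset.2 ⟨x, le_max_left _ _, hle.trans (le_max_right _ _)⟩)
    rw [this]
    refine (ENNReal.sum_lt_top.2 fun g _ => ?_).ne
    exact lt_of_le_of_lt (hχle _) ENNReal.one_lt_top
  have hsum : ∀ x, ∑' g, χ (ℓ g x + τ g) / S (ℓ g x + τ g) = 1 := by
    intro x
    simp only [hSi, div_eq_mul_inv]
    rw [ENNReal.tsum_mul_right]
    exact ENNReal.mul_inv_cancel (hS0 x) (hST x)
  refine ⟨fun x => χ x / S x, hχm.div hSm, ?_, ⟨R, fun x hx => ?_⟩, hsum, ?_⟩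
  · intro x
    have := ENNReal.le_tsum (f := fun g => χ (ℓ g x + τ g) / S (ℓ g x + τ g)) 1
    rw [hsum] at this
    simpa only [act_one h] using this
  · simp [hχ0 x hx]
  · intro h0
    have h1 : ∫⁻ x : Vec (m + 2), (1 : ℝ≥0∞) = 0 := by
      calc ∫⁻ x : Vec (m + 2), (1 : ℝ≥0∞)
          = ∫⁻ x, ∑' g, χ (ℓ g x + τ g) / S (ℓ g x + τ g) := by
            congr 1; ext x; rw [hsum]
        _ = ∑' g, ∫⁻ x, χ (ℓ g x + τ g) / S (ℓ g x + τ g) :=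
            lintegral_tsum fun g => ((hχm.div hSm).comp (hm g)).aemeasurable
        _ = ∑' g : G, 0 := by
            congr 1; ext g
            rw [lint_act h g (fun x => χ x / S x), h0]
        _ = 0 := tsum_zero
    rw [lintegral_one] at h1
    have h2 := (Metric.isOpen_ball (x := (0 : Vec (m + 2))) (ε := 1)).measure_pos
      (volume : Measure (Vec (m + 2))) ⟨0, by simp⟩
    have h3 := measure_mono (μ := (volume : Measure (Vec (m + 2))))
      (Set.subset_univ (Metric.ball (0 : Vec (m + 2)) 1))
    rw [h1] at h3
    exact absurd h3 (not_le.2 h2)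

lemma small_t (h : IsAct ℓ τ) {u : Vec (m + 2) → Vec (m + 2)} (hu : ContDiff ℝ 1 u)
    (hue : ∀ g x, u (ℓ g x + τ g) = ℓ g (u x)) (R₀ : ℝ) :
    ∃ t₀ : ℝ, 0 < t₀ ∧ ∀ t : ℝ, 0 < t → t < t₀ → Function.Injective (fun x => x + t • u x) ∧
      Function.Surjective (fun x => x + t • u x) ∧
      ∀ x, ‖x‖ ≤ R₀ → 0 < (1 + t • fderiv ℝ u x).det := by
  obtain ⟨R', hR'⟩ := h.cc
  obtain ⟨R, hRp, hR⟩ : ∃ R : ℝ, 0 ≤ R ∧ ∀ x, ∃ g, ‖ℓ g x + τ g‖ ≤ R :=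
    ⟨max R' 0, le_max_right _ _, fun x => (hR' x).imp fun g hg => hg.trans (le_max_left _ _)⟩
  have hcu : Continuous u := hu.continuous
  have hcf : Continuous (fderiv ℝ u) := hu.continuous_fderiv one_ne_zero
  have hdu : Differentiable ℝ u := hu.differentiable one_ne_zero
  have bd : ∀ {E : Type} [NormedAddCommGroup E] (f : Vec (m + 2) → E), Continuous f → ∀ r : ℝ,
      ∃ C, 0 ≤ C ∧ ∀ x, ‖x‖ ≤ r → ‖f x‖ ≤ C := by
    intro E _ f hf r
    obtain ⟨C, hC⟩ := (isCompact_closedBall (0 : Vec (m + 2)) r).exists_bound_of_continuousOn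
      hf.continuousOn
    exact ⟨max C 0, le_max_right _ _, fun x hx => (hC x (by simpa using hx)).trans
      (le_max_left _ _)⟩
  obtain ⟨B, hB0, hB⟩ := bd u hcu (R + 1)
  obtain ⟨D, hD0, hD⟩ := bd _ hcf R₀
  have hfin := h.pd (R + 1 + B)
  obtain ⟨R₂, hR2, hR2'⟩ : ∃ R₂, R + 1 ≤ R₂ ∧ ∀ g ∈ hfin.toFinset,
      ‖ℓ g⁻¹‖ * R + ‖τ g⁻¹‖ ≤ R₂ := by
    refine ⟨R + 1 + ∑ g ∈ hfin.toFinset, (‖ℓ g⁻¹‖ * R + ‖τ g⁻¹‖), ?_, fun g hg => ?_⟩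
    · have : 0 ≤ ∑ g ∈ hfin.toFinset, (‖ℓ g⁻¹‖ * R + ‖τ g⁻¹‖) :=
        Finset.sum_nonneg fun g _ => by positivity
      linarith
    · have := Finset.single_le_sum (f := fun g => ‖ℓ g⁻¹‖ * R + ‖τ g⁻¹‖)
        (fun g _ => by positivity) hg
      linarith
  obtain ⟨L, hL0, hL'⟩ := bd _ hcf R₂
  have hL : ∀ x y, ‖x‖ ≤ R₂ → ‖y‖ ≤ R₂ → ‖u x - u y‖ ≤ L * ‖x - y‖ := by
    intro x y hx hy
    exact (convex_closedBall (0 : Vec (m + 2)) R₂).norm_image_sub_le_of_norm_fderiv_le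
      (fun z _ => hdu z) (fun z hz => hL' z (by simpa using hz)) (by simpa using hy)
      (by simpa using hx)
  have hopen : IsOpen {A : Vec (m + 2) →L[ℝ] Vec (m + 2) | 0 < A.det} :=
    isOpen_lt continuous_const ContinuousLinearMap.continuous_det
  obtain ⟨δ, hδ, hδ'⟩ := Metric.isOpen_iff.1 hopen 1 (by
    change 0 < ContinuousLinearMap.det (1 : Vec (m + 2) →L[ℝ] Vec (m + 2))
    have : ContinuousLinearMap.det (1 : Vec (m + 2) →L[ℝ] Vec (m + 2)) = 1 := LinearMap.det_id
    rw [this]; norm_num)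
  have hpos : ∀ a : ℝ, 0 ≤ a → 0 < 1 / (a + 1) := fun a ha => by positivity
  have hlt : ∀ a t : ℝ, 0 ≤ a → 0 < t → t < 1 / (a + 1) → t * a < 1 := by
    intro a t ha ht h1
    rw [lt_div_iff₀ (by positivity)] at h1
    nlinarith
  refine ⟨min (min 1 (1 / (B + 1))) (min (1 / (L + 1)) (δ / (D + 1))), ?_, ?_⟩
  · exact lt_min (lt_min one_pos (hpos B hB0)) (lt_min (hpos L hL0) (by positivity))
  intro t ht htt
  have ht1 : t < 1 := htt.trans_le ((min_le_left _ _).trans (min_le_left _ _))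
  have htB : t * B < 1 := hlt B t hB0 ht (htt.trans_le ((min_le_left _ _).trans (min_le_right _ _)))
  have htL : t * L < 1 := hlt L t hL0 ht (htt.trans_le ((min_le_right _ _).trans (min_le_left _ _)))
  have htD : t * D < δ := by
    have := htt.trans_le ((min_le_right _ _).trans (min_le_right _ _))
    rw [lt_div_iff₀ (by positivity)] at this
    nlinarith
  have heqv : ∀ g x, (ℓ g x + τ g) + t • u (ℓ g x + τ g) = ℓ g (x + t • u x) + τ g := by
    intro g x
    rw [hue, map_add, map_smul]; abel
  have hinj0 : ∀ g x y, ℓ g x + τ g = ℓ g y + τ g → x = y := by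
    intro g x y hxy
    have : ℓ g x = ℓ g y := by simpa using hxy
    rw [← inv_app ℓ g x, this, inv_app]
  have hnt : ∀ x, ‖t • u x‖ = t * ‖u x‖ := fun x => by
    rw [norm_smul, Real.norm_of_nonneg ht.le]
  have hsmall : ∀ x, ‖x‖ ≤ R + 1 → ‖x + t • u x‖ ≤ R + 1 + B := by
    intro x hx
    have h1 := norm_add_le x (t • u x)
    rw [hnt] at h1
    have := hB x hx
    nlinarith
  refine ⟨?_, ?_, ?_⟩
  · have key : ∀ x y, ‖x‖ ≤ R → x + t • u x = y + t • u y → x = y := by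
      intro x y hx hxy
      obtain ⟨g, hg⟩ := hR y
      have hg1 : g ∈ hfin.toFinset := by
        refine hfin.mem_toFinset.2 ⟨x + t • u x, hsmall x (by linarith), ?_⟩
        rw [hxy, ← heqv]
        exact hsmall _ (by linarith)
      have hy : ‖y‖ ≤ R₂ := by
        have e : y = ℓ g⁻¹ (ℓ g y + τ g) + τ g⁻¹ := by
          have := act_inv h g⁻¹ y
          rw [inv_inv] at this; exact this.symm
        rw [e]
        refine (norm_add_le _ _).trans (le_trans ?_ (hR2' g hg1))
        gcongr
        exact (ContinuousLinearMap.le_opNorm _ _).trans (by gcongr)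
      have h1 := hL x y (by linarith) hy
      have h2 : x - y = -(t • (u x - u y)) := by
        rw [smul_sub]
        have : x = y + t • u y - t • u x := by rw [← hxy]; abel
        nth_rewrite 1 [this]; abel
      have h3 : ‖x - y‖ ≤ t * L * ‖x - y‖ := by
        conv_lhs => rw [h2, norm_neg, norm_smul, Real.norm_of_nonneg ht.le]
        nlinarith
      have h4 : ‖x - y‖ = 0 := by
        by_contra hne
        have := lt_of_le_of_ne (norm_nonneg (x - y)) (Ne.symm hne)
        nlinarith
      exact sub_eq_zero.1 (norm_eq_zero.1 h4)
    intro x y hxy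
    simp only at hxy
    obtain ⟨g, hg⟩ := hR x
    refine hinj0 g x y (key _ _ hg ?_)
    rw [heqv, heqv, hxy]
  · intro z
    obtain ⟨g, hg⟩ := hR z
    have hmaps : Set.MapsTo (fun x => (ℓ g z + τ g) - t • u x)
        (Metric.closedBall 0 (R + 1)) (Metric.closedBall 0 (R + 1)) := by
      intro x hx
      have hx' : ‖x‖ ≤ R + 1 := by simpa using hx
      have h1 := norm_sub_le (ℓ g z + τ g) (t • u x)
      rw [hnt] at h1
      have := hB x hx'
      rw [mem_closedBall_zero_iff]
      nlinarith
    have hcon : ContractingWith ⟨t * L, by positivity⟩ (hmaps.restrict _ _ _) := by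
      refine ⟨by exact_mod_cast htL, LipschitzWith.of_dist_le_mul fun x y => ?_⟩
      have hx : ‖(x : Vec (m + 2))‖ ≤ R + 1 := mem_closedBall_zero_iff.1 x.2
      have hy : ‖(y : Vec (m + 2))‖ ≤ R + 1 := mem_closedBall_zero_iff.1 y.2
      have h1 := hL x y (hx.trans hR2) (hy.trans hR2)
      rw [Subtype.dist_eq, Subtype.dist_eq, dist_eq_norm, dist_eq_norm]
      change ‖(ℓ g z + τ g - t • u x) - (ℓ g z + τ g - t • u y)‖ ≤ t * L * ‖(x : Vec (m + 2)) - y‖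
      have e : (ℓ g z + τ g - t • u x) - (ℓ g z + τ g - t • u y) = -(t • (u x - u y)) := by
        rw [smul_sub]; abel
      rw [e, norm_neg, norm_smul, Real.norm_of_nonneg ht.le]
      nlinarith
    obtain ⟨y, hy, hfix, -⟩ := hcon.exists_fixedPoint' Metric.isClosed_closedBall.isComplete
      hmaps (x := 0) (by simp; linarith) (edist_ne_top _ _)
    have hfy : y + t • u y = ℓ g z + τ g := by
      have : (ℓ g z + τ g) - t • u y = y := hfix
      nth_rewrite 1 [← this]; abel
    refine ⟨ℓ g⁻¹ y + τ g⁻¹, ?_⟩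
    simp only
    rw [heqv, hfy]
    have := act_inv h g⁻¹ z
    rwa [inv_inv] at this
  · intro x hx
    refine hδ' ?_
    rw [Metric.mem_ball, dist_eq_norm, add_sub_cancel_left, norm_smul, Real.norm_of_nonneg ht.le]
    have := hD x hx
    nlinarith

lemma det_comp' (A B : Vec (m + 2) →L[ℝ] Vec (m + 2)) : (A.comp B).det = A.det * B.det :=
  LinearMap.det_comp _ _

theorem MR (h : IsAct ℓ τ) {hh : Vec (m + 2) → Vec (m + 2)} (hC : ContDiff ℝ 1 hh)
    (heq : ∀ g x, hh (ℓ g x + τ g) = ℓ g (hh x) + τ g) : ∃ x, (fderiv ℝ hh x).det ≠ 0 := by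
  by_contra hcon
  push Not at hcon
  obtain ⟨φ, hφm, hφ1, ⟨R, hφR⟩, hφs, hφ0⟩ := part_unity h
  let u : Vec (m + 2) → Vec (m + 2) := fun x => hh x - x
  have hu : ContDiff ℝ 1 u := hC.sub contDiff_id
  have hue : ∀ g x, u (ℓ g x + τ g) = ℓ g (u x) := by
    intro g x
    simp only [u]
    rw [heq, map_sub]; abel
  have hdu : Differentiable ℝ u := hu.differentiable one_ne_zero
  have hcf : Continuous (fderiv ℝ u) := hu.continuous_fderiv one_ne_zero
  obtain ⟨t₀, ht₀, hst⟩ := small_t h hu hue R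
  have hφT : ∫⁻ x, φ x ≠ ⊤ := by
    have h1 : ∫⁻ x, φ x ≤ ∫⁻ x, (Metric.closedBall (0 : Vec (m + 2)) R).indicator 1 x := by
      refine lintegral_mono fun x => ?_
      rcases le_or_gt ‖x‖ R with hx | hx
      · rw [Set.indicator_of_mem (mem_closedBall_zero_iff.2 hx)]; exact hφ1 x
      · rw [hφR x hx]; exact zero_le
    rw [lintegral_indicator_one Metric.isClosed_closedBall.measurableSet] at h1
    exact (lt_of_le_of_lt h1 (isCompact_closedBall _ _).measure_lt_top).ne
  have key : ∀ t : ℝ, 0 < t → t < t₀ →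
      ∫⁻ x, φ x * ENNReal.ofReal |(1 + t • fderiv ℝ u x).det| = ∫⁻ x, φ x := by
    intro t ht htt
    obtain ⟨hi, hs, -⟩ := hst t ht htt
    let f : Vec (m + 2) → Vec (m + 2) := fun x => x + t • u x
    have hfc : Continuous f := continuous_id.add (hu.continuous.const_smul t)
    have hfd : ∀ x, HasFDerivAt f (1 + t • fderiv ℝ u x) x := fun x =>
      (hasFDerivAt_id x).add ((hdu x).hasFDerivAt.const_smul t)
    have hfe : ∀ g x, f (ℓ g x + τ g) = ℓ g (f x) + τ g := by
      intro g x
      simp only [f]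
      rw [hue, map_add, map_smul]; abel
    let J : Vec (m + 2) → ℝ≥0∞ := fun x => ENNReal.ofReal |(1 + t • fderiv ℝ u x).det|
    have hJm : Measurable J := by
      have : Continuous fun x => |(1 + t • fderiv ℝ u x).det| :=
        (ContinuousLinearMap.continuous_det.comp (continuous_const.add (hcf.const_smul t))).abs
      exact ENNReal.measurable_ofReal.comp this.measurable
    have hJi : ∀ g x, J (ℓ g x + τ g) = J x := by
      intro g x
      have h1 : HasFDerivAt (fun x => f (ℓ g x + τ g))
          ((1 + t • fderiv ℝ u (ℓ g x + τ g)).comp (ℓ g)) x :=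
        HasFDerivAt.comp (g := f) (f := fun x => ℓ g x + τ g) x (hfd (ℓ g x + τ g))
          ((ℓ g).hasFDerivAt.add_const _)
      have h2 : HasFDerivAt (fun x => f (ℓ g x + τ g))
          ((ℓ g).comp (1 + t • fderiv ℝ u x)) x := by
        simp only [hfe]
        exact ((ℓ g).hasFDerivAt.comp x (hfd x)).add_const _
      have h3 := congrArg (fun A => |ContinuousLinearMap.det A|) (h1.unique h2)
      simp only [det_comp', abs_mul, det_lor (h.lor g), mul_one, one_mul] at h3
      simp only [J, h3]
    have h1 := unfold_int h hφm (hφm.comp hfc.measurable) hJm hJi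
    have h2 : ∀ x, ∑' g, (φ ∘ f) (ℓ g x + τ g) = 1 := by
      intro x
      simp only [Function.comp, hfe, hφs]
    simp only [h2, hφs, mul_one] at h1
    have h3 := lintegral_image_eq_lintegral_abs_det_fderiv_mul (volume : Measure (Vec (m + 2)))
      (s := Set.univ) (f := f) (f' := fun x => 1 + t • fderiv ℝ u x) MeasurableSet.univ
      (fun x _ => (hfd x).hasFDerivWithinAt) hi.injOn φ
    rw [Set.image_univ, hs.range_eq, Measure.restrict_univ] at h3
    rw [h3]
    refine h1.trans ?_
    congr 1; ext x
    rw [mul_comm]; rfl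
  let ψ : Vec (m + 2) → ℝ := fun x => (φ x).toReal
  have hψm : Measurable ψ := hφm.ennreal_toReal
  have hψ0 : ∀ x, 0 ≤ ψ x := fun x => ENNReal.toReal_nonneg
  have hψφ : ∀ x, ENNReal.ofReal (ψ x) = φ x := fun x =>
    ENNReal.ofReal_toReal (ne_top_of_le_ne_top ENNReal.one_ne_top (hφ1 x))
  have key2 : ∀ t : ℝ, 0 < t → t < t₀ →
      Integrable (fun x => ψ x * (1 + t • fderiv ℝ u x).det) ∧
      ∫ x, ψ x * (1 + t • fderiv ℝ u x).det = (∫⁻ x, φ x).toReal := by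
    intro t ht htt
    have hnn : ∀ x, 0 ≤ ψ x * (1 + t • fderiv ℝ u x).det := by
      intro x
      rcases le_or_gt ‖x‖ R with hx | hx
      · exact mul_nonneg (hψ0 x) ((hst t ht htt).2.2 x hx).le
      · have : ψ x = 0 := by simp [ψ, hφR x hx]
        rw [this, zero_mul]
    have hco : ∀ x, ENNReal.ofReal (ψ x * (1 + t • fderiv ℝ u x).det) =
        φ x * ENNReal.ofReal |(1 + t • fderiv ℝ u x).det| := by
      intro x
      rw [← hψφ, ← ENNReal.ofReal_mul (hψ0 x)]
      congr 1
      rw [← abs_of_nonneg (hnn x), abs_mul, abs_of_nonneg (hψ0 x)]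
    have hmeas : Measurable (fun x => ψ x * (1 + t • fderiv ℝ u x).det) :=
      hψm.mul (ContinuousLinearMap.continuous_det.comp
        (continuous_const.add (hcf.const_smul t))).measurable
    have hlin : ∫⁻ x, ENNReal.ofReal (ψ x * (1 + t • fderiv ℝ u x).det) = ∫⁻ x, φ x := by
      rw [← key t ht htt]
      simp only [hco]
    refine ⟨?_, ?_⟩
    · refine (lintegral_ofReal_ne_top_iff_integrable hmeas.aestronglyMeasurable
        (Eventually.of_forall hnn)).1 ?_
      rw [hlin]; exact hφT
    · rw [integral_eq_lintegral_of_nonneg_ae (Eventually.of_forall hnn)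
        hmeas.aestronglyMeasurable, hlin]
  obtain ⟨s, hsub, hcard⟩ := (Set.Ioo_infinite ht₀).exists_subset_card_eq (m + 3)
  obtain ⟨c, hc1, hc2⟩ := det_interp (m := m) (s := s) (by omega)
  have hz : ∀ x, ∑ i ∈ s, c i * (ψ x * (1 + i • fderiv ℝ u x).det) = 0 := by
    intro x
    have h1 : 1 + fderiv ℝ u x = fderiv ℝ hh x := by
      have : fderiv ℝ u x = fderiv ℝ hh x - 1 := by
        have h2 := ((hC.differentiable one_ne_zero x).hasFDerivAt.sub (hasFDerivAt_id x)).fderiv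
        exact h2
      rw [this]; abel
    have h2 := hc2 (fderiv ℝ u x)
    rw [h1, hcon] at h2
    calc _ = ψ x * ∑ i ∈ s, c i * (1 + i • fderiv ℝ u x).det := by
          rw [Finset.mul_sum]
          exact Finset.sum_congr rfl fun i _ => by ring
      _ = 0 := by rw [← h2, mul_zero]
  have hfin : ∫ x, ∑ i ∈ s, c i * (ψ x * (1 + i • fderiv ℝ u x).det) =
      (∫⁻ x, φ x).toReal := by
    rw [integral_finsetSum]
    · have : ∀ i ∈ s, ∫ x, c i * (ψ x * (1 + i • fderiv ℝ u x).det) =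
          c i * (∫⁻ x, φ x).toReal := by
        intro i hi
        have := hsub hi
        rw [integral_const_mul, (key2 i this.1 this.2).2]
      rw [Finset.sum_congr rfl this, ← Finset.sum_mul, hc1, one_mul]
    · intro i hi
      have := hsub hi
      exact (key2 i this.1 this.2).1.const_mul _
  simp only [hz, integral_zero] at hfin
  have := (ENNReal.toReal_eq_zero_iff _).1 hfin.symm
  tauto

end MR
end LZ

namespace LZ
open scoped commutatorElement
open Filter Topology

variable {m : ℕ}
variable {G : Type*} [Group G] {ℓ : G →* (Vec (m + 2) →L[ℝ] Vec (m + 2))} {τ : G → Vec (m + 2)}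

lemma fs_contDiffAt {A E : Type*} [NormedAddCommGroup E] [NormedSpace ℝ E]
    {f : A → Vec (m + 2) → E} {x : Vec (m + 2)} {F : Set A} (hF : F.Finite)
    (hV : ∀ᶠ y in 𝓝 x, ∀ a, f a y ≠ 0 → a ∈ F) (hf : ∀ a, ContDiffAt ℝ 1 (f a) x) :
    ContDiffAt ℝ 1 (fun y => ∑ᶠ a, f a y) x := by
  have h1 : ContDiffAt ℝ 1 (fun y => ∑ a ∈ hF.toFinset, f a y) x :=
    ContDiffAt.sum fun a _ => hf a
  refine h1.congr_of_eventuallyEq ?_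
  filter_upwards [hV] with y hy
  refine finsum_eq_sum_of_support_subset _ fun a ha => ?_
  simpa using hy a ha

lemma isOpen_U : IsOpen {y : Vec (m + 2) | lorentzQ m y < 0 ∧ 0 < tm y} :=
  (isOpen_lt continuous_Q continuous_const).inter (isOpen_lt continuous_const continuous_tm)

lemma norm_le_tm {z : Vec (m + 2)} (hz : lorentzQ m z ≤ 0) (ht : 0 ≤ tm z) : ‖z‖ ≤ tm z := by
  rw [pi_norm_le_iff_of_nonneg ht]
  intro i
  rw [Real.norm_eq_abs]
  refine abs_le_of_sq_le_sq ?_ ht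
  unfold lorentzQ at hz
  change z i ^ 2 ≤ z (Fin.last (m + 1)) ^ 2
  refine Fin.lastCases le_rfl (fun j => ?_) i
  have := Finset.single_le_sum (f := fun i : Fin (m + 1) => z i.castSucc ^ 2)
    (fun i _ => sq_nonneg _) (Finset.mem_univ j)
  linarith

lemma norm_le_tm_e0 : ∃ C : ℝ, 0 < C ∧ ∀ L : Vec (m + 2) →L[ℝ] Vec (m + 2), Lor m L → TP L →
    ‖L‖ ≤ C * tm (L (e0 m)) := by
  obtain ⟨δ, hδ, hδ'⟩ := Metric.isOpen_iff.1 (isOpen_U (m := m)) (e0 m)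
    ⟨by rw [Q_e0]; norm_num, by rw [tm_e0]; norm_num⟩
  refine ⟨2 / δ, by positivity, fun L hL hT => ?_⟩
  have h0 : 0 < tm (L (e0 m)) := hT _ (by rw [Q_e0]; norm_num) (by rw [tm_e0]; norm_num)
  have key : ∀ x, ‖x‖ < δ → ‖L x‖ ≤ tm (L (e0 m)) := by
    intro x hx
    have h1 : e0 m + x ∈ Metric.ball (e0 m) δ := by simpa using hx
    have h2 : e0 m - x ∈ Metric.ball (e0 m) δ := by
      rw [Metric.mem_ball, dist_eq_norm]; simpa using hx
    have h1 := hδ' h1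
    have h2 := hδ' h2
    have t1 := hT _ h1.1.le h1.2
    have t2 := hT _ h2.1.le h2.2
    have n1 := norm_le_tm (by rw [hL]; exact h1.1.le) t1.le
    have n2 := norm_le_tm (by rw [hL]; exact h2.1.le) t2.le
    have e : (2 : ℝ) • L x = L (e0 m + x) - L (e0 m - x) := by
      rw [map_add, map_sub, two_smul]; abel
    have e2 : tm (L (e0 m + x)) + tm (L (e0 m - x)) = 2 * tm (L (e0 m)) := by
      rw [map_add, map_sub, tm_add, tm_sub]; ring
    have n3 := norm_sub_le (L (e0 m + x)) (L (e0 m - x))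
    rw [← e, norm_smul, Real.norm_of_nonneg (by norm_num : (0 : ℝ) ≤ 2)] at n3
    linarith
  refine ContinuousLinearMap.opNorm_le_bound _ (by positivity) fun x => ?_
  by_cases hx : x = 0
  · simp [hx]
  have hxn : 0 < ‖x‖ := norm_pos_iff.2 hx
  have h1 := key ((δ / (2 * ‖x‖)) • x) (by
    rw [norm_smul, Real.norm_of_nonneg (by positivity)]
    field_simp; norm_num)
  rw [map_smul, norm_smul, Real.norm_of_nonneg (by positivity)] at h1
  rw [div_mul_eq_mul_div, div_le_iff₀ (by positivity)] at h1
  rw [div_mul_eq_mul_div, div_mul_eq_mul_div, le_div_iff₀ hδ]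
  nlinarith

lemma tm_eq_lb (x : Vec (m + 2)) : lb m (e0 m) x = - tm x := by
  rw [lb_e0]

section Hc
variable {A : Type*} [Group A] {k : A →* (Vec (m + 2) →L[ℝ] Vec (m + 2))}

lemma tm_inv (hl : ∀ a, Lor m (k a)) (a : A) : tm (k a⁻¹ (e0 m)) = tm (k a (e0 m)) := by
  have h1 := (hl a).lb (k a⁻¹ (e0 m)) (e0 m)
  rw [app_inv, tm_eq_lb, lb_comm, tm_eq_lb] at h1
  linarith

lemma disc_fin (hl : ∀ a, Lor m (k a)) (htp : ∀ a, TP (k a)) (hinj : ∀ a, k a = 1 → a = 1)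
    (hdisc : ∃ ε > 0, ∀ a, ‖k a - 1‖ < ε → k a = 1) (B : ℝ) :
    {a | tm (k a (e0 m)) ≤ B}.Finite := by
  obtain ⟨ε, hε, hd⟩ := hdisc
  obtain ⟨C, hC, hCb⟩ := norm_le_tm_e0 (m := m)
  by_contra hinf
  have hnb : ∀ a ∈ {a | tm (k a (e0 m)) ≤ B}, ‖k a‖ ≤ C * |B| := by
    intro a ha
    refine (hCb _ (hl a) (htp a)).trans ?_
    have : tm (k a (e0 m)) ≤ |B| := le_trans ha (le_abs_self B)
    gcongr
  have hc := (isCompact_closedBall (0 : Vec (m + 2) →L[ℝ] Vec (m + 2)) (C * |B|)).totallyBounded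
  have hη : 0 < ε / (2 * (C * |B| + 1)) := by positivity
  obtain ⟨t, htf, ht⟩ := Metric.totallyBounded_iff.1 hc _ hη
  have hex : ∀ a : A, ∃ y, a ∈ {a | tm (k a (e0 m)) ≤ B} → y ∈ t ∧
      dist (k a) y < ε / (2 * (C * |B| + 1)) := by
    intro a
    by_cases ha : a ∈ {a | tm (k a (e0 m)) ≤ B}
    · have := ht (mem_closedBall_zero_iff.2 (hnb a ha))
      simp only [Set.mem_iUnion, Metric.mem_ball] at this
      obtain ⟨y, hy, hy'⟩ := this
      exact ⟨y, fun _ => ⟨hy, hy'⟩⟩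
    · exact ⟨0, fun h => absurd h ha⟩
  choose p hp using hex
  obtain ⟨a, ha, b, hb, hab, hpab⟩ := Set.Infinite.exists_ne_map_eq_of_mapsTo (f := p) hinf
    (fun a ha => (hp a ha).1) htf
  refine hab ?_
  have d1 := (hp a ha).2
  have d2 := (hp b hb).2
  rw [← hpab] at d2
  have d3 : ‖k b - k a‖ < ε / (C * |B| + 1) := by
    rw [← dist_eq_norm]
    have := dist_triangle_right (k b) (k a) (p a)
    have e : ε / (C * |B| + 1) = ε / (2 * (C * |B| + 1)) + ε / (2 * (C * |B| + 1)) := by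
      field_simp; norm_num
    linarith
  have hia : ‖k a⁻¹‖ ≤ C * |B| := hnb a⁻¹ (by
    change tm (k a⁻¹ (e0 m)) ≤ B
    rw [tm_inv hl]; exact ha)
  have e2 : k (a⁻¹ * b) - 1 = k a⁻¹ * (k b - k a) := by
    rw [mul_sub, ← map_mul, ← map_mul, inv_mul_cancel, map_one]
  have h3 : ‖k (a⁻¹ * b) - 1‖ < ε := by
    rw [e2]
    refine lt_of_le_of_lt (norm_mul_le _ _) ?_
    rw [lt_div_iff₀ (by positivity)] at d3
    nlinarith [norm_nonneg (k b - k a)]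
  have h4 := hinj _ (hd _ h3)
  exact (inv_mul_eq_one.1 h4)

/-- local finiteness on the future cone -/
lemma loc_fin (hl : ∀ a, Lor m (k a)) (htp : ∀ a, TP (k a)) (hinj : ∀ a, k a = 1 → a = 1)
    (hdisc : ∃ ε > 0, ∀ a, ‖k a - 1‖ < ε → k a = 1) (R : ℝ) {y₀ : Vec (m + 2)}
    (hQ : lorentzQ m y₀ < 0) (ht : 0 < tm y₀) :
    ∃ F : Set A, F.Finite ∧ ∀ᶠ y in 𝓝 y₀, ∀ a, tm (k a⁻¹ y) ^ 2 < R * (-lorentzQ m y) →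
      a ∈ F := by
  have h1 : ∀ᶠ c : ℝ in 𝓝 0, y₀ - c • e0 m ∈ {y : Vec (m + 2) | lorentzQ m y < 0 ∧ 0 < tm y} := by
    have : Continuous fun c : ℝ => y₀ - c • e0 m := by fun_prop
    refine this.continuousAt.eventually_mem (isOpen_U.mem_nhds ?_)
    simpa using ⟨hQ, ht⟩
  obtain ⟨c, hc, hc0⟩ : ∃ c : ℝ, y₀ - c • e0 m ∈ {y : Vec (m + 2) | lorentzQ m y < 0 ∧ 0 < tm y}
      ∧ 0 < c := by
    have := (h1.filter_mono nhdsWithin_le_nhds : ∀ᶠ c : ℝ in 𝓝[>] 0, _)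
    exact (this.and self_mem_nhdsWithin).exists
  let B := |R| * (-lorentzQ m y₀ + 1) + 1
  refine ⟨{a | tm (k a (e0 m)) ≤ B / c}, disc_fin hl htp hinj hdisc _, ?_⟩
  have e1 : ∀ᶠ y in 𝓝 y₀, y - c • e0 m ∈ {y : Vec (m + 2) | lorentzQ m y < 0 ∧ 0 < tm y} := by
    have : Continuous fun y : Vec (m + 2) => y - c • e0 m := by fun_prop
    exact this.continuousAt.eventually_mem (isOpen_U.mem_nhds hc)
  have e2 : ∀ᶠ y in 𝓝 y₀, -lorentzQ m y < -lorentzQ m y₀ + 1 :=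
    (continuous_Q.neg.tendsto y₀).eventually_lt_const (by
      change -lorentzQ m y₀ < _
      linarith)
  have e3 : ∀ᶠ y in 𝓝 y₀, lorentzQ m y < 0 := (continuous_Q.tendsto y₀).eventually_lt_const hQ
  filter_upwards [e1, e2, e3] with y h1 h2 h3 a ha
  have h4 := htp a⁻¹ _ h1.1.le h1.2
  rw [map_sub, map_smul, tm_sub, tm_smul, tm_inv hl] at h4
  change tm (k a (e0 m)) ≤ B / c
  rw [le_div_iff₀ hc0]
  have h5 : tm (k a⁻¹ y) ^ 2 < |R| * (-lorentzQ m y₀ + 1) := by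
    refine lt_of_lt_of_le ha ?_
    have : R * (-lorentzQ m y) ≤ |R| * (-lorentzQ m y) :=
      mul_le_mul_of_nonneg_right (le_abs_self R) (by linarith)
    refine this.trans ?_
    gcongr
  have h6 : tm (k a⁻¹ y) ≤ B := by
    simp only [B]
    nlinarith [sq_nonneg (tm (k a⁻¹ y) - 1), sq_nonneg (tm (k a⁻¹ y))]
  linarith

lemma contDiff_Q : ContDiff ℝ 1 (lorentzQ m) := by
  unfold lorentzQ
  fun_prop

lemma contDiff_tm : ContDiff ℝ 1 (tm : Vec (m + 2) → ℝ) := by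
  unfold tm
  fun_prop

/-- the weights -/
def wt (k : A →* (Vec (m + 2) →L[ℝ] Vec (m + 2))) (R : ℝ) (a : A) (y : Vec (m + 2)) : ℝ :=
  Real.smoothTransition (R - tm (k a⁻¹ y) ^ 2 / (-lorentzQ m y))

lemma wt_ne (R : ℝ) (a : A) {y : Vec (m + 2)} (hy : lorentzQ m y < 0) (h : wt k R a y ≠ 0) :
    tm (k a⁻¹ y) ^ 2 < R * (-lorentzQ m y) := by
  by_contra hle
  push Not at hle
  refine h (Real.smoothTransition.zero_of_nonpos ?_)
  rw [← le_div_iff₀ (by linarith)] at hle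
  linarith

lemma wt_pos (R : ℝ) (a : A) {y : Vec (m + 2)} (hy : lorentzQ m y < 0)
    (h : tm (k a⁻¹ y) ^ 2 < R * (-lorentzQ m y)) : 0 < wt k R a y := by
  refine Real.smoothTransition.pos_of_pos ?_
  rw [← div_lt_iff₀ (by linarith)] at h
  linarith

lemma wt_smul (R : ℝ) (a : A) (y : Vec (m + 2)) {s : ℝ} (hs : 0 < s) :
    wt k R a (s • y) = wt k R a y := by
  unfold wt
  rw [map_smul, tm_smul, Q_smul, mul_pow, ← mul_neg, mul_div_mul_left _ _ (by positivity)]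

lemma wt_equiv (hl : ∀ a, Lor m (k a)) (R : ℝ) (a b : A) (y : Vec (m + 2)) :
    wt k R (b * a) (k b y) = wt k R a y := by
  unfold wt
  rw [hl b, mul_inv_rev, mul_app, inv_app]

lemma wt_contDiffAt (R : ℝ) (a : A) {y : Vec (m + 2)} (hy : lorentzQ m y < 0) :
    ContDiffAt ℝ 1 (wt k R a) y := by
  unfold wt
  refine Real.smoothTransition.contDiffAt.comp y ?_
  refine contDiffAt_const.sub (ContDiffAt.div ?_ contDiff_Q.contDiffAt.neg (by linarith))
  exact ((contDiff_tm.comp (k a⁻¹).contDiff).pow 2).contDiffAt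

/-- domain on which `H` is defined -/
def UR (k : A →* (Vec (m + 2) →L[ℝ] Vec (m + 2))) (R : ℝ) : Set (Vec (m + 2)) :=
  {y | lorentzQ m y < 0 ∧ 0 < tm y ∧ ∃ a, tm (k a⁻¹ y) ^ 2 < R * (-lorentzQ m y)}

theorem H_construct (hl : ∀ a, Lor m (k a)) (htp : ∀ a, TP (k a)) (hinj : ∀ a, k a = 1 → a = 1)
    (hdisc : ∃ ε > 0, ∀ a, ‖k a - 1‖ < ε → k a = 1) {c : A → Vec (m + 2)}
    (hc : ∀ a b, c (a * b) = c a + k a (c b)) (R : ℝ) :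
    ∃ H : Vec (m + 2) → Vec (m + 2), (∀ y ∈ UR k R, ContDiffAt ℝ 1 H y) ∧
      (∀ a, ∀ y ∈ UR k R, H (k a y) = c a + k a (H y)) ∧
      (∀ y, ∀ s : ℝ, 0 < s → H (s • y) = H y) := by
  have hfin : ∀ y ∈ UR k R, ({a | wt k R a y ≠ 0} : Set A).Finite := by
    intro y hy
    obtain ⟨F, hF, hV⟩ := loc_fin hl htp hinj hdisc R hy.1 hy.2.1
    exact hF.subset fun a ha => hV.self_of_nhds a (wt_ne R a hy.1 ha)
  have hpos : ∀ y ∈ UR k R, 0 < ∑ᶠ a, wt k R a y := by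
    intro y hy
    obtain ⟨a, ha⟩ := hy.2.2
    exact lt_of_lt_of_le (wt_pos R a hy.1 ha) (single_le_finsum a (hfin y hy)
      fun b => Real.smoothTransition.nonneg _)
  refine ⟨fun y => (∑ᶠ a, wt k R a y)⁻¹ • ∑ᶠ a, wt k R a y • c a, ?_, ?_, ?_⟩
  · intro y hy
    obtain ⟨F, hF, hV⟩ := loc_fin hl htp hinj hdisc R hy.1 hy.2.1
    have hQ : ∀ᶠ z in 𝓝 y, lorentzQ m z < 0 :=
      (continuous_Q.tendsto y).eventually_lt_const hy.1
    have hw : ContDiffAt ℝ 1 (fun y => ∑ᶠ a, wt k R a y) y := by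
      refine fs_contDiffAt (f := wt k R) hF ?_ fun a => wt_contDiffAt R a hy.1
      filter_upwards [hV, hQ] with z h1 h2 a ha
      exact h1 a (wt_ne R a h2 ha)
    refine ContDiffAt.smul (ContDiffAt.inv hw (hpos y hy).ne') ?_
    · refine fs_contDiffAt hF ?_ fun a => (wt_contDiffAt R a hy.1).smul contDiffAt_const
      filter_upwards [hV, hQ] with z h1 h2 a ha
      exact h1 a (wt_ne R a h2 fun h0 => ha (by rw [h0, zero_smul]))
  · intro b y hy
    simp only
    have e1 : ∑ᶠ a, wt k R a (k b y) = ∑ᶠ a, wt k R a y := by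
      rw [← finsum_comp_equiv (Equiv.mulLeft b)]
      exact finsum_congr fun a => wt_equiv hl R a b y
    have e2 : ∑ᶠ a, wt k R a (k b y) • c a =
        (∑ᶠ a, wt k R a y) • c b + k b (∑ᶠ a, wt k R a y • c a) := by
      rw [← finsum_comp_equiv (Equiv.mulLeft b)]
      have f1 : (Function.support fun a => wt k R a y • c b).Finite :=
        (hfin y hy).subset fun a ha h0 => ha (by simp [h0])
      have f2 : (Function.support fun a => k b (wt k R a y • c a)).Finite :=
        (hfin y hy).subset fun a ha h0 => ha (by simp [h0])
      have f3 : (Function.support fun a => wt k R a y • c a).Finite :=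
        (hfin y hy).subset fun a ha h0 => ha (by simp [h0])
      calc _ = ∑ᶠ a, (wt k R a y • c b + k b (wt k R a y • c a)) := by
            refine finsum_congr fun a => ?_
            rw [Equiv.coe_mulLeft, wt_equiv hl, hc, smul_add, map_smul]
        _ = _ := by
            rw [finsum_add_distrib f1 f2, finsum_smul]
            congr 1
            exact ((k b : Vec (m + 2) →+ Vec (m + 2)).map_finsum f3).symm
    rw [e1, e2, smul_add, smul_smul, inv_mul_cancel₀ (hpos y hy).ne', one_smul, map_smul]
  · intro y s hs
    simp only [wt_smul R _ y hs]

end Hc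
end LZ

namespace LZ
open scoped commutatorElement
open Filter Topology

variable {m : ℕ}
variable {G : Type*} [Group G] {ℓ : G →* (Vec (m + 2) →L[ℝ] Vec (m + 2))} {τ : G → Vec (m + 2)}

/-- the open future cone -/
def FC (y : Vec (m + 2)) : Prop := lorentzQ m y < 0 ∧ 0 < tm y

lemma FC.add {x y : Vec (m + 2)} (hx : FC x) (hy : FC y) : FC (x + y) := by
  refine ⟨?_, ?_⟩
  · rw [Q_add]
    have := lb_neg hx.1 hx.2 hy.1.le hy.2
    linarith [hx.1, hy.1]
  · rw [tm_add]; linarith [hx.2, hy.2]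

lemma FC.smul {x : Vec (m + 2)} (hx : FC x) {s : ℝ} (hs : 0 < s) : FC (s • x) := by
  refine ⟨?_, ?_⟩
  · rw [Q_smul]
    have := hx.1
    have : 0 < s ^ 2 := by positivity
    nlinarith
  · rw [tm_smul]; exact mul_pos hs hx.2

lemma FC.finsum {A : Type*} {w : A → ℝ} {v : A → Vec (m + 2)} (hf : {a | w a ≠ 0}.Finite)
    (hw : ∀ a, 0 ≤ w a) (hv : ∀ a, FC (v a)) {b : A} (hb : 0 < w b) :
    FC (∑ᶠ a, w a • v a) := by
  classical
  rw [finsum_eq_sum_of_support_subset (s := hf.toFinset) _ (by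
    intro a ha
    simp only [Set.Finite.coe_toFinset]
    intro h0
    exact ha (by simp [h0]))]
  rw [← Finset.add_sum_erase _ _ (hf.mem_toFinset.2 (show w b ≠ 0 from hb.ne'))]
  have key : ∀ s : Finset A, (∑ a ∈ s, w a • v a) = 0 ∨ FC (∑ a ∈ s, w a • v a) := by
    intro s
    induction s using Finset.induction_on with
    | empty => left; simp
    | insert a s has ih =>
      rw [Finset.sum_insert has]
      rcases (hw a).eq_or_lt with h0 | h0
      · rw [← h0, zero_smul, zero_add]; exact ih
      · right
        rcases ih with h1 | h1
        · rw [h1, add_zero]; exact (hv a).smul h0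
        · exact ((hv a).smul h0).add h1
  rcases key (hf.toFinset.erase b) with h1 | h1
  · rw [h1, add_zero]; exact (hv b).smul hb
  · exact ((hv b).smul hb).add h1

lemma TP.fc {L : Vec (m + 2) →L[ℝ] Vec (m + 2)} (hL : Lor m L) (hT : TP L) {x : Vec (m + 2)}
    (hx : FC x) : FC (L x) := ⟨by rw [hL]; exact hx.1, hT _ hx.1.le hx.2⟩

lemma FC_e0 : FC (e0 m) := ⟨by rw [Q_e0]; norm_num, by rw [tm_e0]; norm_num⟩

/-- an equivariant smooth map to the future cone -/
lemma equiv_f (h : IsAct ℓ τ) (htp : ∀ g, TP (ℓ g)) :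
    ∃ f : Vec (m + 2) → Vec (m + 2), ContDiff ℝ 1 f ∧ (∀ x, FC (f x)) ∧
      ∀ g x, f (ℓ g x + τ g) = ℓ g (f x) := by
  obtain ⟨R', hR'⟩ := h.cc
  obtain ⟨R, hRp, hR⟩ : ∃ R : ℝ, 0 < R ∧ ∀ x, ∃ g, ‖ℓ g x + τ g‖ ≤ R :=
    ⟨max R' 1, lt_of_lt_of_le one_pos (le_max_right _ _),
      fun x => (hR' x).imp fun g hg => hg.trans (le_max_left _ _)⟩
  let φ : ContDiffBump (0 : Vec (m + 2)) := ⟨R, R + 1, hRp, by linarith⟩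
  have hφ : ∀ x, φ x ≠ 0 → ‖x‖ ≤ R + 1 := by
    intro x hx
    have : x ∈ Function.support φ := hx
    rw [φ.support_eq, mem_ball_zero_iff] at this
    exact this.le
  have hlf : ∀ x, ∃ F : Set G, F.Finite ∧ ∀ᶠ y in 𝓝 x, ∀ g, φ (ℓ g y + τ g) ≠ 0 → g ∈ F := by
    intro x
    refine ⟨_, h.pd (max (‖x‖ + 1) (R + 1)), ?_⟩
    have : ∀ᶠ y in 𝓝 x, ‖y‖ < ‖x‖ + 1 :=
      (continuous_norm.tendsto x).eventually_lt_const (by linarith)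
    filter_upwards [this] with y hy g hg
    exact ⟨y, hy.le.trans (le_max_left _ _), (hφ _ hg).trans (le_max_right _ _)⟩
  refine ⟨fun x => ∑ᶠ g, φ (ℓ g x + τ g) • ℓ g⁻¹ (e0 m), ?_, ?_, ?_⟩
  · rw [contDiff_iff_contDiffAt]
    intro x
    obtain ⟨F, hF, hV⟩ := hlf x
    refine fs_contDiffAt (f := fun g x => φ (ℓ g x + τ g) • ℓ g⁻¹ (e0 m)) hF ?_ fun g => ?_
    · filter_upwards [hV] with y hy g hg
      exact hy g fun h0 => hg (by simp [h0])
    · have h1 : ContDiff ℝ 1 φ := φ.contDiff (n := 1)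
      have h2 : ContDiff ℝ 1 fun x => ℓ g x + τ g := (ℓ g).contDiff.add contDiff_const
      exact ((h1.comp h2).smul contDiff_const).contDiffAt
  · intro x
    obtain ⟨F, hF, hV⟩ := hlf x
    obtain ⟨b, hb⟩ := hR x
    refine FC.finsum (hF.subset fun g hg => hV.self_of_nhds g hg) (fun g => φ.nonneg)
      (fun g => (htp g⁻¹).fc (h.lor _) FC_e0) (b := b) ?_
    rw [φ.one_of_mem_closedBall (mem_closedBall_zero_iff.2 hb)]
    exact one_pos
  · intro d x
    simp only
    obtain ⟨F, hF, hV⟩ := hlf x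
    have f3 : (Function.support fun g => φ (ℓ g x + τ g) • ℓ g⁻¹ (e0 m)).Finite :=
      hF.subset fun g hg => hV.self_of_nhds g fun h0 => hg (by simp [h0])
    have e := (ℓ d : Vec (m + 2) →+ Vec (m + 2)).map_finsum f3
    refine Eq.trans ?_ e.symm
    rw [← finsum_comp_equiv (Equiv.mulRight d)
      (f := fun g => (ℓ d : Vec (m + 2) →+ Vec (m + 2)) (φ (ℓ g x + τ g) • ℓ g⁻¹ (e0 m)))]
    refine finsum_congr fun g => ?_
    change _ = ℓ d (φ (ℓ (g * d) x + τ (g * d)) • ℓ (g * d)⁻¹ (e0 m))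
    rw [act_mul h, map_smul, mul_inv_rev, mul_app, app_inv]

theorem deg_step (h : IsAct ℓ τ) (htp : ∀ g, TP (ℓ g))
    (hdisc : ∃ ε > 0, ∀ g, ‖ℓ g - 1‖ < ε → ℓ g = 1)
    (hB : ∀ x ∈ Bsp ℓ τ, x ≠ 0 → 0 < lorentzQ m x) : False := by
  obtain ⟨P, p1, p2, p3, p4⟩ := exists_proj (Bsp ℓ τ) (by
    intro x hx hy
    by_contra h0
    have := hB x hx h0
    rw [← lb_self, hy x hx] at this
    exact lt_irrefl _ this)
  have pp : ∀ x, P (P x) = P x := fun x => p4 _ fun y hy => p1 x y hy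
  have pc : ∀ g x, P (ℓ g x) = ℓ g (P x) := fun g =>
    proj_comm p1 p2 p3 p4 (h.lor g) (Bsp_inv h g)
      fun x hx => ⟨ℓ g⁻¹ x, Bsp_inv h g⁻¹ x hx, app_inv ℓ g x⟩
  have pt : ∀ t, ℓ t = 1 → P (τ t) = 0 := fun t ht => p3 _ (Submodule.subset_span ⟨t, ht, rfl⟩)
  have pFC : ∀ y, FC y → FC (P y) := by
    intro y hy
    have h1 : lb m y (P y) = lorentzQ m (P y) := by
      have := p1 y (y - P y) (p2 y)
      rw [map_sub, LinearMap.sub_apply, lb_self] at this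
      linarith
    have h2 : 0 ≤ lorentzQ m (y - P y) := by
      by_cases h0 : y - P y = 0
      · rw [h0, Q_zero]
      · exact (hB _ (p2 y) h0).le
    rw [Q_sub, h1] at h2
    have h3 : lorentzQ m (P y) < 0 := by linarith [hy.1]
    refine ⟨h3, ?_⟩
    have h4 : P y ≠ 0 := fun h0 => by rw [h0, Q_zero] at h3; exact lt_irrefl _ h3
    by_contra hle
    have h5 : tm (P y) < 0 := lt_of_le_of_ne (not_lt.1 hle) (tm_ne_zero h3.le h4)
    have h6 := lb_neg hy.1 hy.2 (y := -P y) (by rw [Q_neg]; exact h3.le)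
      (by rw [tm_neg]; linarith)
    rw [map_neg, h1] at h6
    linarith
  obtain ⟨f, fC, fFC, fe⟩ := equiv_f h htp
  -- quotient group
  let k : (G ⧸ ℓ.ker) →* (Vec (m + 2) →L[ℝ] Vec (m + 2)) := QuotientGroup.lift ℓ.ker ℓ le_rfl
  have kmk : ∀ g : G, k (g : G ⧸ ℓ.ker) = ℓ g := fun g => rfl
  have ksurj : ∀ a : G ⧸ ℓ.ker, ∃ g : G, (g : G ⧸ ℓ.ker) = a := QuotientGroup.mk_surjective
  have cwd : ∀ g g' : G, (g : G ⧸ ℓ.ker) = g' → P (τ g) = P (τ g') := by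
    intro g g' hgg
    have h1 : ℓ (g⁻¹ * g') = 1 := QuotientGroup.eq.1 hgg
    have h2 : τ g' = τ g + ℓ g (τ (g⁻¹ * g')) := by
      rw [← h.coc]; simp
    rw [h2, map_add, pc, pt _ h1, map_zero, add_zero]
  let c : G ⧸ ℓ.ker → Vec (m + 2) := fun a => P (τ a.out)
  have cmk : ∀ g : G, c (g : G ⧸ ℓ.ker) = P (τ g) := fun g =>
    cwd _ _ (QuotientGroup.out_eq' _)
  have kl : ∀ a, Lor m (k a) := by
    intro a; obtain ⟨g, rfl⟩ := ksurj a; exact h.lor g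
  have ktp : ∀ a, TP (k a) := by
    intro a; obtain ⟨g, rfl⟩ := ksurj a; exact htp g
  have kinj : ∀ a, k a = 1 → a = 1 := by
    intro a ha; obtain ⟨g, rfl⟩ := ksurj a
    exact (QuotientGroup.eq_one_iff g).2 ha
  have kd : ∃ ε > 0, ∀ a, ‖k a - 1‖ < ε → k a = 1 := by
    obtain ⟨ε, hε, hd⟩ := hdisc
    refine ⟨ε, hε, fun a => ?_⟩
    obtain ⟨g, rfl⟩ := ksurj a
    exact hd g
  have kc : ∀ a b, c (a * b) = c a + k a (c b) := by
    intro a b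
    obtain ⟨g, rfl⟩ := ksurj a
    obtain ⟨g', rfl⟩ := ksurj b
    rw [← QuotientGroup.mk_mul, cmk, cmk, cmk, kmk, h.coc, map_add, pc]
  have hPf : ContDiff ℝ 1 fun x => P (f x) := P.contDiff.comp fC
  obtain ⟨R₀, hR₀⟩ := h.cc
  obtain ⟨C, hC⟩ := (isCompact_closedBall (0 : Vec (m + 2)) R₀).exists_bound_of_continuousOn
    (f := fun x => tm (P (f x)) ^ 2 / (-lorentzQ m (P (f x)))) (by
      refine Continuous.continuousOn ?_
      refine ((continuous_tm.comp hPf.continuous).pow 2).div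
        (continuous_Q.comp hPf.continuous).neg fun x => ?_
      have := (pFC _ (fFC x)).1
      linarith)
  obtain ⟨H, H1, H2, H3⟩ := H_construct kl ktp kinj kd kc (C + 1)
  have hUR : ∀ x, P (f x) ∈ UR k (C + 1) := by
    intro x
    refine ⟨(pFC _ (fFC x)).1, (pFC _ (fFC x)).2, ?_⟩
    obtain ⟨g, hg⟩ := hR₀ x
    refine ⟨((g⁻¹ : G) : G ⧸ ℓ.ker), ?_⟩
    have h1 := hC _ (mem_closedBall_zero_iff.2 hg)
    rw [fe, pc, h.lor g] at h1
    have h2 := (pFC _ (fFC x)).1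
    have h3 := lt_of_le_of_lt ((le_abs_self _).trans h1) (lt_add_one C)
    rw [div_lt_iff₀ (by linarith)] at h3
    rw [← QuotientGroup.mk_inv, inv_inv, kmk]
    exact h3
  let hh : Vec (m + 2) → Vec (m + 2) := fun x => x - P x + H (P (f x))
  have hhC : ContDiff ℝ 1 hh := by
    rw [contDiff_iff_contDiffAt]
    intro x
    refine (contDiffAt_id.sub P.contDiff.contDiffAt).add ?_
    exact ContDiffAt.comp (g := H) (f := fun x => P (f x)) x (H1 _ (hUR x)) hPf.contDiffAt
  have hhe : ∀ g x, hh (ℓ g x + τ g) = ℓ g (hh x) + τ g := by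
    intro g x
    have := H2 (g : G ⧸ ℓ.ker) _ (hUR x)
    rw [kmk, cmk] at this
    simp only [hh]
    rw [fe, pc, this, map_add, map_add, map_sub, pc]
    abel
  obtain ⟨x, hx⟩ := MR h hhC hhe
  refine hx ?_
  set y := P (f x) with hy
  have dH : HasFDerivAt H (fderiv ℝ H y) y :=
    ((H1 _ (hUR x)).differentiableAt one_ne_zero).hasFDerivAt
  have df : HasFDerivAt f (fderiv ℝ f x) x := (fC.differentiable one_ne_zero x).hasFDerivAt
  have dPf : HasFDerivAt (fun x => P (f x)) (P.comp (fderiv ℝ f x)) x :=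
    P.hasFDerivAt.comp x df
  let Φ : Vec (m + 2) →L[ℝ] Vec (m + 2) := (1 - P) + (fderiv ℝ H y).comp P
  let Ψ : Vec (m + 2) →L[ℝ] Vec (m + 2) := (1 - P) + P.comp (fderiv ℝ f x)
  have dh : HasFDerivAt hh (Φ.comp Ψ) x := by
    have h1 : HasFDerivAt hh ((1 - P) + (fderiv ℝ H y).comp (P.comp (fderiv ℝ f x))) x :=
      ((hasFDerivAt_id x).sub P.hasFDerivAt).add
        (HasFDerivAt.comp (g := H) (f := fun x => P (f x)) x dH dPf)
    convert h1 using 1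
    ext1 w
    change (((w - P w) + P (fderiv ℝ f x w)) - P ((w - P w) + P (fderiv ℝ f x w))) +
      fderiv ℝ H y (P ((w - P w) + P (fderiv ℝ f x w))) =
      (w - P w) + fderiv ℝ H y (P (fderiv ℝ f x w))
    have : P ((w - P w) + P (fderiv ℝ f x w)) = P (fderiv ℝ f x w) := by
      rw [map_add, map_sub, pp, pp, sub_self, zero_add]
    rw [this]; abel
  rw [dh.fderiv, det_comp']
  have hy0 : y ≠ 0 := by
    intro h0
    have := (hUR x).1
    rw [← hy, h0, Q_zero] at this
    exact lt_irrefl _ this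
  have hHy : fderiv ℝ H y y = 0 := by
    have h1 : HasDerivAt (fun s : ℝ => s • y) y 1 := by
      simpa using (hasDerivAt_id (1 : ℝ)).smul_const y
    have h2 : HasDerivAt (fun s : ℝ => H (s • y)) (fderiv ℝ H y y) 1 := by
      have h3 : HasFDerivAt H (fderiv ℝ H y) ((1 : ℝ) • y) := by rw [one_smul]; exact dH
      exact HasFDerivAt.comp_hasDerivAt (1 : ℝ) h3 h1
    have h4 : HasDerivAt (fun s : ℝ => H (s • y)) 0 1 := by
      refine (hasDerivAt_const (1 : ℝ) (H y)).congr_of_eventuallyEq ?_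
      filter_upwards [lt_mem_nhds (zero_lt_one : (0 : ℝ) < 1)] with s hs
      exact H3 y s hs
    exact h2.unique h4
  have hΦ : Φ.det = 0 := by
    refine LinearMap.det_eq_zero_iff_ker_ne_bot.2 fun hk => hy0 ?_
    have : y ∈ LinearMap.ker (Φ : Vec (m + 2) →ₗ[ℝ] Vec (m + 2)) := by
      rw [LinearMap.mem_ker]
      change (y - P y) + fderiv ℝ H y (P y) = 0
      have : P y = y := pp _
      rw [this, sub_self, hHy, add_zero]
    rw [hk] at this
    exact (Submodule.mem_bot ℝ).1 this
  rw [hΦ, zero_mul]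

theorem main_tp (h : IsAct ℓ τ) (htp : ∀ g, TP (ℓ g)) : VSt G := by
  by_contra hns
  obtain ⟨v, hv, hv1, -⟩ := F_step h htp hns
  have hdisc := D_step h hv hv1
  by_cases h1 : ∃ x ∈ Bsp ℓ τ, lorentzQ m x < 0
  · obtain ⟨x, hx, hx'⟩ := h1
    exact hns (trans_timelike h hx hx')
  push Not at h1
  by_cases h2 : ∃ x ∈ Bsp ℓ τ, x ≠ 0 ∧ lorentzQ m x = 0
  · obtain ⟨x, hx, hx0, hx'⟩ := h2
    exact hns (trans_null h h1 hx hx0 hx')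
  push Not at h2
  exact deg_step h htp hdisc fun x hx hx0 => lt_of_le_of_ne (h1 x hx) (h2 x hx hx0).symm

end LZ

namespace LZ
open scoped commutatorElement
open Filter Topology

variable {m : ℕ}
variable {G : Type*} [Group G] {ℓ : G →* (Vec (m + 2) →L[ℝ] Vec (m + 2))} {τ : G → Vec (m + 2)}

open Classical in
/-- the time orientation character -/
def sgn (hl : ∀ g, Lor m (ℓ g)) : G →* ℤˣ :=
  MonoidHom.mk' (fun g => if 0 < tm (ℓ g (e0 m)) then 1 else -1) (by
    intro a b
    have hQ : lorentzQ m (e0 m) ≤ 0 := FC_e0.1.le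
    have hb : lorentzQ m (ℓ b (e0 m)) ≤ 0 := by rw [hl b]; exact hQ
    have hb' : lorentzQ m (-(ℓ b (e0 m))) ≤ 0 := by rw [Q_neg]; exact hb
    have e : ℓ (a * b) (e0 m) = ℓ a (ℓ b (e0 m)) := mul_app ℓ a b _
    rw [e]
    by_cases h1 : 0 < tm (ℓ a (e0 m)) <;> by_cases h2 : 0 < tm (ℓ b (e0 m))
    · have := TP_of_e0 (hl a) h1 _ hb h2
      simp [h1, h2, this]
    · have h3 := tm_neg_of_not (hl b) h2 hQ FC_e0.2
      have := TP_of_e0 (hl a) h1 _ hb' (by rw [tm_neg]; linarith)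
      rw [map_neg, tm_neg] at this
      have h4 : ¬ 0 < tm (ℓ a (ℓ b (e0 m))) := by linarith
      simp [h1, h2, h4]
    · have := tm_neg_of_not (hl a) h1 hb h2
      have h4 : ¬ 0 < tm (ℓ a (ℓ b (e0 m))) := by linarith
      simp [h1, h2, h4]
    · have h3 := tm_neg_of_not (hl b) h2 hQ FC_e0.2
      have := tm_neg_of_not (hl a) h1 hb' (by rw [tm_neg]; linarith)
      rw [map_neg, tm_neg] at this
      have h4 : 0 < tm (ℓ a (ℓ b (e0 m))) := by linarith
      simp [h1, h2, h4])

theorem main_all (h : IsAct ℓ τ) : VSt G := by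
  have hfi : (sgn h.lor).ker.FiniteIndex := inferInstance
  refine VSt.of_sub (sgn h.lor).ker hfi (main_tp (h.res _ hfi) ?_)
  rintro ⟨g, hg⟩
  refine TP_of_e0 (h.lor g) ?_
  by_contra hn
  have h1 : sgn h.lor g = 1 := hg
  have h2 : sgn h.lor g = -1 := by
    simp only [sgn, MonoidHom.mk'_apply]
    exact if_neg hn
  rw [h1] at h2
  exact absurd h2 (by decide)

/-- the linear part as a homomorphism -/
def linPart (Γ : Subgroup (AffGroup (m + 2))) : Γ →* (Vec (m + 2) →L[ℝ] Vec (m + 2)) where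
  toFun g := LinearMap.toContinuousLinearMap
    ((g : AffGroup (m + 2)).linear : Vec (m + 2) →ₗ[ℝ] Vec (m + 2))
  map_one' := by ext1 x; rfl
  map_mul' a b := by ext1 x; rfl

lemma linPart_apply (Γ : Subgroup (AffGroup (m + 2))) (g : Γ) (x : Vec (m + 2)) :
    linPart Γ g x = (g : AffGroup (m + 2)).linear x := rfl

lemma aff_apply (Γ : Subgroup (AffGroup (m + 2))) (g : Γ) (x : Vec (m + 2)) :
    linPart Γ g x + (g : AffGroup (m + 2)) 0 = (g : AffGroup (m + 2)) x := by
  have := (g : AffGroup (m + 2)).map_vadd 0 x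
  rw [vadd_eq_add, vadd_eq_add, add_zero] at this
  rw [this]; rfl

lemma isAct_of (Γ : Subgroup (AffGroup (m + 2)))
    (hLor : ∀ γ ∈ Γ, ∀ v : Vec (m + 2), lorentzQ m (γ.linear v) = lorentzQ m v)
    (hPD : ProperlyDisc Γ) (hCC : CocompactAction Γ) :
    IsAct (linPart Γ) fun g => (g : AffGroup (m + 2)) 0 where
  coc a b := by
    have := aff_apply Γ a ((b : AffGroup (m + 2)) 0)
    change (a : AffGroup (m + 2)) ((b : AffGroup (m + 2)) 0) = _
    rw [← this]; abel
  lor g := fun x => hLor g g.2 x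
  inj g h1 h2 := by
    apply Subtype.ext
    apply AffineEquiv.ext
    intro x
    rw [← aff_apply Γ g x, h1, h2, add_zero]; rfl
  pd R := by
    have := (hPD _ (isCompact_closedBall (0 : Vec (m + 2)) R)).preimage
      (f := ((↑) : Γ → AffGroup (m + 2))) Subtype.val_injective.injOn
    refine this.subset ?_
    rintro g ⟨x, hx, hgx⟩
    rw [aff_apply] at hgx
    exact ⟨g.2, _, ⟨x, mem_closedBall_zero_iff.2 hx, rfl⟩, mem_closedBall_zero_iff.2 hgx⟩
  cc := by
    obtain ⟨K, hK, hc⟩ := hCC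
    obtain ⟨R, hR⟩ := hK.isBounded.exists_norm_le
    refine ⟨R, fun x => ?_⟩
    obtain ⟨g, hg, hgx⟩ := hc x
    refine ⟨⟨g, hg⟩, ?_⟩
    rw [aff_apply]
    exact hR _ hgx

end LZ

/-- The Auslander–Milnor conjecture for compact complete Lorentzian flat manifolds:
every subgroup `Γ` of the Lorentzian isometry group `E(m+1,1) = ℝ^{m+2} ⋊ O(m+1,1)`
acting freely, properly discontinuously and cocompactly on `ℝ^{m+2}` is virtually
solvable. -/
theorem statement14 (m : ℕ) (Γ : Subgroup (AffGroup (m + 2)))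
    (hLor : ∀ γ ∈ Γ, ∀ v : Vec (m + 2), lorentzQ m (γ.linear v) = lorentzQ m v)
    (hFree : FreeAction Γ) (hPD : ProperlyDisc Γ) (hCC : CocompactAction Γ) :
    ∃ H : Subgroup ↥Γ, H.FiniteIndex ∧ IsSolvable ↥H := by
  obtain ⟨H, hH, hs⟩ := LZ.main_all (LZ.isAct_of Γ hLor hPD hCC)
  exact ⟨H, hH, hs⟩
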